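/- For every ε₀ > 0 there exists a constant C = C(ε₀) < ∞ such that for all integers k ≥ 1 and all R ≥ 1, the spectral sample 𝒮 of the radial indicator f_R of critical bond percolation on ℤ² satisfies 𝐏̂_{f_R}[ |𝒮| < k and 𝒮 ⊄ (−exp(k^{ε₀}), exp(k^{ε₀}))² ] ≤ C · α₁(R) · exp(−k^{ε₀}/C). -/

import Mathlib

open scoped BigOperators

namespace DynPerc

/-- Vertices of the square lattice `ℤ²`. -/
abbrev Vertex : Type := ℤ × ℤ

/-- An edge of `ℤ²`, encoded by an endpoint together with a direction:
`(v, true)` is the horizontal edge from `v` to `(v₁+1, v₂)`, and `(v, false)` is the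
vertical edge from `v` to `(v₁, v₂+1)`. -/
abbrev Edge : Type := Vertex × Bool

/-- The midpoint of an edge, as a point of `ℝ²`. -/
noncomputable def midpoint (e : Edge) : ℝ × ℝ :=
  if e.2 then ((e.1.1 : ℝ) + 1 / 2, (e.1.2 : ℝ)) else ((e.1.1 : ℝ), (e.1.2 : ℝ) + 1 / 2)

/-- The edge `e` (a closed unit segment of the plane) intersects the square `[-R, R]²`. -/
def Intersects (R : ℝ) (e : Edge) : Prop :=
  if e.2 then |(e.1.2 : ℝ)| ≤ R ∧ (e.1.1 : ℝ) ≤ R ∧ -R ≤ (e.1.1 : ℝ) + 1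
  else |(e.1.1 : ℝ)| ≤ R ∧ (e.1.2 : ℝ) ≤ R ∧ -R ≤ (e.1.2 : ℝ) + 1

/-- The finite set `𝓘_R` of edges of `ℤ²` intersecting the square `[-R, R]²`. -/
noncomputable def edgeFinset (R : ℝ) : Finset Edge := by
  classical
  exact ((Finset.Icc (-(⌈R⌉ + 2)) (⌈R⌉ + 2) ×ˢ Finset.Icc (-(⌈R⌉ + 2)) (⌈R⌉ + 2)) ×ˢ
      (Finset.univ : Finset Bool)).filter fun e => Intersects R e

/-- A percolation configuration: `true` = open (state `+1`), `false` = closed (state `-1`). -/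
abbrev Config : Type := Edge → Bool

/-- The configuration whose set of open edges is exactly `F`. -/
def cfg (F : Finset Edge) : Config := fun e => decide (e ∈ F)

/-- The probability of the event `A` under the uniform measure on the states of the
edges of `E` (all edges outside `E` being closed).  When `A` is determined by the states
of the edges of `E`, this is the probability of `A` under critical (`p = 1/2`) bond
percolation on `ℤ²`. -/
noncomputable def probOn (E : Finset Edge) (A : Config → Prop) : ℝ := by
  classical
  exact ((E.powerset.filter fun F => A (cfg F)).card : ℝ) / 2 ^ E.card

/-- `v` and `w` are adjacent vertices of `ℤ²` and the edge joining them is open in `ω`. -/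
def OpenAdj (ω : Config) (v w : Vertex) : Prop :=
  (ω (v, true) = true ∧ w = (v.1 + 1, v.2)) ∨ (ω (w, true) = true ∧ v = (w.1 + 1, w.2)) ∨
  (ω (v, false) = true ∧ w = (v.1, v.2 + 1)) ∨ (ω (w, false) = true ∧ v = (w.1, w.2 + 1))

/-- Sup-norm of a vertex of `ℤ²`. -/
noncomputable def supn (v : Vertex) : ℝ := max |(v.1 : ℝ)| |(v.2 : ℝ)|

/-- The one-arm event: the origin is joined to the boundary of `[-R, R]²` by a path of
open edges. -/
def ZeroToBoundary (R : ℝ) (ω : Config) : Prop :=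
  ∃ v : Vertex, Relation.ReflTransGen (OpenAdj ω) ((0 : ℤ), (0 : ℤ)) v ∧ R ≤ supn v

/-- `α₁(ρ)`: the probability of the one-arm event `{0 ↔ ∂[-ρ,ρ]²}` at criticality. -/
noncomputable def alpha1 (ρ : ℝ) : ℝ := probOn (edgeFinset ρ) (ZeroToBoundary ρ)

/-- A dual vertex `d : ℤ × ℤ` stands for the point `(d₁ + 1/2, d₂ + 1/2)` of the dual
lattice `ℤ² + (1/2, 1/2)`.  `ClosedDualAdj ω d d'` says that `d` and `d'` are adjacent
dual vertices and the dual edge joining them is closed, i.e. the primal edge crossing it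
is closed in `ω`. -/
def ClosedDualAdj (ω : Config) (d d' : Vertex) : Prop :=
  (ω ((d.1 + 1, d.2), false) = false ∧ d' = (d.1 + 1, d.2)) ∨
  (ω ((d'.1 + 1, d'.2), false) = false ∧ d = (d'.1 + 1, d'.2)) ∨
  (ω ((d.1, d.2 + 1), true) = false ∧ d' = (d.1, d.2 + 1)) ∨
  (ω ((d'.1, d'.2 + 1), true) = false ∧ d = (d'.1, d'.2 + 1))

/-- Sup-norm of the point of the plane corresponding to a dual vertex. -/
noncomputable def supnD (d : Vertex) : ℝ := max |(d.1 : ℝ) + 1 / 2| |(d.2 : ℝ) + 1 / 2|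

/-- An arm crossing the annulus `[-r₂,r₂]² \ (-r₁,r₁)²`, for the adjacency relation `adj`
and with positions measured by the sup-norm `nrm`: a nonempty path contained in the
annulus whose first vertex lies on (next to) the inner boundary and whose last vertex
lies on (next to) the outer boundary. -/
def IsArm (adj : Vertex → Vertex → Prop) (nrm : Vertex → ℝ) (r₁ r₂ : ℝ)
    (l : List Vertex) : Prop :=
  l ≠ [] ∧ l.Chain' adj ∧ (∀ v ∈ l, r₁ ≤ nrm v ∧ nrm v ≤ r₂) ∧
    nrm l.headI ≤ r₁ + 1 ∧ r₂ - 1 ≤ nrm (l.getLastD ((0 : ℤ), (0 : ℤ)))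

/-- The angular coordinate of a primal vertex. -/
noncomputable def angP (v : Vertex) : ℝ := Complex.arg ⟨(v.1 : ℝ), (v.2 : ℝ)⟩

/-- The angular coordinate of (the point of the plane corresponding to) a dual vertex. -/
noncomputable def angD (d : Vertex) : ℝ := Complex.arg ⟨(d.1 : ℝ) + 1 / 2, (d.2 : ℝ) + 1 / 2⟩

/-- Four points on a circle, with angular coordinates `a, c` (first kind) and `b, d`
(second kind), alternate in cyclic order: the four angles are pairwise distinct and
exactly one of `b`, `d` lies on the arc strictly between `a` and `c`. -/
def Alt4 (a c b d : ℝ) : Prop :=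
  a ≠ c ∧ b ≠ d ∧ b ≠ a ∧ b ≠ c ∧ d ≠ a ∧ d ≠ c ∧
    ((min a c < b ∧ b < max a c) ↔ ¬(min a c < d ∧ d < max a c))

/-- The four-arm event `A₄(r₁, r₂)` in the annulus `[-r₂,r₂]² \ (-r₁,r₁)²`: there are
four disjoint arms joining the inner boundary to the outer boundary which alternate in
cyclic order between paths of open primal edges and paths of closed dual edges.  (An open
primal path and a closed dual path can never cross, and primal and dual vertices are
distinct points of the plane, so disjointness need only be required within each kind.)
When `r₂ ≤ r₁` this is the sure event. -/
def FourArm (r₁ r₂ : ℝ) (ω : Config) : Prop :=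
  r₂ ≤ r₁ ∨
    ∃ o₁ o₂ d₁ d₂ : List Vertex,
      IsArm (OpenAdj ω) supn r₁ r₂ o₁ ∧ IsArm (OpenAdj ω) supn r₁ r₂ o₂ ∧
      IsArm (ClosedDualAdj ω) supnD r₁ r₂ d₁ ∧ IsArm (ClosedDualAdj ω) supnD r₁ r₂ d₂ ∧
      (∀ v ∈ o₁, v ∉ o₂) ∧ (∀ v ∈ d₁, v ∉ d₂) ∧
      Alt4 (angP o₁.headI) (angP o₂.headI) (angD d₁.headI) (angD d₂.headI)

/-- `α₄(r₁, r₂)`: the probability of the four-arm event in `[-r₂,r₂]² \ (-r₁,r₁)²` at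
criticality (the event is determined by the states of the edges meeting
`[-(r₂+1), r₂+1]²`).  `α₄(r) := α₄(1, r)`. -/
noncomputable def alpha4 (r₁ r₂ : ℝ) : ℝ := probOn (edgeFinset (r₂ + 1)) (FourArm r₁ r₂)

/-- The Fourier character `χ_S` evaluated at the configuration whose open-edge set is `F`. -/
noncomputable def chi (S F : Finset Edge) : ℝ := ∏ e ∈ S, (if e ∈ F then (1 : ℝ) else -1)

/-- The Fourier coefficient `f̂_R(S) = 𝐄_{1/2}[f_R · χ_S]` of the radial indicator
`f_R` (the indicator of the one-arm event `{0 ↔ ∂[-R,R]²}`, a function of the states of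
the edges in `𝓘_R`). -/
noncomputable def fourier (R : ℝ) (S : Finset Edge) : ℝ := by
  classical
  exact (∑ F ∈ (edgeFinset R).powerset,
      if ZeroToBoundary R (cfg F) then chi S F else 0) / 2 ^ (edgeFinset R).card

/-- `𝐏̂_{f_R}[𝒜]`: the probability that the spectral sample `𝒮` of `f_R` (the random
subset `S ⊆ 𝓘_R` with law `f̂_R(S)² / α₁(R)`) belongs to the collection `𝒜`. -/
noncomputable def spectralProb (R : ℝ) (𝒜 : Finset Edge → Prop) : ℝ := by
  classical
  exact (∑ S ∈ (edgeFinset R).powerset, if 𝒜 S then fourier R S ^ 2 else 0) / alpha1 R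

/-- `S \ (-r₀,r₀)²`: the part of `S` lying outside the open square `(-r₀, r₀)²`
(sites/edges are identified with their midpoints). -/
noncomputable def outside (r₀ : ℝ) (S : Finset Edge) : Finset Edge := by
  classical
  exact S.filter fun e => ¬(|(midpoint e).1| < r₀ ∧ |(midpoint e).2| < r₀)

/-- `S ⊆ (-r₀,r₀)²`: every point of `S` lies in the open square `(-r₀, r₀)²`. -/
def InBox (r₀ : ℝ) (S : Finset Edge) : Prop :=
  ∀ e ∈ S, |(midpoint e).1| < r₀ ∧ |(midpoint e).2| < r₀

end DynPerc

section
open scoped BigOperators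
open scoped FinsetFamily
namespace DynPerc
open Classical

/-! Part 1: probability -/

lemma sum_powerset_union {X Y : Finset Edge} (h : Disjoint X Y) (g : Finset Edge → ℝ) :
    ∑ F ∈ (X ∪ Y).powerset, g F = ∑ x ∈ X.powerset, ∑ y ∈ Y.powerset, g (x ∪ y) := by
  rw [← Finset.sum_product']
  symm
  refine Finset.sum_bij' (fun p _ => p.1 ∪ p.2) (fun F _ => (F ∩ X, F ∩ Y)) ?_ ?_ ?_ ?_ ?_
  · rintro ⟨x, y⟩ hp
    simp only [Finset.mem_product, Finset.mem_powerset] at hp ⊢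
    exact Finset.union_subset_union hp.1 hp.2
  · intro F hF
    simp only [Finset.mem_product, Finset.mem_powerset]
    exact ⟨Finset.inter_subset_right, Finset.inter_subset_right⟩
  · rintro ⟨x, y⟩ hp
    simp only [Finset.mem_product, Finset.mem_powerset] at hp
    have h1 := Finset.disjoint_left.1 h
    ext e <;> simp only [Finset.mem_inter, Finset.mem_union] <;>
      have := @hp.1 e <;> have := @hp.2 e <;> have := @h1 e <;> tauto
  · intro F hF
    simp only [Finset.mem_powerset] at hF
    ext e
    have := @hF e
    simp only [Finset.mem_inter, Finset.mem_union] at *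
    tauto
  · simp

def Dep (A : Config → Prop) (E : Set Edge) : Prop :=
  ∀ ω ω' : Config, (∀ e ∈ E, ω e = ω' e) → (A ω ↔ A ω')

lemma Dep.mono {A : Config → Prop} {E E' : Set Edge} (h : Dep A E) (hE : E ⊆ E') : Dep A E' :=
  fun ω ω' hw => h ω ω' fun e he => hw e (hE he)

lemma Dep.and {A B : Config → Prop} {E : Set Edge} (h : Dep A E) (h' : Dep B E) :
    Dep (fun ω => A ω ∧ B ω) E := fun ω ω' hw => and_congr (h ω ω' hw) (h' ω ω' hw)

lemma Dep.or {A B : Config → Prop} {E : Set Edge} (h : Dep A E) (h' : Dep B E) :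
    Dep (fun ω => A ω ∨ B ω) E := fun ω ω' hw => or_congr (h ω ω' hw) (h' ω ω' hw)

lemma Dep.not {A : Config → Prop} {E : Set Edge} (h : Dep A E) :
    Dep (fun ω => ¬ A ω) E := fun ω ω' hw => not_congr (h ω ω' hw)

lemma probOn_eq_sum (E : Finset Edge) (A : Config → Prop) :
    probOn E A = (∑ F ∈ E.powerset, if A (cfg F) then (1 : ℝ) else 0) / 2 ^ E.card := by
  unfold probOn
  rw [Finset.sum_boole]

lemma cfg_union_left {X Y x y : Finset Edge} (h : Disjoint X Y) (hy : y ⊆ Y) :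
    ∀ e ∈ X, cfg (x ∪ y) e = cfg x e := by
  intro e he
  have : e ∉ y := fun h' => Finset.disjoint_left.1 h he (hy h')
  simp [cfg, this]

lemma cfg_union_right {X Y x y : Finset Edge} (h : Disjoint X Y) (hx : x ⊆ X) :
    ∀ e ∈ Y, cfg (x ∪ y) e = cfg y e := by
  intro e he
  have : e ∉ x := fun h' => Finset.disjoint_left.1 h (hx h') he
  simp [cfg, this]

lemma probOn_indep {X Y : Finset Edge} (h : Disjoint X Y) {A B : Config → Prop}
    (hA : Dep A X) (hB : Dep B Y) :
    probOn (X ∪ Y) (fun ω => A ω ∧ B ω) = probOn X A * probOn Y B := by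
  rw [probOn_eq_sum, probOn_eq_sum, probOn_eq_sum, sum_powerset_union h,
    Finset.card_union_of_disjoint h, pow_add, div_mul_div_comm, Finset.sum_mul_sum]
  congr 1
  refine Finset.sum_congr rfl fun x hx => Finset.sum_congr rfl fun y hy => ?_
  rw [Finset.mem_powerset] at hx hy
  have h1 := hA (cfg (x ∪ y)) (cfg x) (cfg_union_left h hy)
  have h2 := hB (cfg (x ∪ y)) (cfg y) (cfg_union_right h hx)
  simp only [h1, h2]
  by_cases a : A (cfg x) <;> by_cases b : B (cfg y) <;> simp [a, b]

lemma probOn_true (E : Finset Edge) : probOn E (fun _ => True) = 1 := by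
  rw [probOn_eq_sum]
  simp

lemma probOn_superset {E E' : Finset Edge} (h : E ⊆ E') {A : Config → Prop} (hA : Dep A E) :
    probOn E' A = probOn E A := by
  have h1 := probOn_indep (X := E) (Y := E' \ E) Finset.disjoint_sdiff hA
    (B := fun _ => True) (fun _ _ _ => Iff.rfl)
  rw [probOn_true, mul_one, Finset.union_sdiff_of_subset h] at h1
  simpa using h1

noncomputable def Pr (A : Config → Prop) : ℝ :=
  if h : ∃ E : Finset Edge, Dep A E then probOn h.choose A else 0

def Loc (A : Config → Prop) : Prop := ∃ E : Finset Edge, Dep A E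

lemma Pr_eq {A : Config → Prop} {E : Finset Edge} (h : Dep A E) : Pr A = probOn E A := by
  have hx : ∃ E : Finset Edge, Dep A E := ⟨E, h⟩
  unfold Pr
  rw [dif_pos hx, ← probOn_superset (Finset.subset_union_left (s₂ := E)) hx.choose_spec,
    ← probOn_superset (Finset.subset_union_right (s₁ := hx.choose)) h]

lemma Loc.and {A B : Config → Prop} (h : Loc A) (h' : Loc B) : Loc (fun ω => A ω ∧ B ω) := by
  obtain ⟨E, h⟩ := h
  obtain ⟨E', h'⟩ := h'
  exact ⟨E ∪ E', (h.mono (by simp)).and (h'.mono (by simp))⟩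

lemma Loc.or {A B : Config → Prop} (h : Loc A) (h' : Loc B) : Loc (fun ω => A ω ∨ B ω) := by
  obtain ⟨E, h⟩ := h
  obtain ⟨E', h'⟩ := h'
  exact ⟨E ∪ E', (h.mono (by simp)).or (h'.mono (by simp))⟩

lemma Loc.not {A : Config → Prop} (h : Loc A) : Loc (fun ω => ¬ A ω) := by
  obtain ⟨E, h⟩ := h
  exact ⟨E, h.not⟩

lemma Loc.common {A B : Config → Prop} (h : Loc A) (h' : Loc B) :
    ∃ E : Finset Edge, Dep A E ∧ Dep B E := by
  obtain ⟨E, h⟩ := h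
  obtain ⟨E', h'⟩ := h'
  exact ⟨E ∪ E', (h.mono (by simp)), (h'.mono (by simp))⟩

lemma probOn_mono {E : Finset Edge} {A B : Config → Prop} (h : ∀ ω, A ω → B ω) :
    probOn E A ≤ probOn E B := by
  rw [probOn_eq_sum, probOn_eq_sum]
  gcongr with F hF
  by_cases a : A (cfg F)
  · simp [a, h _ a]
  · simp only [a, if_false]; split_ifs <;> norm_num

lemma Pr_mono {A B : Config → Prop} (hA : Loc A) (hB : Loc B) (h : ∀ ω, A ω → B ω) :
    Pr A ≤ Pr B := by
  obtain ⟨E, h1, h2⟩ := hA.common hB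
  rw [Pr_eq h1, Pr_eq h2]
  exact probOn_mono h

lemma probOn_nonneg (E : Finset Edge) (A : Config → Prop) : 0 ≤ probOn E A := by
  rw [probOn_eq_sum]
  positivity

lemma probOn_le_one (E : Finset Edge) (A : Config → Prop) : probOn E A ≤ 1 := by
  rw [← probOn_true E]
  exact probOn_mono fun _ _ => trivial

lemma Pr_nonneg (A : Config → Prop) : 0 ≤ Pr A := by
  unfold Pr
  split_ifs
  · exact probOn_nonneg _ _
  · exact le_rfl

lemma Pr_le_one (A : Config → Prop) : Pr A ≤ 1 := by
  unfold Pr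
  split_ifs
  · exact probOn_le_one _ _
  · norm_num

lemma Pr_not {A : Config → Prop} (hA : Loc A) : Pr (fun ω => ¬ A ω) = 1 - Pr A := by
  obtain ⟨E, h⟩ := hA
  rw [Pr_eq h, Pr_eq h.not, ← probOn_true E, probOn_eq_sum, probOn_eq_sum, probOn_eq_sum,
    ← sub_div, ← Finset.sum_sub_distrib]
  congr 1
  refine Finset.sum_congr rfl fun F _ => ?_
  by_cases a : A (cfg F) <;> simp [a]

lemma Pr_or_le {A B : Config → Prop} (hA : Loc A) (hB : Loc B) :
    Pr (fun ω => A ω ∨ B ω) ≤ Pr A + Pr B := by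
  obtain ⟨E, h1, h2⟩ := hA.common hB
  rw [Pr_eq h1, Pr_eq h2, Pr_eq (h1.or h2), probOn_eq_sum, probOn_eq_sum, probOn_eq_sum,
    ← add_div, ← Finset.sum_add_distrib]
  gcongr with F hF
  by_cases a : A (cfg F) <;> by_cases b : B (cfg F) <;> simp [a, b]

lemma Pr_indep {A B : Config → Prop} {X Y : Finset Edge} (h : Disjoint X Y)
    (hA : Dep A X) (hB : Dep B Y) : Pr (fun ω => A ω ∧ B ω) = Pr A * Pr B := by
  rw [Pr_eq hA, Pr_eq hB, ← probOn_indep h hA hB]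
  exact Pr_eq ((hA.mono (by simp)).and (hB.mono (by simp)))

def Inc (A : Config → Prop) : Prop := ∀ ω ω' : Config, (∀ e, ω e = true → ω' e = true) → A ω → A ω'

lemma Inc.and {A B : Config → Prop} (h : Inc A) (h' : Inc B) : Inc (fun ω => A ω ∧ B ω) :=
  fun ω ω' hw hA => ⟨h ω ω' hw hA.1, h' ω ω' hw hA.2⟩

lemma cfg_eq_true {F : Finset Edge} {e : Edge} : cfg F e = true ↔ e ∈ F := by simp [cfg]

lemma Pr_fkg {A B : Config → Prop} (hA : Loc A) (hB : Loc B) (iA : Inc A) (iB : Inc B) :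
    Pr A * Pr B ≤ Pr (fun ω => A ω ∧ B ω) := by
  obtain ⟨E, h1, h2⟩ := hA.common hB
  rw [Pr_eq h1, Pr_eq h2, Pr_eq (h1.and h2), probOn_eq_sum, probOn_eq_sum, probOn_eq_sum]
  have key := four_functions_theorem (α := Finset Edge) (β := ℝ)
    (f₁ := fun F => if A (cfg F) then (1 : ℝ) else 0)
    (f₂ := fun F => if B (cfg F) then (1 : ℝ) else 0)
    (f₃ := fun _ => 1) (f₄ := fun F => if A (cfg F) ∧ B (cfg F) then (1 : ℝ) else 0)
    (fun F => by dsimp; split_ifs <;> norm_num) (fun F => by dsimp; split_ifs <;> norm_num)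
    (fun F => zero_le_one) (fun F => by dsimp; split_ifs <;> norm_num)
    (fun a b => by
      by_cases ha : A (cfg a)
      · by_cases hb : B (cfg b)
        · have h3 : A (cfg (a ∪ b)) := iA _ _ (fun e he => by
            rw [cfg_eq_true] at *; exact Finset.mem_union_left _ he) ha
          have h4 : B (cfg (a ∪ b)) := iB _ _ (fun e he => by
            rw [cfg_eq_true] at *; exact Finset.mem_union_right _ he) hb
          simp [ha, hb, h3, h4]
        · simp only [hb, if_false, mul_zero, one_mul]; split_ifs <;> norm_num
      · simp only [ha, if_false, zero_mul, one_mul]; split_ifs <;> norm_num)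
    E.powerset E.powerset
  have h5 : E.powerset ⊻ E.powerset = E.powerset := by
    ext F
    simp only [Finset.mem_sups, Finset.mem_powerset]
    constructor
    · rintro ⟨a, ha, b, hb, rfl⟩
      exact Finset.union_subset ha hb
    · intro hF
      exact ⟨F, hF, F, hF, by simp⟩
  have h6 : E.powerset ⊼ E.powerset = E.powerset := by
    ext F
    simp only [Finset.mem_infs, Finset.mem_powerset]
    constructor
    · rintro ⟨a, ha, b, hb, rfl⟩
      exact Finset.inter_subset_left.trans ha
    · intro hF
      exact ⟨F, hF, F, hF, by simp⟩
  rw [h5, h6, Finset.sum_const, Finset.card_powerset] at key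
  rw [div_mul_div_comm, div_le_div_iff₀ (by positivity) (by positivity)]
  simp only [nsmul_eq_mul, mul_one, Nat.cast_pow, Nat.cast_ofNat] at key
  calc _ ≤ _ := mul_le_mul_of_nonneg_right key (by positivity)
    _ = _ := by ring_nf

lemma Pr_map (τ : Edge ≃ Edge) {A : Config → Prop} (hA : Loc A) :
    Pr (fun ω => A (fun e => ω (τ e))) = Pr A := by
  obtain ⟨E, h⟩ := hA
  have h' : Dep (fun ω => A (fun e => ω (τ e))) (E.map τ.toEmbedding : Finset Edge) := by
    intro ω ω' hw
    apply h
    intro e he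
    exact hw _ (by simpa using he)
  rw [Pr_eq h, Pr_eq h', probOn_eq_sum, probOn_eq_sum, Finset.card_map]
  congr 1
  symm
  refine Finset.sum_bij' (fun F _ => F.map τ.toEmbedding) (fun F _ => F.map τ.symm.toEmbedding)
    ?_ ?_ ?_ ?_ ?_
  · intro F hF
    simpa using hF
  · intro F hF
    rw [Finset.mem_powerset] at *
    intro e he
    have := @hF (τ e)
    simp only [Finset.mem_map_equiv, Equiv.symm_symm, Equiv.symm_apply_apply] at he this
    exact this he
  · intro F hF
    ext e
    simp
  · intro F hF
    ext e
    simp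
  · intro F hF
    have : (fun e => cfg (F.map τ.toEmbedding) (τ e)) = cfg F := by
      funext e
      simp [cfg]
    rw [this]

lemma Pr_flip {A : Config → Prop} (hA : Loc A) :
    Pr (fun ω => A (fun e => ! ω e)) = Pr A := by
  obtain ⟨E, h⟩ := hA
  have h' : Dep (fun ω => A (fun e => ! ω e)) E := by
    intro ω ω' hw
    apply h
    intro e he
    rw [hw e he]
  rw [Pr_eq h, Pr_eq h', probOn_eq_sum, probOn_eq_sum]
  congr 1
  refine Finset.sum_bij' (fun F _ => E \ F) (fun F _ => E \ F) ?_ ?_ ?_ ?_ ?_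
  · intro F hF; simp
  · intro F hF; simp
  · intro F hF; simpa using hF
  · intro F hF; simpa using hF
  · intro F hF
    have := h (fun e => ! cfg F e) (cfg (E \ F)) (fun e he => by
      have : e ∈ E := he
      simp [cfg, this])
    simp only [this]

lemma Loc_map (τ : Edge ≃ Edge) {A : Config → Prop} (hA : Loc A) :
    Loc (fun ω => A (fun e => ω (τ e))) := by
  obtain ⟨E, h⟩ := hA
  refine ⟨E.map τ.toEmbedding, fun ω ω' hw => h _ _ fun e he => hw _ (by simpa using he)⟩

lemma Loc_flip {A : Config → Prop} (hA : Loc A) : Loc (fun ω => A (fun e => ! ω e)) := by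
  obtain ⟨E, h⟩ := hA
  exact ⟨E, fun ω ω' hw => h _ _ fun e he => by rw [hw e he]⟩

end DynPerc
end

section
open scoped BigOperators
namespace DynPerc
open Classical

/-! Part 2: Fourier analysis on the cube -/

noncomputable def Ex (E : Finset Edge) (g : Finset Edge → ℝ) : ℝ :=
  (∑ F ∈ E.powerset, g F) / 2 ^ E.card

noncomputable def fc (E : Finset Edge) (g : Finset Edge → ℝ) (S : Finset Edge) : ℝ :=
  Ex E (fun F => g F * chi S F)

lemma Ex_mono {E : Finset Edge} {g h : Finset Edge → ℝ} (H : ∀ F ⊆ E, g F ≤ h F) :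
    Ex E g ≤ Ex E h := by
  unfold Ex
  gcongr with F hF
  exact H F (Finset.mem_powerset.1 hF)

lemma Ex_congr {E : Finset Edge} {g h : Finset Edge → ℝ} (H : ∀ F ⊆ E, g F = h F) :
    Ex E g = Ex E h := by
  unfold Ex
  congr 1
  exact Finset.sum_congr rfl fun F hF => H F (Finset.mem_powerset.1 hF)

lemma Ex_add {E : Finset Edge} (g h : Finset Edge → ℝ) :
    Ex E (fun F => g F + h F) = Ex E g + Ex E h := by
  unfold Ex
  rw [Finset.sum_add_distrib, add_div]

lemma Ex_mul {E : Finset Edge} (c : ℝ) (h : Finset Edge → ℝ) :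
    Ex E (fun F => c * h F) = c * Ex E h := by
  unfold Ex
  rw [← Finset.mul_sum, mul_div_assoc]

lemma Ex_const {E : Finset Edge} (c : ℝ) : Ex E (fun _ => c) = c := by
  unfold Ex
  simp

lemma Ex_sum {ι : Type*} {E : Finset Edge} (s : Finset ι) (h : ι → Finset Edge → ℝ) :
    Ex E (fun F => ∑ i ∈ s, h i F) = ∑ i ∈ s, Ex E (h i) := by
  unfold Ex
  rw [Finset.sum_comm, Finset.sum_div]

lemma Ex_comm {E E' : Finset Edge} (h : Finset Edge → Finset Edge → ℝ) :
    Ex E (fun F => Ex E' (fun F' => h F F')) = Ex E' (fun F' => Ex E (fun F => h F F')) := by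
  unfold Ex
  rw [← Finset.sum_div, ← Finset.sum_div, Finset.sum_comm]
  ring

lemma Ex_nonneg {E : Finset Edge} {g : Finset Edge → ℝ} (H : ∀ F ⊆ E, 0 ≤ g F) : 0 ≤ Ex E g := by
  rw [← Ex_const (E := E) 0]
  exact Ex_mono H

lemma Ex_union {X Y : Finset Edge} (h : Disjoint X Y) (g : Finset Edge → ℝ) :
    Ex (X ∪ Y) g = Ex X (fun x => Ex Y (fun y => g (x ∪ y))) := by
  unfold Ex
  rw [sum_powerset_union h, Finset.card_union_of_disjoint h, pow_add, ← Finset.sum_div, div_div,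
    mul_comm]

lemma Ex_cs {E : Finset Edge} (g h : Finset Edge → ℝ) :
    Ex E (fun F => g F * h F) ^ 2 ≤ Ex E (fun F => g F ^ 2) * Ex E (fun F => h F ^ 2) := by
  unfold Ex
  rw [div_pow, div_mul_div_comm, ← sq]
  gcongr
  exact Finset.sum_mul_sq_le_sq_mul_sq _ _ _

lemma Ex_sq_le {E : Finset Edge} (h : Finset Edge → ℝ) :
    Ex E h ^ 2 ≤ Ex E (fun F => h F ^ 2) := by
  have := Ex_cs (E := E) (fun _ => 1) h
  simpa [Ex_const] using this

lemma chi_eq {E S F : Finset Edge} (hS : S ⊆ E) :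
    chi S F = ∏ e ∈ E \ F, (if e ∈ S then (-1 : ℝ) else 1) := by
  have h1 : chi S F = ∏ e ∈ S, (if e ∉ F then (-1 : ℝ) else 1) := by
    unfold chi
    refine Finset.prod_congr rfl fun e _ => ?_
    by_cases h : e ∈ F <;> simp [h]
  rw [h1, ← Finset.prod_filter, ← Finset.prod_filter]
  congr 1
  ext e
  have := @hS e
  simp only [Finset.mem_filter, Finset.mem_sdiff]
  tauto

lemma chi_orth {E S T : Finset Edge} (hS : S ⊆ E) (hT : T ⊆ E) :
    Ex E (fun F => chi S F * chi T F) = if S = T then 1 else 0 := by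
  have key : ∑ F ∈ E.powerset, chi S F * chi T F = ∏ e ∈ E, ((1 : ℝ) +
      (if e ∈ S then (-1 : ℝ) else 1) * (if e ∈ T then (-1 : ℝ) else 1)) := by
    rw [Finset.prod_add]
    refine Finset.sum_congr rfl fun F hF => ?_
    rw [chi_eq hS, chi_eq hT, Finset.prod_const_one, one_mul, Finset.prod_mul_distrib]
  unfold Ex
  rw [key]
  split_ifs with h
  · subst h
    rw [Finset.prod_congr rfl (g := fun _ => (2 : ℝ))
      (fun e _ => by by_cases h : e ∈ S <;> simp [h] <;> norm_num)]
    simp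
  · rw [div_eq_zero_iff]
    left
    have : ∃ e, ¬ (e ∈ S ↔ e ∈ T) := by
      by_contra hc
      push Not at hc
      exact h (Finset.ext hc)
    obtain ⟨e, he⟩ := this
    have heE : e ∈ E := by
      by_cases h1 : e ∈ S
      · exact hS h1
      · exact hT (by tauto)
    apply Finset.prod_eq_zero heE
    by_cases h1 : e ∈ S <;> by_cases h2 : e ∈ T <;> simp [h1, h2] <;> tauto

lemma chi_dual {E F F' : Finset Edge} (hF : F ⊆ E) (hF' : F' ⊆ E) :
    ∑ S ∈ E.powerset, chi S F * chi S F' = if F = F' then 2 ^ E.card else 0 := by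
  have key : ∑ S ∈ E.powerset, chi S F * chi S F' = ∏ e ∈ E, ((if e ∈ F then (1 : ℝ) else -1) *
      (if e ∈ F' then (1 : ℝ) else -1) + 1) := by
    rw [Finset.prod_add]
    refine Finset.sum_congr rfl fun S hS => ?_
    unfold chi
    rw [Finset.prod_const_one, mul_one, Finset.prod_mul_distrib]
  rw [key]
  split_ifs with h
  · subst h
    rw [Finset.prod_congr rfl (g := fun _ => (2 : ℝ))
      (fun e _ => by by_cases h : e ∈ F <;> simp [h] <;> norm_num)]
    simp
  · have : ∃ e, ¬ (e ∈ F ↔ e ∈ F') := by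
      by_contra hc
      push Not at hc
      exact h (Finset.ext hc)
    obtain ⟨e, he⟩ := this
    have heE : e ∈ E := by
      by_cases h1 : e ∈ F
      · exact hF h1
      · exact hF' (by tauto)
    apply Finset.prod_eq_zero heE
    by_cases h1 : e ∈ F <;> by_cases h2 : e ∈ F' <;> simp [h1, h2] <;> tauto

lemma parseval (E : Finset Edge) (g : Finset Edge → ℝ) :
    ∑ S ∈ E.powerset, fc E g S ^ 2 = Ex E (fun F => g F ^ 2) := by
  have h1 : ∀ S, fc E g S ^ 2 = (∑ F ∈ E.powerset, ∑ F' ∈ E.powerset,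
      g F * g F' * (chi S F * chi S F')) / (2 ^ E.card * 2 ^ E.card) := by
    intro S
    unfold fc Ex
    rw [sq, div_mul_div_comm, Finset.sum_mul_sum]
    congr 1
    refine Finset.sum_congr rfl fun F _ => Finset.sum_congr rfl fun F' _ => by ring
  simp only [h1]
  rw [← Finset.sum_div, Finset.sum_comm]
  have h2 : ∀ F ∈ E.powerset, ∑ S ∈ E.powerset, ∑ F' ∈ E.powerset,
      g F * g F' * (chi S F * chi S F') = g F ^ 2 * 2 ^ E.card := by
    intro F hF
    rw [Finset.sum_comm]
    rw [Finset.sum_congr rfl (fun F' hF' => by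
      rw [← Finset.mul_sum, chi_dual (Finset.mem_powerset.1 hF) (Finset.mem_powerset.1 hF')])]
    simp only [mul_ite, mul_zero, Finset.sum_ite_eq, hF, if_true]
    ring
  rw [Finset.sum_congr rfl h2, ← Finset.sum_mul]
  unfold Ex
  field_simp

lemma chi_union {S T : Finset Edge} (h : Disjoint S T) (F : Finset Edge) :
    chi (S ∪ T) F = chi S F * chi T F := by
  unfold chi
  rw [Finset.prod_union h]

lemma chi_congr {S F F' : Finset Edge} (h : ∀ e ∈ S, (e ∈ F ↔ e ∈ F')) : chi S F = chi S F' := by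
  unfold chi
  refine Finset.prod_congr rfl fun e he => ?_
  simp [h e he]

lemma chi_abs (S F : Finset Edge) : chi S F ^ 2 = 1 := by
  unfold chi
  rw [← Finset.prod_pow]
  apply Finset.prod_eq_one
  intro e _
  split_ifs <;> norm_num

def IsStop (X : Finset Edge) (J : Finset Edge → Finset Edge) : Prop :=
  ∀ x ⊆ X, ∀ x' ⊆ X, x' ∩ J x = x ∩ J x → J x' = J x

def mix (J x x' : Finset Edge) : Finset Edge := (x ∩ J) ∪ (x' \ J)

lemma mix_sub {X J x x' : Finset Edge} (h : x ⊆ X) (h' : x' ⊆ X) : mix J x x' ⊆ X :=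
  Finset.union_subset (Finset.inter_subset_left.trans h) (Finset.sdiff_subset.trans h')

lemma mix_inter (J x x' : Finset Edge) : mix J x x' ∩ J = x ∩ J := by
  ext e
  simp only [mix, Finset.mem_inter, Finset.mem_union, Finset.mem_sdiff]
  tauto

lemma mix_mix (J x x' : Finset Edge) : mix J (mix J x x') (mix J x' x) = x := by
  ext e
  simp only [mix, Finset.mem_inter, Finset.mem_union, Finset.mem_sdiff]
  tauto

lemma Ex_swap {X : Finset Edge} {J : Finset Edge → Finset Edge} (hJ : IsStop X J)
    (Φ : Finset Edge → Finset Edge → ℝ) :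
    Ex X (fun x => Ex X (fun x' => Φ x x')) =
      Ex X (fun x => Ex X (fun x' => Φ (mix (J x) x x') (mix (J x) x' x))) := by
  unfold Ex
  rw [← Finset.sum_div, ← Finset.sum_div, ← Finset.sum_product', ← Finset.sum_product']
  congr 2
  have hJ' : ∀ x ⊆ X, ∀ x' ⊆ X, J (mix (J x) x x') = J x := fun x hx x' hx' =>
    hJ x hx _ (mix_sub hx hx') (mix_inter _ _ _)
  refine Finset.sum_bij' (fun p _ => (mix (J p.1) p.1 p.2, mix (J p.1) p.2 p.1))
    (fun p _ => (mix (J p.1) p.1 p.2, mix (J p.1) p.2 p.1)) ?_ ?_ ?_ ?_ ?_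
  · rintro ⟨x, x'⟩ hp
    simp only [Finset.mem_product, Finset.mem_powerset] at hp ⊢
    exact ⟨mix_sub hp.1 hp.2, mix_sub hp.2 hp.1⟩
  · rintro ⟨x, x'⟩ hp
    simp only [Finset.mem_product, Finset.mem_powerset] at hp ⊢
    exact ⟨mix_sub hp.1 hp.2, mix_sub hp.2 hp.1⟩
  · rintro ⟨x, x'⟩ hp
    simp only [Finset.mem_product, Finset.mem_powerset] at hp ⊢
    rw [hJ' x hp.1 x' hp.2, mix_mix, mix_mix]
  · rintro ⟨x, x'⟩ hp
    simp only [Finset.mem_product, Finset.mem_powerset] at hp ⊢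
    rw [hJ' x hp.1 x' hp.2, mix_mix, mix_mix]
  · rintro ⟨x, x'⟩ hp
    simp only [Finset.mem_product, Finset.mem_powerset] at hp ⊢
    rw [hJ' x hp.1 x' hp.2, mix_mix, mix_mix]

end DynPerc
end

section
open scoped BigOperators
namespace DynPerc
open Classical

lemma stop_level {X A : Finset Edge} {J : Finset Edge → Finset Edge} (hJ : IsStop X J)
    (hA : A ⊆ X) (g : Finset Edge → ℝ)
    (hg : ∀ x ⊆ X, ∀ x' ⊆ X, x' ∩ J x = x ∩ J x → g x' = g x)
    {δ : ℝ} (hδ0 : 0 ≤ δ) (hδ : ∀ e ∈ A, Ex X (fun x => if e ∈ J x then 1 else 0) ≤ δ)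
    {m : ℕ} (hm : 1 ≤ m) :
    ∑ T ∈ A.powersetCard m, fc X g T ^ 2 ≤ m * δ * Ex X (fun x => g x ^ 2) := by
  set c := fc X g with hc
  set 𝒯 := A.powersetCard m with h𝒯
  have hTX : ∀ T ∈ 𝒯, T ⊆ X := fun T hT => (Finset.mem_powersetCard.1 hT).1.trans hA
  have hTc : ∀ T ∈ 𝒯, T.card = m := fun T hT => (Finset.mem_powersetCard.1 hT).2
  set N := ∑ T ∈ 𝒯, c T ^ 2 with hN
  set h : Finset Edge → ℝ := fun F => ∑ T ∈ 𝒯, c T * chi T F with hh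
  set G := Ex X (fun x => g x ^ 2) with hG
  have hG0 : 0 ≤ G := Ex_nonneg fun F _ => sq_nonneg _
  have N1 : Ex X (fun F => g F * h F) = N := by
    have : ∀ F, g F * h F = ∑ T ∈ 𝒯, c T * (g F * chi T F) := by
      intro F
      rw [hh, Finset.mul_sum]
      exact Finset.sum_congr rfl fun T _ => by ring
    simp only [this]
    rw [Ex_sum]
    refine Finset.sum_congr rfl fun T _ => ?_
    rw [Ex_mul, sq]
    rfl
  have N2 : Ex X (fun F => h F ^ 2) = N := by
    have : ∀ F, h F ^ 2 = ∑ T ∈ 𝒯, ∑ T' ∈ 𝒯, c T * c T' * (chi T F * chi T' F) := by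
      intro F
      rw [hh, sq, Finset.sum_mul_sum]
      exact Finset.sum_congr rfl fun T _ => Finset.sum_congr rfl fun T' _ => by ring
    simp only [this]
    rw [Ex_sum]
    refine Finset.sum_congr rfl fun T hT => ?_
    rw [Ex_sum]
    rw [Finset.sum_congr rfl (fun T' hT' => by rw [Ex_mul, chi_orth (hTX T hT) (hTX T' hT')])]
    simp only [mul_ite, mul_zero, Finset.sum_ite_eq, hT, if_true]
    ring
  set u : Finset Edge → ℝ := fun x => Ex X (fun x' => h (mix (J x) x x')) with hu
  have s1 : N = Ex X (fun x => g x * u x) := by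
    have h1 := Ex_swap hJ (fun x _ => g x * h x)
    simp only [Ex_const] at h1
    rw [← N1, h1]
    refine Ex_congr fun x hx => ?_
    rw [hu, ← Ex_mul]
    refine Ex_congr fun x' hx' => ?_
    rw [hg x hx _ (mix_sub hx hx') (mix_inter _ _ _)]
  have s3 : N = Ex X (fun x => Ex X (fun x' => h (mix (J x) x x') ^ 2)) := by
    have h1 := Ex_swap hJ (fun x _ => h x ^ 2)
    simp only [Ex_const] at h1
    rw [← N2, h1]
  have s2 : ∀ x ⊆ X, u x ^ 2 + ∑ T ∈ 𝒯, (if Disjoint T (J x) then c T ^ 2 else 0) ≤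
      Ex X (fun x' => h (mix (J x) x x') ^ 2) := by
    intro x hx
    set k : Finset Edge → ℝ := fun x' => h (mix (J x) x x') with hk
    rw [← parseval X k]
    have c0 : fc X k ∅ = u x := by
      unfold fc
      simp [chi, hu, hk]
    have cT : ∀ T ∈ 𝒯, Disjoint T (J x) → fc X k T = c T := by
      intro T hT hd
      unfold fc
      have e1 : ∀ x' ⊆ X, k x' * chi T x' =
          ∑ T' ∈ 𝒯, c T' * chi (T' ∩ J x) x * (chi (T' \ J x) x' * chi T x') := by
        intro x' _
        rw [hk]
        simp only [hh]
        rw [Finset.sum_mul]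
        refine Finset.sum_congr rfl fun T' _ => ?_
        have : chi T' (mix (J x) x x') = chi (T' ∩ J x) x * chi (T' \ J x) x' := by
          have e2 : T' = (T' ∩ J x) ∪ (T' \ J x) := by
            ext e; simp only [Finset.mem_inter, Finset.mem_union, Finset.mem_sdiff]; tauto
          conv_lhs => rw [e2]
          rw [chi_union (Finset.disjoint_left.2 (by simp +contextual))]
          congr 1
          · apply chi_congr
            intro e he
            simp only [mix, Finset.mem_inter, Finset.mem_union, Finset.mem_sdiff] at *
            tauto
          · apply chi_congr
            intro e he
            simp only [mix, Finset.mem_inter, Finset.mem_union, Finset.mem_sdiff] at *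
            tauto
        rw [this]; ring
      rw [Ex_congr e1, Ex_sum]
      rw [Finset.sum_congr rfl (fun T' hT' => by
        rw [Ex_mul, chi_orth (Finset.sdiff_subset.trans (hTX T' hT')) (hTX T hT)])]
      rw [Finset.sum_eq_single T]
      · have e3 : T \ J x = T := Finset.sdiff_eq_self_of_disjoint hd
        have e4 : T ∩ J x = ∅ := Finset.disjoint_iff_inter_eq_empty.1 hd
        simp [e3, e4, chi]
      · intro T' hT' hne
        have : T' \ J x ≠ T := by
          intro h5
          apply hne
          have h6 : T ⊆ T' := h5 ▸ Finset.sdiff_subset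
          exact (Finset.eq_of_subset_of_card_le h6 (by rw [hTc T hT, hTc T' hT'])).symm
        simp [this]
      · intro h'; exact absurd hT h'
    rw [← Finset.sum_filter, ← c0]
    rw [Finset.sum_congr rfl (g := fun T => fc X k T ^ 2) (fun T hT => by
      rw [Finset.mem_filter] at hT; rw [cT T hT.1 hT.2])]
    have e0 : (∅ : Finset Edge) ∉ 𝒯.filter (fun T => Disjoint T (J x)) := by
      intro h0
      have := hTc _ (Finset.mem_filter.1 h0).1
      simp at this
      omega
    rw [← Finset.sum_insert e0 (f := fun T => fc X k T ^ 2)]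
    refine Finset.sum_le_sum_of_subset_of_nonneg ?_ (fun _ _ _ => sq_nonneg _)
    intro T hT
    rw [Finset.mem_insert] at hT
    rw [Finset.mem_powerset]
    rcases hT with rfl | hT
    · simp
    · exact hTX T (Finset.mem_filter.1 hT).1
  have s4 : Ex X (fun x => u x ^ 2) ≤ m * δ * N := by
    have h1 : Ex X (fun x => u x ^ 2) +
        Ex X (fun x => ∑ T ∈ 𝒯, (if Disjoint T (J x) then c T ^ 2 else 0)) ≤ N := by
      rw [← Ex_add]
      conv_rhs => rw [s3]
      exact Ex_mono s2
    have h2 : N - m * δ * N ≤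
        Ex X (fun x => ∑ T ∈ 𝒯, (if Disjoint T (J x) then c T ^ 2 else 0)) := by
      rw [Ex_sum, hN, Finset.mul_sum, ← Finset.sum_sub_distrib]
      refine Finset.sum_le_sum fun T hT => ?_
      have h3 : Ex X (fun x => 1 - ∑ e ∈ T, (if e ∈ J x then (1 : ℝ) else 0)) ≤
          Ex X (fun x => if Disjoint T (J x) then 1 else 0) := by
        refine Ex_mono fun x _ => ?_
        split_ifs with hd
        · have : 0 ≤ ∑ e ∈ T, (if e ∈ J x then (1 : ℝ) else 0) :=
            Finset.sum_nonneg fun e _ => by split_ifs <;> norm_num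
          linarith
        · rw [Finset.not_disjoint_iff] at hd
          obtain ⟨e, he, heJ⟩ := hd
          have := Finset.single_le_sum (f := fun e => if e ∈ J x then (1 : ℝ) else 0)
            (fun e _ => by split_ifs <;> norm_num) he
          simp only [heJ, if_true] at this
          linarith
      have h4 : Ex X (fun x => 1 - ∑ e ∈ T, (if e ∈ J x then (1 : ℝ) else 0)) =
          1 - ∑ e ∈ T, Ex X (fun x => if e ∈ J x then (1 : ℝ) else 0) := by
        have := Ex_add (E := X) (fun x => 1 - ∑ e ∈ T, (if e ∈ J x then (1 : ℝ) else 0))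
          (fun x => ∑ e ∈ T, (if e ∈ J x then (1 : ℝ) else 0))
        rw [Ex_sum] at this
        simp only [sub_add_cancel, Ex_const] at this
        linarith
      have h5 : ∑ e ∈ T, Ex X (fun x => if e ∈ J x then (1 : ℝ) else 0) ≤ m * δ := by
        calc _ ≤ ∑ e ∈ T, δ :=
              Finset.sum_le_sum fun e he => hδ e ((Finset.mem_powersetCard.1 hT).1 he)
          _ = m * δ := by rw [Finset.sum_const, hTc T hT, nsmul_eq_mul]
      have h6 : Ex X (fun x => if Disjoint T (J x) then c T ^ 2 else 0) =
          c T ^ 2 * Ex X (fun x => if Disjoint T (J x) then 1 else 0) := by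
        rw [← Ex_mul]
        refine Ex_congr fun x _ => ?_
        simp
      rw [h6]
      nlinarith [sq_nonneg (c T)]
    linarith
  have hN0 : 0 ≤ N := Finset.sum_nonneg fun _ _ => sq_nonneg _
  have h7 : N ^ 2 ≤ G * (m * δ * N) := by
    calc N ^ 2 = Ex X (fun x => g x * u x) ^ 2 := by rw [← s1]
      _ ≤ G * Ex X (fun x => u x ^ 2) := Ex_cs g u
      _ ≤ _ := by gcongr
  rcases hN0.eq_or_lt with h8 | h8
  · rw [← h8]; positivity
  · have : N * N ≤ (m * δ * G) * N := by nlinarith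
    exact le_of_mul_le_mul_right this h8

/-- weight of a family -/
noncomputable def Wt (E : Finset Edge) (f : Finset Edge → ℝ) (Q : Finset Edge → Prop) : ℝ :=
  ∑ S ∈ E.powerset, if Q S then fc E f S ^ 2 else 0

lemma Wt_mono {E : Finset Edge} {f : Finset Edge → ℝ} {Q Q' : Finset Edge → Prop}
    (h : ∀ S ⊆ E, Q S → Q' S) : Wt E f Q ≤ Wt E f Q' := by
  unfold Wt
  refine Finset.sum_le_sum fun S hS => ?_
  have := h S (Finset.mem_powerset.1 hS)
  by_cases a : Q S
  · simp [a, this a]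
  · simp only [a, if_false]; split_ifs <;> positivity

lemma Wt_nonneg (E : Finset Edge) (f : Finset Edge → ℝ) (Q : Finset Edge → Prop) :
    0 ≤ Wt E f Q := Finset.sum_nonneg fun S _ => by split_ifs <;> positivity

lemma Wt_biUnion {ι : Type*} {E : Finset Edge} {f : Finset Edge → ℝ} (s : Finset ι)
    (Q : Finset Edge → Prop)
    (Q' : ι → Finset Edge → Prop) (h : ∀ S ⊆ E, Q S → ∃ i ∈ s, Q' i S) :
    Wt E f Q ≤ ∑ i ∈ s, Wt E f (Q' i) := by
  unfold Wt
  rw [Finset.sum_comm]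
  refine Finset.sum_le_sum fun S hS => ?_
  have hn : ∀ i ∈ s, 0 ≤ if Q' i S then fc E f S ^ 2 else 0 := fun i _ => by
    split_ifs <;> positivity
  by_cases a : Q S
  · obtain ⟨i, hi, hq⟩ := h S (Finset.mem_powerset.1 hS) a
    have := Finset.single_le_sum hn hi
    simpa [a, hq] using this
  · simp only [a, if_false]
    exact Finset.sum_nonneg hn

lemma fc_union {X Y : Finset Edge} (h : Disjoint X Y) (f : Finset Edge → ℝ) {T U : Finset Edge}
    (hT : T ⊆ X) (hU : U ⊆ Y) :
    fc (X ∪ Y) f (T ∪ U) = fc X (fun x => Ex Y (fun y => f (x ∪ y) * chi U y)) T := by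
  unfold fc
  rw [Ex_union h]
  refine Ex_congr fun x hx => ?_
  rw [mul_comm, ← Ex_mul]
  refine Ex_congr fun y hy => ?_
  rw [chi_union (Finset.disjoint_of_subset_left hT (Finset.disjoint_of_subset_right hU h))]
  have h1 : chi T (x ∪ y) = chi T x := chi_congr fun e he => by
    have : e ∉ y := fun h' => Finset.disjoint_left.1 h (hT he) (hy h')
    simp [this]
  have h2 : chi U (x ∪ y) = chi U y := chi_congr fun e he => by
    have : e ∉ x := fun h' => Finset.disjoint_left.1 h (hx h') (hU he)
    simp [this]
  rw [h1, h2]; ring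

lemma Wt_stop {X Y A : Finset Edge} (hXY : Disjoint X Y) {J : Finset Edge → Finset Edge}
    (hJ : IsStop X J) (hA : A ⊆ X) (f : Finset Edge → ℝ)
    (hf : ∀ x ⊆ X, ∀ x' ⊆ X, x' ∩ J x = x ∩ J x → ∀ y ⊆ Y, f (x' ∪ y) = f (x ∪ y))
    {δ : ℝ} (hδ0 : 0 ≤ δ) (hδ : ∀ e ∈ A, Ex X (fun x => if e ∈ J x then 1 else 0) ≤ δ)
    (k : ℕ) (Q : Finset Edge → Prop) (hQ : ∀ S S' : Finset Edge, S \ X = S' \ X → (Q S ↔ Q S')) :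
    Wt (X ∪ Y) f (fun S => S ∩ X ⊆ A ∧ (S ∩ X).Nonempty ∧ (S ∩ X).card < k ∧ Q S) ≤
      (k : ℝ) ^ 2 * δ * Wt (X ∪ Y) f Q := by
  unfold Wt
  rw [Finset.union_comm X Y, sum_powerset_union hXY.symm, sum_powerset_union hXY.symm,
    Finset.mul_sum]
  refine Finset.sum_le_sum fun U hU => ?_
  rw [Finset.mem_powerset] at hU
  have eX : ∀ T ⊆ X, (U ∪ T) ∩ X = T := by
    intro T hT
    ext e
    have := @hT e
    have := @hU e
    have := fun h1 : e ∈ X => fun h2 : e ∈ Y => Finset.disjoint_left.1 hXY h1 h2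
    simp only [Finset.mem_inter, Finset.mem_union]
    tauto
  have eQ : ∀ T ⊆ X, (Q (U ∪ T) ↔ Q U) := by
    intro T hT
    apply hQ
    ext e
    have := @hT e
    simp only [Finset.mem_sdiff, Finset.mem_union]
    tauto
  by_cases hq : Q U
  swap
  · rw [Finset.sum_eq_zero, Finset.sum_eq_zero, mul_zero]
    · intro T hT
      simp [eQ T (Finset.mem_powerset.1 hT), hq]
    · intro T hT
      simp [eQ T (Finset.mem_powerset.1 hT), hq]
  set g : Finset Edge → ℝ := fun x => Ex Y (fun y => f (x ∪ y) * chi U y) with hg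
  have hfc : ∀ T ⊆ X, fc (Y ∪ X) f (U ∪ T) = fc X g T := by
    intro T hT
    rw [Finset.union_comm, Finset.union_comm U, fc_union hXY f hT hU]
  have R : ∑ T ∈ X.powerset, (if Q (U ∪ T) then fc (Y ∪ X) f (U ∪ T) ^ 2 else 0) =
      Ex X (fun x => g x ^ 2) := by
    rw [← parseval]
    refine Finset.sum_congr rfl fun T hT => ?_
    rw [Finset.mem_powerset] at hT
    rw [hfc T hT]
    simp [eQ T hT, hq]
  rw [R]
  have hG0 : 0 ≤ Ex X (fun x => g x ^ 2) := Ex_nonneg fun F _ => sq_nonneg _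
  have Lb : ∑ T ∈ X.powerset, (if (U ∪ T) ∩ X ⊆ A ∧ ((U ∪ T) ∩ X).Nonempty ∧ ((U ∪ T) ∩ X).card < k ∧
      Q (U ∪ T) then fc (Y ∪ X) f (U ∪ T) ^ 2 else 0) ≤
      ∑ m ∈ Finset.range k, if 1 ≤ m then ∑ T ∈ A.powersetCard m, fc X g T ^ 2 else 0 := by
    rw [← Finset.sum_filter]
    rw [← Finset.sum_fiberwise_of_maps_to (s := Finset.filter _ _) (t := Finset.range k)
      (g := Finset.card)]
    · refine Finset.sum_le_sum fun m _ => ?_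
      split_ifs with h1
      · rw [Finset.sum_congr rfl (g := fun T => fc X g T ^ 2) (fun T hT => by
          rw [hfc T (Finset.mem_powerset.1 (Finset.mem_filter.1 (Finset.mem_filter.1 hT).1).1)])]
        refine Finset.sum_le_sum_of_subset_of_nonneg ?_ (fun _ _ _ => sq_nonneg _)
        intro T hT
        simp only [Finset.mem_filter, Finset.mem_powerset] at hT
        obtain ⟨⟨h2, h3, -⟩, h4⟩ := hT
        rw [eX T h2] at h3
        exact Finset.mem_powersetCard.2 ⟨h3, h4⟩
      · refine le_of_eq (Finset.sum_eq_zero fun T hT => ?_)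
        simp only [Finset.mem_filter, Finset.mem_powerset] at hT
        obtain ⟨⟨h2, h3, h5, -⟩, h4⟩ := hT
        rw [eX T h2] at h5
        have := h5.card_pos
        omega
    · intro T hT
      simp only [Finset.mem_filter, Finset.mem_powerset] at hT
      obtain ⟨h2, h3, h5, h6, -⟩ := hT
      rw [eX T h2] at h6
      exact Finset.mem_range.2 h6
  refine le_trans (le_of_eq ?_) (Lb.trans ?_)
  · exact Finset.sum_congr rfl fun T _ => by congr
  calc _ ≤ ∑ m ∈ Finset.range k, (k : ℝ) * δ * Ex X (fun x => g x ^ 2) := by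
        refine Finset.sum_le_sum fun m hm => ?_
        split_ifs with h1
        · refine (stop_level hJ hA g ?_ hδ0 hδ h1).trans ?_
          · intro x hx x' hx' he
            refine Ex_congr fun y hy => ?_
            rw [hf x hx x' hx' he y hy]
          · have : (m : ℝ) ≤ k := by exact_mod_cast (Finset.mem_range.1 hm).le
            gcongr
        · positivity
    _ = _ := by
        rw [Finset.sum_const, Finset.card_range, nsmul_eq_mul]; ring

/-- functions vanishing off a product event -/
lemma Wt_proj {V Y : Finset Edge} (hVY : Disjoint V Y) (f : Finset Edge → ℝ)
    (G I : Finset Edge → Prop) (hf0 : ∀ F, 0 ≤ f F)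
    (hf : ∀ v ⊆ V, ∀ y ⊆ Y, f (v ∪ y) ≤ if G v ∧ I y then 1 else 0) :
    Wt (V ∪ Y) f (fun S => S ∩ V = ∅) ≤
      Ex V (fun v => if G v then 1 else 0) ^ 2 * Ex Y (fun y => if I y then 1 else 0) := by
  unfold Wt
  rw [Finset.union_comm V Y, sum_powerset_union hVY.symm]
  have h1 : ∀ U ∈ Y.powerset, ∑ T ∈ V.powerset,
      (if (U ∪ T) ∩ V = ∅ then fc (Y ∪ V) f (U ∪ T) ^ 2 else 0) =
      fc Y (fun y => Ex V (fun v => f (v ∪ y))) U ^ 2 := by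
    intro U hU
    rw [Finset.mem_powerset] at hU
    have hUV : U ∩ V = ∅ := Finset.disjoint_iff_inter_eq_empty.1
      (Finset.disjoint_of_subset_left hU hVY.symm)
    rw [Finset.sum_eq_single ∅]
    · rw [Finset.union_empty, if_pos hUV]
      have := fc_union hVY.symm f (T := U) (U := ∅) hU (by simp)
      rw [Finset.union_empty] at this
      rw [this]
      simp only [chi, Finset.prod_empty, mul_one]
      simp only [Finset.union_comm]
    · intro T hT hne
      rw [if_neg]
      rw [Finset.mem_powerset] at hT
      rw [Finset.union_inter_distrib_right, hUV, Finset.inter_eq_left.2 hT]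
      simpa using hne
    · simp
  have h2 := Finset.sum_congr rfl h1
  refine le_trans (le_of_eq ?_) ((le_of_eq h2).trans ?_)
  · exact Finset.sum_congr rfl fun U _ => Finset.sum_congr rfl fun T _ => by congr
  rw [parseval, ← Ex_mul]
  refine Ex_mono fun y hy => ?_
  have h0 : 0 ≤ Ex V (fun v => f (v ∪ y)) := Ex_nonneg fun v _ => hf0 _
  by_cases hI : I y
  · have : Ex V (fun v => f (v ∪ y)) ≤ Ex V (fun v => if G v then 1 else 0) :=
      Ex_mono fun v hv => by simpa [hI] using hf v hv y hy
    simp only [hI, if_true, mul_one]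
    gcongr
  · have : Ex V (fun v => f (v ∪ y)) ≤ Ex V (fun _ => 0) :=
      Ex_mono fun v hv => by simpa [hI] using hf v hv y hy
    rw [Ex_const] at this
    simp only [hI, if_false, mul_zero]
    have : Ex V (fun v => f (v ∪ y)) = 0 := le_antisymm this h0
    rw [this]; norm_num

end DynPerc
end

section
open scoped BigOperators
namespace DynPerc
open Classical

/-! Part 3: lattice connectivity -/

def tl (e : Edge) : Vertex := if e.2 then (e.1.1 + 1, e.1.2) else (e.1.1, e.1.2 + 1)

@[simp] lemma tl_true (v : Vertex) : tl (v, true) = (v.1 + 1, v.2) := rfl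
@[simp] lemma tl_false (v : Vertex) : tl (v, false) = (v.1, v.2 + 1) := rfl

lemma openAdj_iff {ω : Config} {v w : Vertex} :
    OpenAdj ω v w ↔ ∃ e, ω e = true ∧ ((v = e.1 ∧ w = tl e) ∨ (w = e.1 ∧ v = tl e)) := by
  constructor
  · rintro (⟨h, rfl⟩ | ⟨h, rfl⟩ | ⟨h, rfl⟩ | ⟨h, rfl⟩)
    · exact ⟨(v, true), h, Or.inl ⟨rfl, rfl⟩⟩
    · exact ⟨(w, true), h, Or.inr ⟨rfl, rfl⟩⟩
    · exact ⟨(v, false), h, Or.inl ⟨rfl, rfl⟩⟩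
    · exact ⟨(w, false), h, Or.inr ⟨rfl, rfl⟩⟩
  · rintro ⟨⟨p, b⟩, h, (⟨h1, h2⟩ | ⟨h1, h2⟩)⟩ <;> cases b <;> simp only [tl_true, tl_false] at h2 <;>
      subst h1 <;> subst h2
    · exact Or.inr (Or.inr (Or.inl ⟨h, rfl⟩))
    · exact Or.inl ⟨h, rfl⟩
    · exact Or.inr (Or.inr (Or.inr ⟨h, rfl⟩))
    · exact Or.inr (Or.inl ⟨h, rfl⟩)

lemma OpenAdj.symm {ω : Config} {v w : Vertex} (h : OpenAdj ω v w) : OpenAdj ω w v := by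
  rw [openAdj_iff] at *
  obtain ⟨e, h, h'⟩ := h
  exact ⟨e, h, h'.symm⟩

def Conn (ω : Config) : Vertex → Vertex → Prop := Relation.ReflTransGen (OpenAdj ω)

lemma Conn.refl {ω : Config} (v : Vertex) : Conn ω v v := Relation.ReflTransGen.refl

lemma Conn.symm {ω : Config} {v w : Vertex} (h : Conn ω v w) : Conn ω w v :=
  haveI : Std.Symm (OpenAdj ω) := ⟨fun _ _ => OpenAdj.symm⟩
  (Relation.ReflTransGen.stdSymm (r := OpenAdj ω)).symm _ _ h

lemma Conn.trans {ω : Config} {u v w : Vertex} (h : Conn ω u v) (h' : Conn ω v w) : Conn ω u w :=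
  Relation.ReflTransGen.trans h h'

lemma Conn.tail {ω : Config} {u v w : Vertex} (h : Conn ω u v) (h' : OpenAdj ω v w) : Conn ω u w :=
  Relation.ReflTransGen.tail h h'

lemma Conn.single {ω : Config} {v w : Vertex} (h' : OpenAdj ω v w) : Conn ω v w :=
  Relation.ReflTransGen.single h'

lemma Conn.mono {ω ω' : Config} (h : ∀ e, ω e = true → ω' e = true) {u v : Vertex}
    (hc : Conn ω u v) : Conn ω' u v := by
  refine Relation.ReflTransGen.mono ?_ _ _ hc
  intro a b hab
  rw [openAdj_iff] at *
  obtain ⟨e, he, h'⟩ := hab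
  exact ⟨e, h e he, h'⟩

noncomputable def res (p : Edge → Prop) (ω : Config) : Config := fun e => ω e && decide (p e)

@[simp] lemma res_true {p : Edge → Prop} {ω : Config} {e : Edge} :
    res p ω e = true ↔ ω e = true ∧ p e := by simp [res]

lemma res_false {p : Edge → Prop} {ω : Config} {e : Edge} :
    res p ω e = false ↔ ¬ (ω e = true ∧ p e) := by
  rw [← res_true, Bool.not_eq_true]

lemma Conn.res_mono {p q : Edge → Prop} {ω : Config} (h : ∀ e, p e → q e) {u v : Vertex}
    (hc : Conn (res p ω) u v) : Conn (res q ω) u v :=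
  hc.mono fun e he => by rw [res_true] at *; exact ⟨he.1, h e he.2⟩

lemma Conn.of_res {p : Edge → Prop} {ω : Config} {u v : Vertex}
    (hc : Conn (res p ω) u v) : Conn ω u v :=
  hc.mono fun e he => by rw [res_true] at *; exact he.1

lemma Dep_conn_res (p : Edge → Prop) (u v : Vertex) :
    Dep (fun ω => Conn (res p ω) u v) {e | p e} := by
  intro ω ω' h
  have : res p ω = res p ω' := by
    funext e
    by_cases hp : p e
    · simp [res, h e hp]
    · simp [res, hp]
  simp only [this]

lemma Inc_conn_res (p : Edge → Prop) (u v : Vertex) : Inc (fun ω => Conn (res p ω) u v) := by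
  intro ω ω' h hc
  exact Conn.mono (fun e he => by rw [res_true] at *; exact ⟨h e he.1, he.2⟩) hc

def inV (P : Vertex → Prop) (e : Edge) : Prop := P e.1 ∧ P (tl e)

lemma openAdj_inV {P : Vertex → Prop} {ω : Config} {v w : Vertex} :
    OpenAdj (res (inV P) ω) v w ↔ OpenAdj ω v w ∧ P v ∧ P w := by
  rw [openAdj_iff, openAdj_iff]
  constructor
  · rintro ⟨e, he, h⟩
    rw [res_true] at he
    refine ⟨⟨e, he.1, h⟩, ?_⟩
    rcases h with ⟨rfl, rfl⟩ | ⟨rfl, rfl⟩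
    · exact he.2
    · exact he.2.symm
  · rintro ⟨⟨e, he, h⟩, h1, h2⟩
    refine ⟨e, ?_, h⟩
    rw [res_true]
    refine ⟨he, ?_⟩
    rcases h with ⟨rfl, rfl⟩ | ⟨rfl, rfl⟩
    · exact ⟨h1, h2⟩
    · exact ⟨h2, h1⟩

lemma Conn.inV_end {P : Vertex → Prop} {ω : Config} {u v : Vertex} (hu : P u)
    (h : Conn (res (inV P) ω) u v) : P v := by
  induction h with
  | refl => exact hu
  | tail _ h' _ => exact (openAdj_inV.1 h').2.2

/-- first exit -/
lemma Conn.exit {P : Vertex → Prop} {ω : Config} {u v : Vertex} (hu : P u) (h : Conn ω u v) :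
    Conn (res (inV P) ω) u v ∨
      ∃ a b, Conn (res (inV P) ω) u a ∧ P a ∧ OpenAdj ω a b ∧ ¬ P b ∧ Conn ω b v := by
  induction h with
  | refl => exact Or.inl (Conn.refl _)
  | @tail b c _ h' ih =>
    rcases ih with ih | ⟨a, b', h1, h2, h3, h4, h5⟩
    · have hb := ih.inV_end hu
      by_cases hc : P c
      · exact Or.inl (ih.tail (openAdj_inV.2 ⟨h', hb, hc⟩))
      · exact Or.inr ⟨b, c, ih, hb, h', hc, Conn.refl _⟩
    · exact Or.inr ⟨a, b', h1, h2, h3, h4, h5.tail h'⟩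

/-- Potential of a path. -/
lemma pot_aux {ω : Config} {u v : Vertex} {y0 y1 : ℤ}
    (hω : ∀ x y, ω ((x, y), true) = true → y0 ≤ y ∧ y ≤ y1) (h : Conn ω u v) :
    ∃ φ : ℤ → ℤ → ℤ,
      (∀ x y, ω ((x, y), true) = false → φ x y = φ x (y - 1)) ∧
      (∀ x y, ω ((x, y), false) = false → φ x y = φ (x - 1) y +
        (if x = u.1 ∧ u.2 ≤ y then 1 else 0) - (if x = v.1 ∧ v.2 ≤ y then 1 else 0)) ∧
      (∀ x y, y < y0 → φ x y = 0) ∧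
      (∀ x y, y1 ≤ y → φ x y = (if u.1 ≤ x then 1 else 0) - (if v.1 ≤ x then 1 else 0)) := by
  induction h with
  | refl => exact ⟨fun _ _ => 0, by simp, by simp, by simp, by simp⟩
  | @tail b c _ h' ih =>
    obtain ⟨φ, h1, h2, h3, h4⟩ := ih
    obtain ⟨b1, b2⟩ := b
    obtain ⟨c1, c2⟩ := c
    simp only at *
    rcases h' with ⟨he, hw⟩ | ⟨he, hw⟩ | ⟨he, hw⟩ | ⟨he, hw⟩ <;>
      simp only [Prod.mk.injEq] at hw he <;> obtain ⟨e1, e2⟩ := hw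
    · subst e1 e2
      refine ⟨fun x y => φ x y + (if x = b1 ∧ c2 ≤ y then 1 else 0), ?_, ?_, ?_, ?_⟩
      · intro x y hxy
        have := h1 x y hxy
        have : ¬ (x = b1 ∧ y = c2) := by rintro ⟨rfl, rfl⟩; simp [he] at hxy
        dsimp only
        split_ifs <;> omega
      · intro x y hxy
        have := h2 x y hxy
        dsimp only
        split_ifs at * <;> omega
      · intro x y hy
        have := h3 x y hy
        have := hω _ _ he
        dsimp only
        split_ifs <;> omega
      · intro x y hy
        have := h4 x y hy
        have := hω _ _ he
        dsimp only
        split_ifs at * <;> omega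
    · subst e1 e2
      refine ⟨fun x y => φ x y - (if x = c1 ∧ b2 ≤ y then 1 else 0), ?_, ?_, ?_, ?_⟩
      · intro x y hxy
        have := h1 x y hxy
        have : ¬ (x = c1 ∧ y = b2) := by rintro ⟨rfl, rfl⟩; simp [he] at hxy
        dsimp only
        split_ifs <;> omega
      · intro x y hxy
        have := h2 x y hxy
        dsimp only
        split_ifs at * <;> omega
      · intro x y hy
        have := h3 x y hy
        have := hω _ _ he
        dsimp only
        split_ifs <;> omega
      · intro x y hy
        have := h4 x y hy
        have := hω _ _ he
        dsimp only
        split_ifs at * <;> omega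
    · subst e1 e2
      refine ⟨φ, h1, ?_, h3, h4⟩
      intro x y hxy
      have := h2 x y hxy
      have : ¬ (x = c1 ∧ y = b2) := by rintro ⟨rfl, rfl⟩; simp [he] at hxy
      split_ifs at * <;> omega
    · subst e1 e2
      refine ⟨φ, h1, ?_, h3, h4⟩
      intro x y hxy
      have := h2 x y hxy
      have : ¬ (x = b1 ∧ y = c2) := by rintro ⟨rfl, rfl⟩; simp [he] at hxy
      split_ifs at * <;> omega

lemma pot {ω : Config} {u v : Vertex} {y0 y1 : ℤ}
    (hω : ∀ x y, ω ((x, y), true) = true → y0 ≤ y ∧ y ≤ y1) (h : Conn ω u v)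
    (hu : y0 ≤ u.2 ∧ u.2 ≤ y1) (hv : y0 ≤ v.2 ∧ v.2 ≤ y1) :
    ∃ φ : ℤ → ℤ → ℤ,
      (∀ x y, ω ((x, y), true) = false → ¬ (y = v.2 ∧ v.1 ≤ x) → ¬ (y = u.2 ∧ x < u.1) →
        φ x y = φ x (y - 1)) ∧
      (∀ x y, ω ((x, y), false) = false → φ x y = φ (x - 1) y) ∧
      (∀ x y, y < y0 → φ x y = 0) ∧ (∀ x y, y1 ≤ y → φ x y = 1) := by
  obtain ⟨φ, h1, h2, h3, h4⟩ := pot_aux hω h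
  refine ⟨fun x y => φ x y + (if x < u.1 ∧ u.2 ≤ y then 1 else 0) +
    (if v.1 ≤ x ∧ v.2 ≤ y then 1 else 0), ?_, ?_, ?_, ?_⟩
  · intro x y hxy n1 n2
    have := h1 x y hxy
    dsimp only
    split_ifs <;> omega
  · intro x y hxy
    have := h2 x y hxy
    dsimp only
    split_ifs at * <;> omega
  · intro x y hy
    have := h3 x y hy
    dsimp only
    split_ifs <;> omega
  · intro x y hy
    have := h4 x y hy
    dsimp only
    split_ifs at * <;> omega

def dtau : Edge ≃ Edge where
  toFun e := if e.2 then ((e.1.1 + 1, e.1.2), false) else ((e.1.1, e.1.2 + 1), true)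
  invFun e := if e.2 then ((e.1.1, e.1.2 - 1), false) else ((e.1.1 - 1, e.1.2), true)
  left_inv := by rintro ⟨⟨x, y⟩, b⟩; cases b <;> simp
  right_inv := by rintro ⟨⟨x, y⟩, b⟩; cases b <;> simp

@[simp] lemma dtau_true (x y : ℤ) : dtau ((x, y), true) = ((x + 1, y), false) := rfl
@[simp] lemma dtau_false (x y : ℤ) : dtau ((x, y), false) = ((x, y + 1), true) := rfl

def dualc (ω : Config) : Config := fun e => ! ω (dtau e)

/-- A labelling of faces constant across closed edges is constant along dual paths. -/
lemma dual_const {η : Config} {p q : Vertex} (φ : ℤ → ℤ → ℤ)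
    (h1 : ∀ x y, η ((x, y), true) = true → φ (x + 1) y = φ x y)
    (h2 : ∀ x y, η ((x, y), false) = true → φ x (y + 1) = φ x y) (h : Conn η p q) :
    φ p.1 p.2 = φ q.1 q.2 := by
  induction h with
  | refl => rfl
  | @tail b c _ h' ih =>
    rw [ih]
    rcases h' with ⟨he, hw⟩ | ⟨he, hw⟩ | ⟨he, hw⟩ | ⟨he, hw⟩ <;> subst hw
    · exact (h1 _ _ he).symm
    · exact h1 _ _ he
    · exact (h2 _ _ he).symm
    · exact h2 _ _ he

lemma dual_step {ω : Config} {p : Edge → Prop} {e : Edge} (h : res p (dualc ω) e = true) :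
    ω (dtau e) = false ∧ p e := by
  rw [res_true] at h
  exact ⟨by simpa [dualc] using h.1, h.2⟩

/-- an open left-right path blocks dual bottom-top paths -/
lemma block {ω η : Config} {u v p q : Vertex} {y0 y1 : ℤ}
    (hω : ∀ x y, ω ((x, y), true) = true → y0 ≤ y ∧ y ≤ y1) (h : Conn ω u v)
    (hu : y0 ≤ u.2 ∧ u.2 ≤ y1) (hv : y0 ≤ v.2 ∧ v.2 ≤ y1)
    (hη : ∀ e, η e = true → ω (dtau e) = false)
    (hx : ∀ x y, η ((x, y), false) = true → u.1 ≤ x ∧ x < v.1)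
    (hp : p.2 < y0) (hq : y1 ≤ q.2) : ¬ Conn η p q := by
  intro hc
  obtain ⟨φ, h1, h2, h3, h4⟩ := pot hω h hu hv
  have := dual_const φ (fun x y he => by
      have := h2 (x + 1) y (hη _ he)
      simpa using this) (fun x y he => by
      have := hx x y he
      have := h1 x (y + 1) (hη _ he) (by omega) (by omega)
      simpa using this) hc
  rw [h3 _ _ hp, h4 _ _ hq] at this
  omega

/-- an open left-right path meets every bottom-top path -/
lemma meet {ω η : Config} {u v p q : Vertex} {y0 y1 : ℤ}
    (hω : ∀ x y, ω ((x, y), true) = true → y0 ≤ y ∧ y ≤ y1) (h : Conn ω u v)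
    (hu : y0 ≤ u.2 ∧ u.2 ≤ y1) (hv : y0 ≤ v.2 ∧ v.2 ≤ y1)
    (hx : ∀ z, Conn η p z → u.1 ≤ z.1 ∧ z.1 ≤ v.1) (hp : p.2 ≤ y0) (hq : y1 ≤ q.2)
    (hc : Conn η p q) : ∃ z, Conn ω u z ∧ Conn η p z := by
  by_contra hn
  push Not at hn
  set ω' := res (inV (Conn ω u)) ω with hω'
  have hcv : Conn ω' u v := by
    rcases Conn.exit (P := Conn ω u) (Conn.refl u) h with h' | ⟨a, b, h1, h2, h3, h4, -⟩
    · exact h'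
    · exact absurd (h2.tail h3) h4
  have hcl : ∀ z, Conn η p z → ∀ e : Edge, (e.1 = z ∨ tl e = z) → ω' e = false := by
    intro z hz e he
    rw [hω', res_false]
    rintro ⟨-, h1, h2⟩
    rcases he with rfl | rfl
    · exact hn _ h1 hz
    · exact hn _ h2 hz
  obtain ⟨φ, h1, h2, h3, h4⟩ := pot (ω := ω') (y0 := y0) (y1 := y1)
    (fun x y he => hω x y (res_true.1 he).1) hcv hu hv
  have hstep : ∀ z, Conn η p z → φ z.1 z.2 = φ z.1 (z.2 - 1) := by
    intro z hz
    refine h1 z.1 z.2 (hcl z hz _ (Or.inl rfl)) ?_ ?_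
    · rintro ⟨e1, e2⟩
      have := (hx z hz).2
      exact hn z (by
        have : z = v := Prod.ext (by omega) e1
        rw [this]; exact h) hz
    · rintro ⟨e1, e2⟩
      have := (hx z hz).1
      omega
  have key : ∀ z, Conn η p z → φ z.1 z.2 = φ p.1 p.2 := by
    intro z hz
    induction hz with
    | refl => rfl
    | @tail b c hb h' ih =>
      have hb : Conn η p b := hb
      have hc' : Conn η p c := hb.tail h'
      rw [← ih]
      rcases h' with ⟨he, hw⟩ | ⟨he, hw⟩ | ⟨he, hw⟩ | ⟨he, hw⟩ <;> subst hw
      · have := h2 (b.1 + 1) b.2 (hcl _ hc' _ (Or.inl rfl))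
        simpa using this
      · have := h2 (c.1 + 1) c.2 (hcl _ hb _ (Or.inl rfl))
        simpa using this.symm
      · have := hstep _ hc'
        simpa using this
      · have := hstep _ hb
        simpa using this.symm
  have e1 := key q hc
  have e2 := hstep p (Conn.refl p)
  rw [h4 _ _ hq, e2, h3 _ _ (by omega)] at e1
  omega

end DynPerc
end

section
open scoped BigOperators
namespace DynPerc
open Classical

def SE (L h : ℤ) (e : Edge) : Prop :=
  if e.2 then 0 ≤ e.1.1 ∧ e.1.1 < L ∧ 0 ≤ e.1.2 ∧ e.1.2 ≤ h
  else 1 ≤ e.1.1 ∧ e.1.1 < L ∧ 0 ≤ e.1.2 ∧ e.1.2 < h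

lemma SE_true {L h x y : ℤ} : SE L h ((x, y), true) ↔ 0 ≤ x ∧ x < L ∧ 0 ≤ y ∧ y ≤ h := Iff.rfl
lemma SE_false {L h x y : ℤ} : SE L h ((x, y), false) ↔ 1 ≤ x ∧ x < L ∧ 0 ≤ y ∧ y < h := by
  simp [SE]

def Dset (L h : ℤ) (ω : Config) (f : Vertex) : Prop :=
  ∃ x0, 0 ≤ x0 ∧ x0 < L ∧ Conn (res (fun e => SE L h (dtau e)) (dualc ω)) (x0, -1) f

def Jset (L h : ℤ) (ω : Config) (e : Edge) : Prop :=
  SE L h e ∧ (Dset L h ω e.1 ∨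
    if e.2 then Dset L h ω (e.1.1, e.1.2 - 1) else Dset L h ω (e.1.1 - 1, e.1.2))

lemma Dset_step {L h : ℤ} {ω : Config} {f g : Vertex} {e : Edge} (hf : Dset L h ω f)
    (hS : SE L h (dtau e)) (hc : ω (dtau e) = false)
    (hfg : (f = e.1 ∧ g = tl e) ∨ (g = e.1 ∧ f = tl e)) : Dset L h ω g := by
  obtain ⟨x0, h1, h2, h3⟩ := hf
  refine ⟨x0, h1, h2, h3.tail (openAdj_iff.2 ⟨e, ?_, hfg⟩)⟩
  rw [res_true]
  exact ⟨by simp [dualc, hc], hS⟩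

lemma Dset_h {L h x y : ℤ} {ω : Config} (hS : SE L h ((x, y), true))
    (hne : ¬ (Dset L h ω (x, y) ↔ Dset L h ω (x, y - 1))) : ω ((x, y), true) = true := by
  by_contra hc
  rw [Bool.not_eq_true] at hc
  apply hne
  have e1 : dtau ((x, y - 1), false) = ((x, y), true) := by simp
  constructor <;> intro hD
  · exact Dset_step (e := ((x, y - 1), false)) hD (by rw [e1]; exact hS) (by rw [e1]; exact hc)
      (Or.inr ⟨rfl, by simp⟩)
  · exact Dset_step (e := ((x, y - 1), false)) hD (by rw [e1]; exact hS) (by rw [e1]; exact hc)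
      (Or.inl ⟨rfl, by simp⟩)

lemma Dset_v {L h x y : ℤ} {ω : Config} (hS : SE L h ((x, y), false))
    (hne : ¬ (Dset L h ω (x, y) ↔ Dset L h ω (x - 1, y))) : ω ((x, y), false) = true := by
  by_contra hc
  rw [Bool.not_eq_true] at hc
  apply hne
  have e1 : dtau ((x - 1, y), true) = ((x, y), false) := by simp
  constructor <;> intro hD
  · exact Dset_step (e := ((x - 1, y), true)) hD (by rw [e1]; exact hS) (by rw [e1]; exact hc)
      (Or.inr ⟨rfl, by simp⟩)
  · exact Dset_step (e := ((x - 1, y), true)) hD (by rw [e1]; exact hS) (by rw [e1]; exact hc)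
      (Or.inl ⟨rfl, by simp⟩)

lemma cross_exists {L h : ℕ} (hL : 1 ≤ L) {ω : Config} (hn : ∀ x, ¬ Dset L h ω (x, (h : ℤ))) :
    ∃ a b : ℤ, 0 ≤ a ∧ a ≤ h ∧ 0 ≤ b ∧ b ≤ h ∧
      Conn (res (Jset L h ω) ω) (0, a) ((L : ℤ), b) := by
  by_contra hcon
  push Not at hcon
  set C : Vertex → Prop := fun v => ∃ a : ℤ, 0 ≤ a ∧ a ≤ h ∧ Conn (res (Jset L h ω) ω) (0, a) v
  set c : ℤ → ℤ → ℤ := fun x y => if C (x, y) then 1 else 0 with hcdef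
  set d : ℤ → ℤ → ℤ := fun x y => if Dset L h ω (x, y) then 1 else 0 with hddef
  have dbot : ∀ x : ℤ, 0 ≤ x → x < L → d x (-1) = 1 := by
    intro x h1 h2
    rw [hddef]
    exact if_pos ⟨x, h1, h2, Conn.refl _⟩
  have dtop : ∀ x : ℤ, d x h = 0 := fun x => if_neg (hn x)
  have cC : ∀ v w, OpenAdj (res (Jset L h ω) ω) v w → (C v ↔ C w) := by
    intro v w hvw
    constructor
    · rintro ⟨a, h1, h2, h3⟩
      exact ⟨a, h1, h2, h3.tail hvw⟩
    · rintro ⟨a, h1, h2, h3⟩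
      exact ⟨a, h1, h2, h3.tail hvw.symm⟩
  have FA : ∀ x y : ℤ, 0 ≤ x → x < L → 0 ≤ y → y ≤ h →
      c x y * (d x (y - 1) - d x y) = c (x + 1) y * (d x (y - 1) - d x y) := by
    intro x y h1 h2 h3 h4
    by_cases hne : Dset L h ω (x, y) ↔ Dset L h ω (x, y - 1)
    · have : d x (y - 1) - d x y = 0 := by simp [hddef, hne]
      rw [this]; ring
    · have hS : SE L h ((x, y), true) := ⟨h1, h2, h3, h4⟩
      have ho := Dset_h hS hne
      have hJ : Jset L h ω ((x, y), true) := ⟨hS, by simp only [if_true]; tauto⟩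
      have := cC (x, y) (x + 1, y) (openAdj_iff.2
        ⟨((x, y), true), res_true.2 ⟨ho, hJ⟩, Or.inl ⟨rfl, rfl⟩⟩)
      simp only [hcdef, this]
  have FB : ∀ x y : ℤ, 1 ≤ x → x < L → 0 ≤ y → y < h →
      c x y * (d x y - d (x - 1) y) = c x (y + 1) * (d x y - d (x - 1) y) := by
    intro x y h1 h2 h3 h4
    by_cases hne : Dset L h ω (x, y) ↔ Dset L h ω (x - 1, y)
    · have : d x y - d (x - 1) y = 0 := by simp [hddef, hne]
      rw [this]; ring
    · have hS : SE L h ((x, y), false) := SE_false.2 ⟨h1, h2, h3, h4⟩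
      have ho := Dset_v hS hne
      have hJ : Jset L h ω ((x, y), false) := ⟨hS, by
        simp only [Bool.false_eq_true, if_false]; tauto⟩
      have := cC (x, y) (x, y + 1) (openAdj_iff.2
        ⟨((x, y), false), res_true.2 ⟨ho, hJ⟩, Or.inl ⟨rfl, rfl⟩⟩)
      simp only [hcdef, this]
  set N : ℕ → ℤ := fun i => ∑ j ∈ Finset.range (h + 1), c i j * (d i (j - 1) - d i j) with hN
  have N0 : N 0 = 1 := by
    have e1 : N 0 = ∑ j ∈ Finset.range (h + 1),
        ((fun j : ℕ => d 0 ((j : ℤ) - 1)) j - (fun j : ℕ => d 0 ((j : ℤ) - 1)) (j + 1)) := by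
      rw [hN]
      refine Finset.sum_congr rfl fun j hj => ?_
      rw [Finset.mem_range] at hj
      have : c 0 j = 1 := if_pos ⟨(j : ℤ), by omega, by omega, Conn.refl _⟩
      simp [this]
    rw [e1, Finset.sum_range_sub']
    have := dbot 0 le_rfl (by omega)
    have := dtop 0
    simp_all
  have Nst : ∀ i : ℕ, i < L → N i = 1 := by
    intro i
    induction i with
    | zero => intro _; exact N0
    | succ i ih =>
      intro hi
      have ih := ih (by omega)
      set x : ℤ := ((i + 1 : ℕ) : ℤ) with hx
      have hxi : (i : ℤ) = x - 1 := by omega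
      have e1 : N (i + 1) - N i = ∑ j ∈ Finset.range (h + 1),
          ((fun j : ℕ => c x j * (d x ((j : ℤ) - 1) - d (x - 1) ((j : ℤ) - 1))) j -
           (fun j : ℕ => c x j * (d x ((j : ℤ) - 1) - d (x - 1) ((j : ℤ) - 1))) (j + 1)) := by
        rw [hN]
        dsimp only
        rw [← Finset.sum_sub_distrib]
        refine Finset.sum_congr rfl fun j hj => ?_
        rw [Finset.mem_range] at hj
        rw [hxi, ← hx]
        have f1 := FA (x - 1) j (by omega) (by omega) (by omega) (by omega)
        rw [sub_add_cancel] at f1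
        rw [f1]
        push_cast
        rw [add_sub_cancel_right]
        by_cases hjh : j = h
        · subst hjh
          rw [dtop, dtop]
          ring
        · have f2 := FB x j (by omega) (by omega) (by omega) (by omega)
          linear_combination -f2
      rw [Finset.sum_range_sub'] at e1
      have g0 := dbot x (by omega) (by omega)
      have g1 := dbot (x - 1) (by omega) (by omega)
      have g2 := dtop x
      have g3 := dtop (x - 1)
      push_cast at e1
      rw [add_sub_cancel_right, g2, g3, zero_sub, g0, g1] at e1
      linarith
  have hlast := Nst (L - 1) (by omega)
  have hx : ∃ j ∈ Finset.range (h + 1), c ((L - 1 : ℕ) : ℤ) j *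
      (d ((L - 1 : ℕ) : ℤ) (j - 1) - d ((L - 1 : ℕ) : ℤ) j) ≠ 0 := by
    apply Finset.exists_ne_zero_of_sum_ne_zero
    have : N (L - 1) ≠ 0 := by rw [hlast]; norm_num
    exact this
  obtain ⟨j, hj, hne⟩ := hx
  rw [Finset.mem_range] at hj
  rw [FA _ _ (by omega) (by omega) (by omega) (by omega)] at hne
  have e2 : ((L - 1 : ℕ) : ℤ) + 1 = L := by omega
  rw [e2] at hne
  have hc1 : C ((L : ℤ), (j : ℤ)) := by
    by_contra hc
    apply hne
    have : c L j = 0 := if_neg hc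
    rw [this]; ring
  obtain ⟨a, h1, h2, h3⟩ := hc1
  exact hcon a j h1 h2 (by omega) (by omega) h3

end DynPerc
end

section
open scoped BigOperators
namespace DynPerc
open Classical

lemma Dep_res (p : Edge → Prop) (B : Config → Prop) : Dep (fun ω => B (res p ω)) {e | p e} := by
  intro ω ω' h
  have : res p ω = res p ω' := by
    funext e
    by_cases hp : p e
    · simp [res, h e hp]
    · simp [res, hp]
  simp only [this]

lemma Inc_res {B : Config → Prop} (p : Edge → Prop) (hB : Inc B) :
    Inc (fun ω => B (res p ω)) := fun ω ω' h =>
  hB _ _ fun e he => by rw [res_true] at *; exact ⟨h e he.1, he.2⟩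

noncomputable def bigE (M : ℤ) : Finset Edge :=
  (Finset.Icc (-M) M ×ˢ Finset.Icc (-M) M) ×ˢ (Finset.univ : Finset Bool)

lemma mem_bigE {M : ℤ} {e : Edge} : e ∈ bigE M ↔ (-M ≤ e.1.1 ∧ e.1.1 ≤ M) ∧ -M ≤ e.1.2 ∧ e.1.2 ≤ M := by
  simp [bigE]

lemma loc_of_bdd {A : Config → Prop} {p : Edge → Prop} (hD : Dep A {e | p e}) (M : ℤ)
    (h : ∀ e, p e → e ∈ bigE M) : Loc A := ⟨bigE M, hD.mono fun e he => h e he⟩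

def rect (x0 x1 y0 y1 : ℤ) (v : Vertex) : Prop := x0 ≤ v.1 ∧ v.1 ≤ x1 ∧ y0 ≤ v.2 ∧ v.2 ≤ y1

def HC (x0 x1 y0 y1 : ℤ) (ω : Config) : Prop :=
  ∃ a b : ℤ, rect x0 x1 y0 y1 (x0, a) ∧ rect x0 x1 y0 y1 (x1, b) ∧
    Conn (res (inV (rect x0 x1 y0 y1)) ω) (x0, a) (x1, b)

def VC (x0 x1 y0 y1 : ℤ) (ω : Config) : Prop :=
  ∃ a b : ℤ, rect x0 x1 y0 y1 (a, y0) ∧ rect x0 x1 y0 y1 (b, y1) ∧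
    Conn (res (inV (rect x0 x1 y0 y1)) ω) (a, y0) (b, y1)

lemma rect_bdd {x0 x1 y0 y1 : ℤ} {e : Edge} (h : inV (rect x0 x1 y0 y1) e) :
    e ∈ bigE (|x0| + |x1| + |y0| + |y1|) := by
  rw [mem_bigE]
  obtain ⟨⟨h1, h2, h3, h4⟩, -⟩ := h
  have := neg_abs_le x0
  have := neg_abs_le y0
  have := le_abs_self x1
  have := le_abs_self y1
  have := abs_nonneg x0
  have := abs_nonneg y0
  have := abs_nonneg x1
  have := abs_nonneg y1
  omega

lemma HC_dep (x0 x1 y0 y1 : ℤ) : Dep (HC x0 x1 y0 y1) {e | inV (rect x0 x1 y0 y1) e} :=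
  Dep_res (inV (rect x0 x1 y0 y1)) (fun ω => ∃ a b : ℤ, rect x0 x1 y0 y1 (x0, a) ∧
    rect x0 x1 y0 y1 (x1, b) ∧ Conn ω (x0, a) (x1, b))

lemma VC_dep (x0 x1 y0 y1 : ℤ) : Dep (VC x0 x1 y0 y1) {e | inV (rect x0 x1 y0 y1) e} :=
  Dep_res (inV (rect x0 x1 y0 y1)) (fun ω => ∃ a b : ℤ, rect x0 x1 y0 y1 (a, y0) ∧
    rect x0 x1 y0 y1 (b, y1) ∧ Conn ω (a, y0) (b, y1))

lemma HC_loc (x0 x1 y0 y1 : ℤ) : Loc (HC x0 x1 y0 y1) :=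
  loc_of_bdd (HC_dep x0 x1 y0 y1) _ fun _ => rect_bdd

lemma VC_loc (x0 x1 y0 y1 : ℤ) : Loc (VC x0 x1 y0 y1) :=
  loc_of_bdd (VC_dep x0 x1 y0 y1) _ fun _ => rect_bdd

lemma HC_inc (x0 x1 y0 y1 : ℤ) : Inc (HC x0 x1 y0 y1) := by
  rintro ω ω' h ⟨a, b, h1, h2, h3⟩
  exact ⟨a, b, h1, h2, Inc_conn_res _ _ _ ω ω' h h3⟩

lemma VC_inc (x0 x1 y0 y1 : ℤ) : Inc (VC x0 x1 y0 y1) := by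
  rintro ω ω' h ⟨a, b, h1, h2, h3⟩
  exact ⟨a, b, h1, h2, Inc_conn_res _ _ _ ω ω' h h3⟩

/-! automorphisms -/

def IsAut (σ : Vertex ≃ Vertex) (τ : Edge ≃ Edge) : Prop :=
  ∀ e, (σ e.1 = (τ e).1 ∧ σ (tl e) = tl (τ e)) ∨ (σ e.1 = tl (τ e) ∧ σ (tl e) = (τ e).1)

lemma IsAut.symm {σ : Vertex ≃ Vertex} {τ : Edge ≃ Edge} (h : IsAut σ τ) :
    IsAut σ.symm τ.symm := by
  intro e
  have := h (τ.symm e)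
  rw [Equiv.apply_symm_apply] at this
  rcases this with ⟨h1, h2⟩ | ⟨h1, h2⟩
  · left
    rw [← h1, ← h2]; simp
  · right
    rw [← h1, ← h2]; simp

lemma IsAut.conn1 {σ : Vertex ≃ Vertex} {τ : Edge ≃ Edge} (h : IsAut σ τ) {ω : Config}
    {u v : Vertex} (hc : Conn (fun e => ω (τ e)) u v) : Conn ω (σ u) (σ v) := by
  refine Relation.ReflTransGen.lift σ ?_ _ _ hc
  intro a b hab
  rw [openAdj_iff] at hab
  obtain ⟨e, he, h'⟩ := hab
  refine openAdj_iff.2 ⟨τ e, he, ?_⟩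
  rcases h' with ⟨rfl, rfl⟩ | ⟨rfl, rfl⟩ <;> rcases h e with ⟨h1, h2⟩ | ⟨h1, h2⟩ <;> simp [h1, h2]

lemma IsAut.conn {σ : Vertex ≃ Vertex} {τ : Edge ≃ Edge} (h : IsAut σ τ) {ω : Config}
    {u v : Vertex} : Conn (fun e => ω (τ e)) u v ↔ Conn ω (σ u) (σ v) := by
  refine ⟨h.conn1, fun hc => ?_⟩
  have := h.symm.conn1 (ω := fun e => ω (τ e)) (u := σ u) (v := σ v) (by simpa using hc)
  simpa using this

lemma IsAut.inV {σ : Vertex ≃ Vertex} {τ : Edge ≃ Edge} (h : IsAut σ τ) (P : Vertex → Prop)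
    (e : Edge) : inV P (τ e) ↔ inV (fun v => P (σ v)) e := by
  unfold DynPerc.inV
  rcases h e with ⟨h1, h2⟩ | ⟨h1, h2⟩
  · simp only [h1, h2]
  · simp only [h1, h2]; tauto

lemma IsAut.conn_inV {σ : Vertex ≃ Vertex} {τ : Edge ≃ Edge} (h : IsAut σ τ) {ω : Config}
    {u v : Vertex} {P Q : Vertex → Prop} (hPQ : ∀ v, P v ↔ Q (σ v)) :
    Conn (res (DynPerc.inV P) (fun e => ω (τ e))) u v ↔
      Conn (res (DynPerc.inV Q) ω) (σ u) (σ v) := by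
  rw [← h.conn]
  have : res (DynPerc.inV P) (fun e => ω (τ e)) = fun e => res (DynPerc.inV Q) ω (τ e) := by
    funext e
    unfold res
    simp only [h.inV Q e]
    have : P = fun v => Q (σ v) := funext fun v => propext (hPQ v)
    rw [this]
  rw [this]

def vtrans (a b : ℤ) : Vertex ≃ Vertex where
  toFun v := (v.1 + a, v.2 + b)
  invFun v := (v.1 - a, v.2 - b)
  left_inv v := by simp
  right_inv v := by simp

def etrans (a b : ℤ) : Edge ≃ Edge where
  toFun e := ((e.1.1 + a, e.1.2 + b), e.2)
  invFun e := ((e.1.1 - a, e.1.2 - b), e.2)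
  left_inv v := by simp
  right_inv v := by simp

lemma aut_trans (a b : ℤ) : IsAut (vtrans a b) (etrans a b) := by
  rintro ⟨⟨x, y⟩, c⟩
  left
  cases c <;> simp [vtrans, etrans, tl] <;> ring

def vswap : Vertex ≃ Vertex where
  toFun v := (v.2, v.1)
  invFun v := (v.2, v.1)
  left_inv v := by simp
  right_inv v := by simp

def eswap : Edge ≃ Edge where
  toFun e := ((e.1.2, e.1.1), !e.2)
  invFun e := ((e.1.2, e.1.1), !e.2)
  left_inv v := by simp
  right_inv v := by simp

lemma aut_swap : IsAut vswap eswap := by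
  rintro ⟨⟨x, y⟩, c⟩
  left
  cases c <;> simp [vswap, eswap, tl]

def vrefl (c : ℤ) : Vertex ≃ Vertex where
  toFun v := (c - v.1, v.2)
  invFun v := (c - v.1, v.2)
  left_inv v := by simp
  right_inv v := by simp

def erefl (c : ℤ) : Edge ≃ Edge where
  toFun e := if e.2 then ((c - e.1.1 - 1, e.1.2), true) else ((c - e.1.1, e.1.2), false)
  invFun e := if e.2 then ((c - e.1.1 - 1, e.1.2), true) else ((c - e.1.1, e.1.2), false)
  left_inv := by rintro ⟨⟨x, y⟩, b⟩; cases b <;> simp; omega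
  right_inv := by rintro ⟨⟨x, y⟩, b⟩; cases b <;> simp; omega

lemma aut_refl (c : ℤ) : IsAut (vrefl c) (erefl c) := by
  rintro ⟨⟨x, y⟩, b⟩
  cases b
  · left; simp [vrefl, erefl, tl]
  · right; simp [vrefl, erefl, tl]; ring

lemma IsAut.trans {σ σ' : Vertex ≃ Vertex} {τ τ' : Edge ≃ Edge} (h : IsAut σ τ)
    (h' : IsAut σ' τ') : IsAut (σ.trans σ') (τ.trans τ') := by
  intro e
  simp only [Equiv.trans_apply]
  rcases h e with ⟨h1, h2⟩ | ⟨h1, h2⟩ <;> rcases h' (τ e) with ⟨h3, h4⟩ | ⟨h3, h4⟩ <;>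
    simp [h1, h2, h3, h4]

def vrefY (c : ℤ) : Vertex ≃ Vertex := (vswap.trans (vrefl c)).trans vswap
def erefY (c : ℤ) : Edge ≃ Edge := (eswap.trans (erefl c)).trans eswap

lemma aut_refY (c : ℤ) : IsAut (vrefY c) (erefY c) := (aut_swap.trans (aut_refl c)).trans aut_swap

@[simp] lemma vrefY_apply (c : ℤ) (v : Vertex) : vrefY c v = (v.1, c - v.2) := rfl
@[simp] lemma vrefl_apply (c : ℤ) (v : Vertex) : vrefl c v = (c - v.1, v.2) := rfl
@[simp] lemma vswap_apply (v : Vertex) : vswap v = (v.2, v.1) := rfl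
@[simp] lemma vtrans_apply (a b : ℤ) (v : Vertex) : vtrans a b v = (v.1 + a, v.2 + b) := rfl

noncomputable def hp (L h : ℤ) : ℝ := Pr (HC 0 L 0 h)

lemma Pr_HC (x0 x1 y0 y1 : ℤ) : Pr (HC x0 x1 y0 y1) = hp (x1 - x0) (y1 - y0) := by
  unfold hp
  rw [← Pr_map (etrans (-x0) (-y0)) (HC_loc x0 x1 y0 y1)]
  congr 1
  funext ω
  apply propext
  constructor
  · rintro ⟨a, b, h1, h2, h3⟩
    rw [(aut_trans _ _).conn_inV (Q := rect 0 (x1 - x0) 0 (y1 - y0))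
      (by intro v; simp only [rect, vtrans_apply]; omega)] at h3
    simp only [rect, vtrans_apply] at h1 h2 h3
    refine ⟨a + -y0, b + -y0, ?_, ?_, ?_⟩
    · simp only [rect]; omega
    · simp only [rect]; omega
    · convert h3 using 2 <;> omega
  · rintro ⟨a, b, h1, h2, h3⟩
    simp only [rect] at h1 h2
    refine ⟨a + y0, b + y0, ?_, ?_, ?_⟩
    · simp only [rect]; omega
    · simp only [rect]; omega
    rw [(aut_trans _ _).conn_inV (Q := rect 0 (x1 - x0) 0 (y1 - y0))
      (by intro v; simp only [rect, vtrans_apply]; omega)]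
    simp only [vtrans_apply]
    convert h3 using 2 <;> omega

lemma Pr_VC (x0 x1 y0 y1 : ℤ) : Pr (VC x0 x1 y0 y1) = hp (y1 - y0) (x1 - x0) := by
  rw [← Pr_HC y0 y1 x0 x1, ← Pr_map eswap (VC_loc x0 x1 y0 y1)]
  congr 1
  funext ω
  apply propext
  constructor
  · rintro ⟨a, b, h1, h2, h3⟩
    rw [aut_swap.conn_inV (Q := rect y0 y1 x0 x1)
      (by intro v; simp only [rect, vswap_apply]; omega)] at h3
    simp only [rect, vswap_apply] at h1 h2 h3
    exact ⟨a, b, by simp only [rect]; omega, by simp only [rect]; omega, h3⟩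
  · rintro ⟨a, b, h1, h2, h3⟩
    simp only [rect] at h1 h2
    refine ⟨a, b, by simp only [rect]; omega, by simp only [rect]; omega, ?_⟩
    rw [aut_swap.conn_inV (Q := rect y0 y1 x0 x1)
      (by intro v; simp only [rect, vswap_apply]; omega)]
    exact h3

lemma Loc_dual {A : Config → Prop} (hA : Loc A) : Loc (fun ω => A (dualc ω)) :=
  Loc_map dtau (Loc_flip hA)

lemma Pr_dual {A : Config → Prop} (hA : Loc A) : Pr (fun ω => A (dualc ω)) = Pr A := by
  rw [← Pr_flip hA, ← Pr_map dtau (Loc_flip hA)]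
  rfl

lemma SE_inV {L h : ℤ} {e : Edge} (hS : SE L h e) : inV (rect 0 L 0 h) e := by
  obtain ⟨⟨x, y⟩, b⟩ := e
  cases b
  · rw [SE_false] at hS
    simp only [inV, rect, tl_false]; omega
  · rw [SE_true] at hS
    simp only [inV, rect, tl_true]; omega

lemma SE_dual_inV {L h : ℤ} {e : Edge} (hS : SE L h (dtau e)) : inV (rect 0 (L - 1) (-1) h) e := by
  obtain ⟨⟨x, y⟩, b⟩ := e
  cases b
  · rw [dtau_false, SE_true] at hS
    simp only [inV, rect, tl_false]; omega
  · rw [dtau_true, SE_false] at hS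
    simp only [inV, rect, tl_true]; omega

lemma HC_or_dual {L h : ℕ} (hL : 1 ≤ L) (ω : Config) :
    HC 0 L 0 h ω ∨ VC 0 (L - 1) (-1) h (dualc ω) := by
  by_cases hn : ∀ x, ¬ Dset L h ω (x, (h : ℤ))
  · left
    obtain ⟨a, b, h1, h2, h3, h4, h5⟩ := cross_exists hL hn
    refine ⟨a, b, ?_, ?_, h5.res_mono fun e he => SE_inV he.1⟩ <;> simp only [rect] <;> omega
  · right
    push Not at hn
    obtain ⟨x, x0, h1, h2, h3⟩ := hn
    have h3 := h3.res_mono (fun e he => SE_dual_inV he)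
    have h4 : rect 0 (L - 1) (-1) h (x0, -1) := by simp only [rect]; omega
    exact ⟨x0, x, h4, h3.inV_end h4, h3⟩

lemma hp_half (h : ℕ) : 1 / 2 ≤ hp (h + 1) h := by
  have h1 := Pr_or_le (HC_loc 0 (h + 1) 0 h) (Loc_dual (VC_loc 0 h (-1) h))
  rw [Pr_dual (VC_loc 0 h (-1) h), Pr_HC, Pr_VC] at h1
  have h2 : Pr (fun ω => HC 0 (h + 1) 0 h ω ∨ VC 0 h (-1) h (dualc ω)) = 1 := by
    have : (fun ω => HC 0 (h + 1) 0 h ω ∨ VC 0 h (-1) h (dualc ω)) = fun _ => True := by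
      funext ω
      have := HC_or_dual (L := h + 1) (h := h) (by omega) ω
      push_cast at this
      rw [add_sub_cancel_right] at this
      simpa using this
    rw [this, Pr_eq (E := ∅) (fun _ _ _ => Iff.rfl), probOn_true]
  rw [h2] at h1
  simp only [sub_zero, sub_neg_eq_add] at h1
  linarith

lemma openAdj_coord {ω : Config} {a b : Vertex} (h : OpenAdj ω a b) :
    (b.1 = a.1 + 1 ∧ b.2 = a.2) ∨ (a.1 = b.1 + 1 ∧ a.2 = b.2) ∨ (b.2 = a.2 + 1 ∧ a.1 = b.1) ∨
    (a.2 = b.2 + 1 ∧ a.1 = b.1) := by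
  rcases h with ⟨-, h⟩ | ⟨-, h⟩ | ⟨-, h⟩ | ⟨-, h⟩ <;> rw [h] <;> simp

lemma Conn.res_res {p q : Edge → Prop} {ω : Config} {u v : Vertex}
    (hc : Conn (res p (res q ω)) u v) : Conn (res (fun e => q e ∧ p e) ω) u v :=
  hc.mono fun e he => by simp only [res_true] at *; tauto

lemma strip_x {ω : Config} {u v : Vertex} {x0 x1 : ℤ} (hx : x0 ≤ x1) (hu : u.1 ≤ x0)
    (hv : x1 ≤ v.1) (h : Conn ω u v) :
    ∃ a b, Conn (res (inV (fun z => x0 ≤ z.1 ∧ z.1 ≤ x1)) ω) (x0, a) (x1, b) ∧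
      Conn ω u (x0, a) := by
  have s1 : ∃ b, Conn (res (inV (fun z => z.1 ≤ x1)) ω) u (x1, b) := by
    rcases Conn.exit (P := fun z => z.1 ≤ x1) (by omega) h with h' | ⟨a, b, h1, h2, h3, h4, -⟩
    · have := h'.inV_end (by omega)
      have e : v = (x1, v.2) := Prod.ext (by simp only at *; omega) rfl
      exact ⟨v.2, e ▸ h'⟩
    · have := openAdj_coord h3
      have e : a = (x1, a.2) := Prod.ext (by simp only at *; omega) rfl
      exact ⟨a.2, e ▸ h1⟩
  obtain ⟨b, s1⟩ := s1
  have s2 : ∃ a, Conn (res (inV (fun z => x0 ≤ z.1)) (res (inV (fun z => z.1 ≤ x1)) ω))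
      (x1, b) (x0, a) := by
    rcases Conn.exit (P := fun z => x0 ≤ z.1) hx s1.symm with h' | ⟨a, b, h1, h2, h3, h4, -⟩
    · have := h'.inV_end hx
      have e : u = (x0, u.2) := Prod.ext (by simp only at *; omega) rfl
      exact ⟨u.2, e ▸ h'⟩
    · have := openAdj_coord h3
      have e : a = (x0, a.2) := Prod.ext (by simp only at *; omega) rfl
      exact ⟨a.2, e ▸ h1⟩
  obtain ⟨a, s2⟩ := s2
  refine ⟨a, b, s2.symm.res_res.res_mono ?_, s1.of_res.trans s2.of_res.of_res⟩
  rintro e ⟨⟨h1, h2⟩, h3, h4⟩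
  exact ⟨⟨h3, h1⟩, h4, h2⟩

/-- a connection inside a box from the left of `x0` to the right of `x1` crosses -/
lemma HC_of_conn {ω : Config} {P : Vertex → Prop} {u v : Vertex} {x0 x1 y0 y1 : ℤ} (hx : x0 ≤ x1)
    (hP : ∀ z, P z → y0 ≤ z.2 ∧ z.2 ≤ y1) (hPu : P u)
    (hu : u.1 ≤ x0) (hv : x1 ≤ v.1) (h : Conn (res (inV P) ω) u v) : HC x0 x1 y0 y1 ω := by
  obtain ⟨a, b, h1, h2⟩ := strip_x hx hu hv h
  have ha := hP _ (h2.inV_end hPu)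
  have h3 : Conn (res (inV P) ω) u (x1, b) := h2.trans h1.of_res
  have hb := hP _ (h3.inV_end hPu)
  refine ⟨a, b, ⟨le_rfl, hx, ha⟩, ⟨hx, le_rfl, hb⟩, h1.res_res.res_mono ?_⟩
  rintro e ⟨⟨h1, h2⟩, h3, h4⟩
  exact ⟨⟨h3.1, h3.2, hP _ h1⟩, ⟨h4.1, h4.2, hP _ h2⟩⟩

lemma HC_swap {x0 x1 y0 y1 : ℤ} {ω : Config} :
    VC x0 x1 y0 y1 (fun e => ω (eswap e)) ↔ HC y0 y1 x0 x1 ω := by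
  constructor
  · rintro ⟨a, b, h1, h2, h3⟩
    rw [aut_swap.conn_inV (Q := rect y0 y1 x0 x1)
      (by intro v; simp only [rect, vswap_apply]; omega)] at h3
    simp only [rect, vswap_apply] at h1 h2 h3
    exact ⟨a, b, by simp only [rect]; omega, by simp only [rect]; omega, h3⟩
  · rintro ⟨a, b, h1, h2, h3⟩
    simp only [rect] at h1 h2
    refine ⟨a, b, by simp only [rect]; omega, by simp only [rect]; omega, ?_⟩
    rw [aut_swap.conn_inV (Q := rect y0 y1 x0 x1)
      (by intro v; simp only [rect, vswap_apply]; omega)]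
    exact h3

lemma VC_of_conn {ω : Config} {P : Vertex → Prop} {u v : Vertex} {x0 x1 y0 y1 : ℤ} (hy : y0 ≤ y1)
    (hP : ∀ z, P z → x0 ≤ z.1 ∧ z.1 ≤ x1) (hPu : P u)
    (hu : u.2 ≤ y0) (hv : y1 ≤ v.2) (h : Conn (res (inV P) ω) u v) : VC x0 x1 y0 y1 ω := by
  have e : (fun e => (fun e => ω (eswap e)) (eswap e)) = ω := by
    funext e; simp [eswap]
  rw [← e]
  refine (HC_swap (ω := fun e => ω (eswap e))).2 ?_
  refine HC_of_conn (P := fun z => P (vswap z)) (u := vswap u) (v := vswap v) hy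
    (fun z hz => hP _ hz) (by simpa using hPu) hu hv ?_
  rw [aut_swap.conn_inV (Q := P) (fun v => Iff.rfl)]
  simpa using h

lemma hp_mono {L L' h h' : ℤ} (hL0 : 0 ≤ L) (hL : L ≤ L') (hh : h' ≤ h) : hp L' h' ≤ hp L h := by
  refine Pr_mono (HC_loc _ _ _ _) (HC_loc _ _ _ _) ?_
  rintro ω ⟨a, b, h1, h2, h3⟩
  exact HC_of_conn hL0 (fun z hz => ⟨hz.2.2.1, hz.2.2.2.trans hh⟩) h1 le_rfl hL h3

end DynPerc
end

section
open scoped BigOperators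
namespace DynPerc
open Classical

lemma Dset_stop {L h : ℤ} {ω ω' : Config} (hJ : ∀ e, Jset L h ω e → ω' e = ω e) (f : Vertex) :
    Dset L h ω f ↔ Dset L h ω' f := by
  have key : ∀ e : Edge, ∀ g, SE L h (dtau e) → (g = e.1 ∨ g = tl e) → Dset L h ω g →
      Jset L h ω (dtau e) := by
    rintro ⟨⟨x, y⟩, _ | _⟩ g hS hg hD
    · simp only [dtau_false, tl_false] at *
      refine ⟨hS, ?_⟩
      simp only [if_true, add_sub_cancel_right]
      rcases hg with rfl | rfl
      · right; exact hD
      · left; exact hD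
    · simp only [dtau_true, tl_true] at *
      refine ⟨hS, ?_⟩
      simp only [Bool.false_eq_true, if_false, add_sub_cancel_right]
      rcases hg with rfl | rfl
      · right; exact hD
      · left; exact hD
  constructor
  · rintro ⟨x0, h1, h2, h3⟩
    have : ∀ g, Conn (res (fun e => SE L h (dtau e)) (dualc ω)) (x0, -1) g →
        Dset L h ω g ∧ Dset L h ω' g := by
      intro g hg
      induction hg with
      | refl => exact ⟨⟨x0, h1, h2, Conn.refl _⟩, ⟨x0, h1, h2, Conn.refl _⟩⟩
      | tail _ hst ih =>
        obtain ⟨e, he, hfg⟩ := openAdj_iff.1 hst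
        obtain ⟨hc, hS⟩ := dual_step he
        refine ⟨Dset_step ih.1 hS hc hfg, Dset_step ih.2 hS ?_ hfg⟩
        rw [hJ _ (key e _ hS (by tauto) ih.1), hc]
    exact (this f h3).2
  · rintro ⟨x0, h1, h2, h3⟩
    induction h3 with
    | refl => exact ⟨x0, h1, h2, Conn.refl _⟩
    | tail _ hst ih =>
      obtain ⟨e, he, hfg⟩ := openAdj_iff.1 hst
      obtain ⟨hc, hS⟩ := dual_step he
      refine Dset_step ih hS ?_ hfg
      rw [← hJ _ (key e _ hS (by tauto) ih), hc]

lemma Jset_stop {L h : ℤ} {ω ω' : Config} (hJ : ∀ e, Jset L h ω e → ω' e = ω e) :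
    Jset L h ω' = Jset L h ω := by
  funext e
  simp only [Jset, ← Dset_stop hJ]

/-- barrier data -/
structure Bar (n : ℤ) (ρ : Config) (a b : ℤ) : Prop where
  n1 : 1 ≤ n
  ins : ∀ e, ρ e = true → inV (rect 0 n 0 n) e
  ha : 0 ≤ a ∧ a ≤ n
  conn : Conn ρ (0, a) (n, b)

def KK (n : ℤ) (ρ : Config) (a : ℤ) (z : Vertex) : Prop :=
  Conn ρ (0, a) z ∨ Conn ρ (0, a) (2 * n + 1 - z.1, z.2)

def QQ (n : ℤ) (ρ : Config) (a : ℤ) (v : Vertex) : Prop :=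
  rect 0 (2 * n + 1) 0 (2 * n + 1) v ∧ ¬ KK n ρ a v

def BK (n : ℤ) (ρ : Config) (a : ℤ) (ω : Config) : Prop :=
  ∃ t z k : Vertex, t.2 = 2 * n + 1 ∧ rect 0 (2 * n + 1) 0 (2 * n + 1) t ∧
    Conn (res (inV (QQ n ρ a)) ω) t z ∧
    OpenAdj (res (inV (rect 0 (2 * n + 1) 0 (2 * n + 1))) ω) z k ∧ Conn ρ (0, a) k

lemma Bar.K_rect {n a b : ℤ} {ρ : Config} (B : Bar n ρ a b) {z : Vertex} (hz : Conn ρ (0, a) z) :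
    rect 0 n 0 n z := by
  have : Conn (res (inV (rect 0 n 0 n)) ρ) (0, a) z :=
    hz.mono fun e he => res_true.2 ⟨he, B.ins e he⟩
  refine this.inV_end ?_
  have := B.ha
  have := B.n1
  simp only [rect]; omega

lemma Bar.KK_y {n a b : ℤ} {ρ : Config} (B : Bar n ρ a b) {z : Vertex} (hz : KK n ρ a z) :
    0 ≤ z.2 ∧ z.2 ≤ n := by
  rcases hz with hz | hz
  · exact (B.K_rect hz).2.2
  · exact (B.K_rect hz).2.2

lemma KK_mirror {n a : ℤ} {ρ : Config} (z : Vertex) :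
    KK n ρ a (vrefl (2 * n + 1) z) ↔ KK n ρ a z := by
  simp only [KK, vrefl_apply, sub_sub_cancel]
  tauto

noncomputable def pi0 (ρ : Config) (a : ℤ) : Config := fun e => ρ e && decide (Conn ρ (0, a) e.1)

lemma pi0_true {ρ : Config} {a : ℤ} {e : Edge} :
    pi0 ρ a e = true ↔ ρ e = true ∧ Conn ρ (0, a) e.1 := by simp [pi0]

lemma pi0_ends {ρ : Config} {a : ℤ} {e : Edge} (h : pi0 ρ a e = true) :
    Conn ρ (0, a) e.1 ∧ Conn ρ (0, a) (tl e) := by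
  rw [pi0_true] at h
  exact ⟨h.2, h.2.tail (openAdj_iff.2 ⟨e, h.1, Or.inl ⟨rfl, rfl⟩⟩)⟩

lemma pi0_conn {ρ : Config} {a : ℤ} {z : Vertex} (h : Conn ρ (0, a) z) :
    Conn (pi0 ρ a) (0, a) z := by
  induction h with
  | refl => exact Conn.refl _
  | @tail y z h1 h2 ih =>
    refine ih.tail ?_
    obtain ⟨e, he, hfg⟩ := openAdj_iff.1 h2
    refine openAdj_iff.2 ⟨e, pi0_true.2 ⟨he, ?_⟩, hfg⟩
    rcases hfg with ⟨rfl, rfl⟩ | ⟨rfl, rfl⟩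
    · exact h1
    · exact Conn.tail h1 h2

noncomputable def pic (n : ℤ) (ρ : Config) (a b : ℤ) : Config := fun e =>
  pi0 ρ a e || pi0 ρ a (erefl (2 * n + 1) e) || decide (e = ((n, b), true))

lemma pic_true {n : ℤ} {ρ : Config} {a b : ℤ} {e : Edge} : pic n ρ a b e = true ↔
    pi0 ρ a e = true ∨ pi0 ρ a (erefl (2 * n + 1) e) = true ∨ e = ((n, b), true) := by
  simp only [pic, Bool.or_eq_true, decide_eq_true_eq, or_assoc]

lemma Bar.pic_ends {n a b : ℤ} {ρ : Config} (B : Bar n ρ a b) {e : Edge}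
    (h : pic n ρ a b e = true) : KK n ρ a e.1 ∧ KK n ρ a (tl e) := by
  rcases pic_true.1 h with h | h | rfl
  · have := pi0_ends h
    exact ⟨Or.inl this.1, Or.inl this.2⟩
  · have := pi0_ends h
    rcases aut_refl (2 * n + 1) e with ⟨h1, h2⟩ | ⟨h1, h2⟩
    · rw [← h1, ← h2] at this
      exact ⟨Or.inr this.1, Or.inr this.2⟩
    · rw [← h1, ← h2] at this
      exact ⟨Or.inr this.2, Or.inr this.1⟩
  · refine ⟨Or.inl B.conn, Or.inr ?_⟩
    have : 2 * n + 1 - (n + 1) = n := by ring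
    simp only [tl_true, this]
    exact B.conn

lemma Bar.pic_conn {n a b : ℤ} {ρ : Config} (B : Bar n ρ a b) :
    Conn (pic n ρ a b) (0, a) (2 * n + 1, a) := by
  have h1 : Conn (pic n ρ a b) (0, a) (n, b) :=
    (pi0_conn B.conn).mono fun e he => pic_true.2 (Or.inl he)
  have h2 : Conn (fun e => pi0 ρ a (erefl (2 * n + 1) e)) (2 * n + 1, a) (n + 1, b) := by
    rw [(aut_refl (2 * n + 1)).conn]
    have e1 : vrefl (2 * n + 1) (2 * n + 1, a) = (0, a) := by simp
    have e2 : vrefl (2 * n + 1) (n + 1, b) = (n, b) := by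
      simp only [vrefl_apply, Prod.mk.injEq, and_true]; ring
    rw [e1, e2]
    exact pi0_conn B.conn
  have h3 : Conn (pic n ρ a b) (2 * n + 1, a) (n + 1, b) :=
    h2.mono fun e he => pic_true.2 (Or.inr (Or.inl he))
  have h4 : OpenAdj (pic n ρ a b) (n, b) (n + 1, b) :=
    openAdj_iff.2 ⟨((n, b), true), pic_true.2 (Or.inr (Or.inr rfl)), Or.inl ⟨rfl, rfl⟩⟩
  exact (h1.tail h4).trans h3.symm

lemma Bar.pic_KK {n a b : ℤ} {ρ : Config} (B : Bar n ρ a b) {z : Vertex}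
    (h : Conn (pic n ρ a b) (0, a) z) : KK n ρ a z := by
  rcases Relation.ReflTransGen.cases_tail h with h | ⟨y, -, h⟩
  · rw [h]; exact Or.inl (Conn.refl _)
  · obtain ⟨e, he, hfg⟩ := openAdj_iff.1 h
    have := B.pic_ends he
    rcases hfg with ⟨rfl, rfl⟩ | ⟨rfl, rfl⟩
    · exact this.2
    · exact this.1

lemma Bar.pic_hor {n a b : ℤ} {ρ : Config} (B : Bar n ρ a b) (x y : ℤ)
    (h : pic n ρ a b ((x, y), true) = true) : 0 ≤ y ∧ y ≤ n := B.KK_y (B.pic_ends h).1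

lemma Bar.pic_left {n a b : ℤ} {ρ : Config} (B : Bar n ρ a b) {e : Edge}
    (h : pic n ρ a b e = true) (he : e.1.1 < n) : ρ e = true := by
  rcases pic_true.1 h with h | h | rfl
  · exact (pi0_true.1 h).1
  · exfalso
    have := pi0_ends h
    rcases aut_refl (2 * n + 1) e with ⟨h1, h2⟩ | ⟨h1, h2⟩
    · rw [← h1, ← h2] at this
      have := (B.K_rect this.1).2.1
      simp only [vrefl_apply] at this
      omega
    · rw [← h1, ← h2] at this
      have := (B.K_rect this.2).2.1
      simp only [vrefl_apply] at this
      omega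
  · simp at he

lemma Bar.vc {n a b : ℤ} {ρ : Config} (B : Bar n ρ a b) {ω : Config}
    (h : VC 0 (2 * n + 1) 0 (2 * n + 1) ω) :
    BK n ρ a ω ∨ BK n ρ a (fun e => ω (erefl (2 * n + 1) e)) := by
  obtain ⟨p, q, hp, hq, hc⟩ := h
  have hn := B.n1
  have hz := meet (ω := pic n ρ a b) (η := res (inV (rect 0 (2 * n + 1) 0 (2 * n + 1))) ω)
    (u := (0, a)) (v := (2 * n + 1, a)) (p := (p, 0)) (q := (q, 2 * n + 1)) (y0 := 0) (y1 := n)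
    B.pic_hor B.pic_conn B.ha B.ha (fun z hz => by
      have := hz.inV_end hp
      exact ⟨this.1, this.2.1⟩) le_rfl (by show n ≤ 2 * n + 1; omega) hc
  obtain ⟨z, hz1, hz2⟩ := hz
  have hzK := B.pic_KK hz1
  have hqz : Conn (res (inV (rect 0 (2 * n + 1) 0 (2 * n + 1))) ω) (q, 2 * n + 1) z :=
    hc.symm.trans hz2
  have hqK : ¬ KK n ρ a (q, 2 * n + 1) := fun hk => by
    have := (B.KK_y hk).2
    simp only at this
    omega
  rcases Conn.exit (P := QQ n ρ a) ⟨hq, hqK⟩ hqz with h1 | ⟨c, d, h1, h2, h3, h4, -⟩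
  · exact absurd hzK (h1.inV_end (P := QQ n ρ a) ⟨hq, hqK⟩).2
  · have h3' := openAdj_inV.1 h3
    have hd : KK n ρ a d := by
      by_contra hd
      exact h4 ⟨h3'.2.2, hd⟩
    have h1' : Conn (res (inV (QQ n ρ a)) ω) (q, 2 * n + 1) c :=
      h1.mono fun e he => by simp only [res_true] at *; tauto
    rcases hd with hd | hd
    · left
      exact ⟨_, c, d, rfl, hq, h1', h3, hd⟩
    · right
      set σ := vrefl (2 * n + 1) with hσ
      have hσσ : ∀ v, σ (σ v) = v := fun v => by simp [hσ]
      have hr : ∀ v, rect 0 (2 * n + 1) 0 (2 * n + 1) v ↔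
          rect 0 (2 * n + 1) 0 (2 * n + 1) (σ v) := fun v => by
        simp only [rect, hσ, vrefl_apply]; omega
      have hQ : ∀ v, QQ n ρ a v ↔ QQ n ρ a (σ v) := fun v => by
        simp only [QQ, hσ, KK_mirror]; rw [← hσ, ← hr]
      refine ⟨σ (q, 2 * n + 1), σ c, σ d, rfl, (hr _).1 hq, ?_, ?_, hd⟩
      · rw [(aut_refl (2 * n + 1)).conn_inV hQ, hσσ, hσσ]
        exact h1'
      · rw [openAdj_inV]
        refine ⟨?_, (hr _).1 h3'.2.1, (hr _).1 h3'.2.2⟩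
        obtain ⟨e, he, hfg⟩ := openAdj_iff.1 h3'.1
        refine openAdj_iff.2 ⟨(erefl (2 * n + 1)).symm e, by simpa using he, ?_⟩
        have := (aut_refl (2 * n + 1)).symm e
        have hs : ∀ v, (vrefl (2 * n + 1)).symm v = σ v := fun v => rfl
        rw [hs, hs] at this
        rcases hfg with ⟨rfl, rfl⟩ | ⟨rfl, rfl⟩ <;> rcases this with ⟨h1, h2⟩ | ⟨h1, h2⟩ <;>
          simp [h1, h2]

/-- the four faces around a vertex -/
def face (z f : Vertex) : Prop := (f.1 = z.1 ∨ f.1 = z.1 - 1) ∧ (f.2 = z.2 ∨ f.2 = z.2 - 1)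

lemma Bar.avoid {n : ℕ} {a b : ℤ} {ω ω' : Config}
    (B : Bar n (res (Jset n n ω) ω) a b)
    (h : BK n (res (Jset n n ω) ω) a ω')
    (hω : ∀ e, ¬ Jset n n ω e → ω' e = true → ω e = true) :
    ∃ t : ℤ, rect 0 (2 * n + 1) 0 (2 * n + 1) (t, 2 * n + 1) ∧
      Conn (res (inV (rect 0 (2 * n + 1) 0 (2 * n + 1))) ω) (0, a) (t, 2 * n + 1) := by
  set ρ := res (Jset n n ω) ω with hρ
  have hn := B.n1
  obtain ⟨φ, p1, p2, p3, p4⟩ := pot B.pic_hor B.pic_conn B.ha B.ha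
  have D0 : ∀ f, Dset n n ω f → φ f.1 f.2 = 0 := by
    rintro f ⟨x0, -, -, hc⟩
    rw [← dual_const φ ?_ ?_ hc]
    · exact p3 _ _ (by norm_num)
    · intro x y hxy
      obtain ⟨hcl, hS⟩ := dual_step hxy
      rw [dtau_true] at hcl hS
      rw [SE_false] at hS
      rw [p2 (x + 1) y, add_sub_cancel_right]
      by_contra hcon
      rw [Bool.not_eq_false] at hcon
      have := (res_true.1 (B.pic_left hcon hS.2.1)).1
      rw [hcl] at this
      exact absurd this (by simp)
    · intro x y hxy
      obtain ⟨hcl, hS⟩ := dual_step hxy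
      rw [dtau_false] at hcl hS
      rw [SE_true] at hS
      rw [p1 x (y + 1) ?_ (by simp only; omega) (by simp only; omega), add_sub_cancel_right]
      by_contra hcon
      rw [Bool.not_eq_false] at hcon
      have := (res_true.1 (B.pic_left hcon hS.2.1)).1
      rw [hcl] at this
      exact absurd this (by simp)
  have four : ∀ z, QQ n ρ a z → ∀ f g, face z f → face z g → φ f.1 f.2 = φ g.1 g.2 := by
    rintro ⟨x, y⟩ ⟨hr, hK⟩
    have cl : ∀ e : Edge, (e.1 = (x, y) ∨ tl e = (x, y)) → pic n ρ a b e = false := by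
      intro e he
      by_contra hcon
      rw [Bool.not_eq_false] at hcon
      have := B.pic_ends hcon
      rcases he with he | he <;> rw [he] at this <;> tauto
    have c1 := p2 x y (cl _ (Or.inl rfl))
    have c2 := p2 x (y - 1) (cl _ (Or.inr (by simp)))
    have c3 : φ x y = φ x (y - 1) ∨ φ (x - 1) y = φ (x - 1) (y - 1) := by
      simp only [rect] at hr
      by_cases hx : x = 0
      · left
        exact p1 x y (cl _ (Or.inl rfl)) (by simp only; omega) (by simp only; omega)
      · right
        exact p1 (x - 1) y (cl _ (Or.inr (by simp))) (by simp only; omega) (by simp only; omega)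
    rintro ⟨f1, f2⟩ ⟨g1, g2⟩ ⟨hf1, hf2⟩ ⟨hg1, hg2⟩
    simp only at hf1 hf2 hg1 hg2 ⊢
    rcases hf1 with rfl | rfl <;> rcases hf2 with rfl | rfl <;> rcases hg1 with rfl | rfl <;>
      rcases hg2 with rfl | rfl <;> rcases c3 with c3 | c3 <;> linarith
  have nJ : ∀ e : Edge, ∀ z, QQ n ρ a z → (∀ f, face z f → φ f.1 f.2 = 1) →
      (e.1 = z ∨ tl e = z) → ¬ Jset n n ω e := by
    rintro ⟨⟨x, y⟩, _ | _⟩ z - hz he ⟨hS, hD⟩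
    · simp only [Bool.false_eq_true, if_false] at hD
      simp only [tl_false] at he
      rcases hD with hD | hD
      · have h1 := D0 _ hD
        have h2 := hz (x, y) (by rcases he with rfl | rfl <;> simp [face])
        linarith
      · have h1 := D0 _ hD
        have h2 := hz (x - 1, y) (by rcases he with rfl | rfl <;> simp [face])
        linarith
    · simp only [if_true] at hD
      simp only [tl_true] at he
      rcases hD with hD | hD
      · have h1 := D0 _ hD
        have h2 := hz (x, y) (by rcases he with rfl | rfl <;> simp [face])
        linarith
      · have h1 := D0 _ hD
        have h2 := hz (x, y - 1) (by rcases he with rfl | rfl <;> simp [face])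
        linarith
  obtain ⟨⟨t, t2⟩, z, k, rfl, htr, htz, hzk, hk⟩ := h
  have htK : ¬ KK n ρ a (t, 2 * n + 1) := fun hk => by
    have := (B.KK_y hk).2
    simp only at this
    omega
  have htQ : QQ n ρ a (t, 2 * n + 1) := ⟨htr, htK⟩
  have shared : ∀ u v, OpenAdj ω' u v → ∃ f, face u f ∧ face v f := by
    intro u v huv
    rcases openAdj_coord huv with ⟨h1, h2⟩ | ⟨h1, h2⟩ | ⟨h1, h2⟩ | ⟨h1, h2⟩
    · exact ⟨u, by simp [face], by simp [face, h1, h2]⟩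
    · exact ⟨v, by simp [face, h1, h2], by simp [face]⟩
    · exact ⟨u, by simp [face], by simp [face, h1, h2]⟩
    · exact ⟨v, by simp [face, h1, h2], by simp [face]⟩
  have main : ∀ w, Conn (res (inV (QQ n ρ a)) ω') (t, 2 * n + 1) w →
      QQ n ρ a w ∧ (∀ f, face w f → φ f.1 f.2 = 1) ∧
        Conn (res (inV (rect 0 (2 * n + 1) 0 (2 * n + 1))) ω) (t, 2 * n + 1) w := by
    intro w hw
    induction hw with
    | refl =>
      refine ⟨htQ, fun f hf => ?_, Conn.refl _⟩
      rw [four _ htQ f (t, 2 * n + 1) hf (by simp [face])]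
      exact p4 _ _ (by simp only; omega)
    | @tail u v hu huv ih =>
      obtain ⟨huv', hQu, hQv⟩ := openAdj_inV.1 huv
      obtain ⟨f0, hf0, hf0'⟩ := shared u v huv'
      refine ⟨hQv, fun f hf => ?_, ih.2.2.tail ?_⟩
      · rw [four _ hQv f f0 hf hf0']
        exact ih.2.1 f0 hf0
      · rw [openAdj_inV]
        refine ⟨?_, hQu.1, hQv.1⟩
        obtain ⟨e, he, hfg⟩ := openAdj_iff.1 huv'
        exact openAdj_iff.2 ⟨e, hω e (nJ e u hQu ih.2.1 (by
          rcases hfg with ⟨h1, h2⟩ | ⟨h1, h2⟩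
          · left; exact h1.symm
          · right; exact h2.symm)) he, hfg⟩
  obtain ⟨hQz, hz1, hz2⟩ := main z htz
  obtain ⟨hzk', hrz, hrk⟩ := openAdj_inV.1 hzk
  refine ⟨t, htr, ?_⟩
  have h1 : Conn (res (inV (rect 0 (2 * n + 1) 0 (2 * n + 1))) ω) (0, a) k := by
    refine hk.mono fun e he => ?_
    have := B.ins e he
    rw [res_true] at he ⊢
    refine ⟨he.1, ?_⟩
    simp only [inV, rect] at this ⊢
    omega
  refine h1.trans (Conn.symm (hz2.tail ?_))
  rw [openAdj_inV]
  refine ⟨?_, hrz, hrk⟩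
  obtain ⟨e, he, hfg⟩ := openAdj_iff.1 hzk'
  exact openAdj_iff.2 ⟨e, hω e (nJ e z hQz hz1 (by
    rcases hfg with ⟨h1, h2⟩ | ⟨h1, h2⟩
    · left; exact h1.symm
    · right; exact h2.symm)) he, hfg⟩

end DynPerc
end

section
open scoped BigOperators
namespace DynPerc
open Classical

lemma Pr_Ex {A : Config → Prop} {E : Finset Edge} (h : Dep A E) :
    Pr A = Ex E (fun F => if A (cfg F) then 1 else 0) := by
  rw [Pr_eq h, probOn_eq_sum]; rfl

def good (n : ℕ) (ω : Config) : Prop := ∀ x, ¬ Dset n n ω (x, (n : ℤ))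

lemma good_of_HC {n : ℕ} {ω : Config} (h : HC 0 n 0 n ω) : good n ω := by
  rintro x ⟨x0, h1, h2, h3⟩
  obtain ⟨a, b, ha, hb, hc⟩ := h
  refine block (ω := res (inV (rect 0 n 0 n)) ω) (y0 := 0) (y1 := n) ?_ hc ha.2.2 hb.2.2 ?_ ?_
    ?_ ?_ h3
  · intro x y hxy
    exact (res_true.1 hxy).2.1.2.2
  · intro e he
    rw [res_false]
    rw [(dual_step he).1]
    simp
  · intro x y hxy
    have := (dual_step hxy).2
    rw [dtau_false, SE_true] at this
    exact ⟨this.1, this.2.1⟩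
  · norm_num
  · exact le_rfl

lemma good_dep (n : ℕ) : Dep (good n) {e | SE n n e} := by
  intro ω ω' h
  have : ∀ f, Dset n n ω f ↔ Dset n n ω' f :=
    fun f => Dset_stop (fun e he => ((h e he.1).symm)) f
  simp only [good, this]

lemma SE_big {n : ℕ} {e : Edge} (h : SE n n e) : e ∈ bigE (4 * n + 4) := by
  have := SE_inV h
  rw [mem_bigE]
  simp only [inV, rect] at this
  omega

lemma RR_big {n : ℕ} {e : Edge} (h : inV (rect 0 (2 * n + 1) 0 (2 * n + 1)) e) :
    e ∈ bigE (4 * n + 4) := by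
  rw [mem_bigE]
  simp only [inV, rect] at h
  omega

lemma good_half (n : ℕ) : 1 / 2 ≤ Pr (good n) := by
  have h1 : Pr (HC 0 n 0 n) ≤ Pr (good n) :=
    Pr_mono (HC_loc _ _ _ _) (loc_of_bdd (good_dep n) _ fun e he => SE_big he)
      fun ω hω => good_of_HC hω
  rw [Pr_HC] at h1
  have h2 := hp_half n
  have h3 : hp (n + 1) n ≤ hp (n - 0) (n - 0) := hp_mono (by omega) (by omega) (by omega)
  linarith

noncomputable def aof (n : ℕ) (ρ : Config) : ℤ :=
  Classical.epsilon (fun a : ℤ => 0 ≤ a ∧ a ≤ n ∧ ∃ b : ℤ, Conn ρ (0, a) ((n : ℤ), b))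

lemma BK_dep (n : ℤ) (ρ : Config) (a : ℤ) :
    Dep (BK n ρ a) {e | inV (rect 0 (2 * n + 1) 0 (2 * n + 1)) e} := by
  have : BK n ρ a = fun ω => BK n ρ a (res (inV (rect 0 (2 * n + 1) 0 (2 * n + 1))) ω) := by
    funext ω
    have e1 : res (inV (rect 0 (2 * n + 1) 0 (2 * n + 1)))
        (res (inV (rect 0 (2 * n + 1) 0 (2 * n + 1))) ω) =
        res (inV (rect 0 (2 * n + 1) 0 (2 * n + 1))) ω := by
      funext e; simp [res]
    have e2 : res (inV (QQ n ρ a)) (res (inV (rect 0 (2 * n + 1) 0 (2 * n + 1))) ω) =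
        res (inV (QQ n ρ a)) ω := by
      funext e
      rw [Bool.eq_iff_iff]
      simp only [res_true, inV, QQ]
      tauto
    simp only [BK, e1, e2]
  rw [this]
  exact Dep_res _ _

lemma good_bar {n : ℕ} (hn : 1 ≤ n) {ω : Config} (hg : good n ω) :
    ∃ b, Bar n (res (Jset n n ω) ω) (aof n (res (Jset n n ω) ω)) b := by
  obtain ⟨a, b, h1, h2, -, -, h5⟩ := cross_exists hn hg
  obtain ⟨h6, h7, b', h8⟩ := Classical.epsilon_spec
    (p := fun a : ℤ => 0 ≤ a ∧ a ≤ n ∧ ∃ b : ℤ, Conn (res (Jset n n ω) ω) (0, a) ((n : ℤ), b))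
    ⟨a, h1, h2, b, h5⟩
  exact ⟨b', by omega, fun e he => SE_inV (res_true.1 he).2.1, ⟨h6, h7⟩, h8⟩

lemma Bar.prob {n : ℕ} {a b : ℤ} {ρ : Config} (B : Bar n ρ a b) : 1 / 4 ≤ Pr (BK n ρ a) := by
  have hl : Loc (BK n ρ a) := loc_of_bdd (BK_dep n ρ a) _ fun e he => RR_big he
  have h1 := Pr_mono (VC_loc _ _ _ _) (hl.or (Loc_map (erefl (2 * n + 1)) hl)) fun ω hω => B.vc hω
  have h2 := Pr_or_le hl (Loc_map (erefl (2 * n + 1)) hl)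
  rw [Pr_map _ hl] at h2
  rw [Pr_VC] at h1
  have h3 := hp_half (2 * n + 1)
  have h4 : hp ((2 * n + 1 : ℕ) + 1) (2 * n + 1 : ℕ) ≤ hp (2 * n + 1 - 0) (2 * n + 1 - 0) :=
    hp_mono (by omega) (by omega) (by omega)
  linarith

def XR (n : ℤ) (ω : Config) : Prop :=
  ∃ a b t : ℤ, rect 0 n 0 n (0, a) ∧ rect 0 n 0 n (n, b) ∧
    rect 0 (2 * n + 1) 0 (2 * n + 1) (t, 2 * n + 1) ∧
    Conn (res (inV (rect 0 n 0 n)) ω) (0, a) (n, b) ∧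
    Conn (res (inV (rect 0 (2 * n + 1) 0 (2 * n + 1))) ω) (0, a) (t, 2 * n + 1)

lemma XR_inc (n : ℤ) : Inc (XR n) := by
  rintro ω ω' h ⟨a, b, t, h1, h2, h3, h4, h5⟩
  exact ⟨a, b, t, h1, h2, h3, Inc_conn_res _ _ _ ω ω' h h4, Inc_conn_res _ _ _ ω ω' h h5⟩

lemma XR_dep {n : ℤ} :
    Dep (XR n) {e | inV (rect 0 (2 * n + 1) 0 (2 * n + 1)) e} := by
  intro ω ω' h
  have e1 : res (inV (rect 0 (2 * n + 1) 0 (2 * n + 1))) ω =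
      res (inV (rect 0 (2 * n + 1) 0 (2 * n + 1))) ω' := by
    funext e
    rw [Bool.eq_iff_iff, res_true, res_true]
    constructor <;> rintro ⟨h1, h2⟩ <;> have := h e h2 <;> simp_all
  have e2 : res (inV (rect 0 n 0 n)) ω = res (inV (rect 0 n 0 n)) ω' := by
    funext e
    rw [Bool.eq_iff_iff, res_true, res_true]
    constructor <;> rintro ⟨h1, h2⟩ <;>
      have := h e (by simp only [inV, rect, Set.mem_ofPred_eq] at *; omega) <;> simp_all
  simp only [XR, e1, e2]

lemma XR_prob {n : ℕ} (hn : 1 ≤ n) : 1 / 8 ≤ Pr (XR n) := by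
  set E := bigE (4 * n + 4) with hE
  set J : Finset Edge → Finset Edge := fun x => E.filter (Jset n n (cfg x)) with hJ
  have hmem : ∀ x e, e ∈ J x ↔ Jset n n (cfg x) e := by
    intro x e
    simp only [hJ, Finset.mem_filter, and_iff_right_iff_imp]
    exact fun h => SE_big h.1
  have agree : ∀ x x' : Finset Edge, x' ∩ J x = x ∩ J x →
      ∀ e, Jset n n (cfg x) e → cfg x' e = cfg x e := by
    intro x x' h e he
    rw [← hmem] at he
    have : e ∈ x' ↔ e ∈ x := by
      have := Finset.ext_iff.1 h e
      simp only [Finset.mem_inter, he, and_true] at this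
      exact this
    rw [Bool.eq_iff_iff, cfg_eq_true, cfg_eq_true, this]
  have hstp : IsStop E J := by
    intro x _ x' _ h
    ext e
    rw [hmem, hmem, Jset_stop (agree x x' h)]
  set ρ : Finset Edge → Config := fun x => res (Jset n n (cfg x)) (cfg x) with hρ
  have hρeq : ∀ x x' : Finset Edge, x' ∩ J x = x ∩ J x → ρ x' = ρ x := by
    intro x x' h
    have h1 := agree x x' h
    simp only [hρ, Jset_stop h1]
    funext e
    rw [Bool.eq_iff_iff, res_true, res_true]
    constructor <;> rintro ⟨h2, h3⟩ <;> have := h1 e h3 <;> simp_all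
  set Φ : Finset Edge → Finset Edge → ℝ := fun x x' =>
    if good n (cfg x) ∧ BK n (ρ x) (aof n (ρ x)) (cfg x') then 1 else 0 with hΦ
  have low : 1 / 8 ≤ Ex E (fun x => Ex E (fun x' => Φ x x')) := by
    have h1 : ∀ x ∈ E.powerset, 1 / 4 * (if good n (cfg x) then (1 : ℝ) else 0) ≤
        Ex E (fun x' => Φ x x') := by
      intro x _
      by_cases hg : good n (cfg x)
      · obtain ⟨b, B⟩ := good_bar hn hg
        have h2 := B.prob
        rw [Pr_Ex (E := E) ((BK_dep _ _ _).mono fun e he => RR_big he)] at h2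
        simpa [hΦ, hg] using h2
      · simp [hΦ, hg, Ex_const]
    have h2 := Ex_mono (fun x hx => h1 x (Finset.mem_powerset.2 hx))
    refine le_trans ?_ h2
    rw [Ex_mul, ← Pr_Ex (E := E) ((good_dep n).mono fun e he => SE_big he)]
    have := good_half n
    linarith
  rw [Ex_swap hstp] at low
  refine low.trans ?_
  rw [Pr_Ex (E := E) ((XR_dep).mono fun e he => RR_big he)]
  refine Ex_mono fun x hx => ?_
  have : ∀ x' ⊆ E, Φ (mix (J x) x x') (mix (J x) x' x) ≤ if XR n (cfg x) then 1 else 0 := by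
    intro x' _
    have h1 := mix_inter (J x) x x'
    have h2 := hρeq _ _ h1
    simp only [hΦ, h2]
    by_cases hh : good n (cfg (mix (J x) x x')) ∧ BK n (ρ x) (aof n (ρ x)) (cfg (mix (J x) x' x))
    · rw [if_pos hh, if_pos]
      obtain ⟨hg, hB⟩ := hh
      have hg' : good n (cfg x) := by
        intro y hy
        exact hg y ((Dset_stop (agree _ _ h1) _).1 hy)
      obtain ⟨b, B⟩ := good_bar hn hg'
      obtain ⟨t, ht, hc⟩ := B.avoid hB (by
        intro e he ho
        rw [← hmem] at he
        rw [cfg_eq_true] at *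
        simp only [mix, Finset.mem_union, Finset.mem_inter, Finset.mem_sdiff] at ho
        tauto)
      have ha : 0 ≤ aof n (ρ x) ∧ aof n (ρ x) ≤ n := B.ha
      have hcr : Conn (res (inV (rect 0 n 0 n)) (cfg x)) (0, aof n (ρ x)) (n, b) :=
        B.conn.mono fun e he => res_true.2 ⟨(res_true.1 he).1, B.ins e he⟩
      have hra : rect 0 n 0 n (0, aof n (ρ x)) := by simp only [rect]; omega
      exact ⟨aof n (ρ x), b, t, hra, hcr.inV_end hra, ht, hcr, hc⟩
    · rw [if_neg hh]
      split_ifs <;> norm_num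
  calc Ex E (fun x' => Φ (mix (J x) x x') (mix (J x) x' x))
      ≤ Ex E (fun _ => if XR n (cfg x) then 1 else 0) := Ex_mono this
    _ = _ := Ex_const _

end DynPerc
end

section
open scoped BigOperators
namespace DynPerc
open Classical

lemma Conn.rect_mono {x0 x1 y0 y1 x0' x1' y0' y1' : ℤ} {ω : Config} {u v : Vertex}
    (h : Conn (res (inV (rect x0 x1 y0 y1)) ω) u v) (h1 : x0' ≤ x0) (h2 : x1 ≤ x1')
    (h3 : y0' ≤ y0) (h4 : y1 ≤ y1') : Conn (res (inV (rect x0' x1' y0' y1')) ω) u v :=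
  h.res_mono fun e he => by simp only [inV, rect] at *; omega

lemma rect_hor {x0 x1 y0 y1 : ℤ} {ω : Config} (x y : ℤ)
    (h : res (inV (rect x0 x1 y0 y1)) ω ((x, y), true) = true) : y0 ≤ y ∧ y ≤ y1 :=
  (res_true.1 h).2.1.2.2

/-- an LR path of one rectangle and a BT path of a narrower one meet -/
lemma HV_meet {x0 x1 y0 y1 x2 x3 y2 y3 : ℤ} {ω ω' : Config} {u v p q : Vertex}
    (hu : rect x0 x1 y0 y1 u) (hv : rect x0 x1 y0 y1 v) (hux : u.1 = x0) (hvx : v.1 = x1)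
    (h : Conn (res (inV (rect x0 x1 y0 y1)) ω) u v)
    (hp : rect x2 x3 y2 y3 p) (hpx : p.2 = y2) (hqx : q.2 = y3)
    (h' : Conn (res (inV (rect x2 x3 y2 y3)) ω') p q)
    (h02 : x0 ≤ x2) (h31 : x3 ≤ x1) (h20 : y2 ≤ y0) (h13 : y1 ≤ y3) :
    ∃ z, Conn (res (inV (rect x0 x1 y0 y1)) ω) u z ∧ Conn (res (inV (rect x2 x3 y2 y3)) ω') p z :=
  meet rect_hor h hu.2.2 hv.2.2 (fun z hz => by
    have := hz.inV_end hp
    simp only [rect] at this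
    omega) (by omega) (by omega) h'

lemma HC_glue {x0 x1 x2 x3 y0 y1 : ℤ} {ω : Config} (h1 : HC x0 x1 y0 y1 ω)
    (h2 : HC x2 x3 y0 y1 ω) (h3 : VC x2 x1 y0 y1 ω) (h02 : x0 ≤ x2) (h13 : x1 ≤ x3) :
    HC x0 x3 y0 y1 ω := by
  obtain ⟨a, b, ha, hb, hc⟩ := h1
  obtain ⟨a', b', ha', hb', hc'⟩ := h2
  obtain ⟨p, q, hp, hq, hv⟩ := h3
  obtain ⟨z, z1, z2⟩ := HV_meet ha hb rfl rfl hc hp rfl rfl hv h02 le_rfl le_rfl le_rfl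
  obtain ⟨w, w1, w2⟩ := HV_meet ha' hb' rfl rfl hc' hp rfl rfl hv le_rfl h13 le_rfl le_rfl
  simp only [rect] at ha hb ha' hb' hp hq
  have z1 := z1.rect_mono le_rfl h13 le_rfl le_rfl
  have z2 := z2.rect_mono h02 h13 le_rfl le_rfl
  have w2 := w2.rect_mono h02 h13 le_rfl le_rfl
  have w1 := w1.rect_mono h02 le_rfl le_rfl le_rfl
  have hc' := hc'.rect_mono h02 le_rfl le_rfl le_rfl
  refine ⟨a, b', ?_, ?_, ((z1.trans z2.symm).trans w2).trans (w1.symm.trans hc')⟩ <;>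
    simp only [rect] <;> omega

lemma XR_glue {n : ℤ} (hn : 0 ≤ n) {ω : Config} (h1 : XR n ω) (h2 : XR n (fun e => ω (erefY n e)))
    (h3 : VC 0 n 0 n ω) : VC 0 (2 * n + 1) (-(n + 1)) (2 * n + 1) ω := by
  obtain ⟨a, b, t, r1, r2, r3, c1, c2⟩ := h1
  obtain ⟨a', b', t', s1, s2, s3, d1, d2⟩ := h2
  obtain ⟨p, q, hp, hq, hv⟩ := h3
  have g1 : ∀ v, rect 0 n 0 n v ↔ rect 0 n 0 n (vrefY n v) := fun v => by
    simp only [rect, vrefY_apply]; omega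
  have g2 : ∀ v, rect 0 (2 * n + 1) 0 (2 * n + 1) v ↔
      rect 0 (2 * n + 1) (-(n + 1)) n (vrefY n v) := fun v => by
    simp only [rect, vrefY_apply]; omega
  rw [(aut_refY n).conn_inV g1] at d1
  rw [(aut_refY n).conn_inV g2] at d2
  rw [g1] at s1 s2
  rw [g2] at s3
  obtain ⟨z, z1, z2⟩ := HV_meet r1 r2 rfl rfl c1 hp rfl rfl hv le_rfl le_rfl le_rfl le_rfl
  obtain ⟨w, w1, w2⟩ := HV_meet s1 s2 rfl rfl d1 hp rfl rfl hv le_rfl le_rfl le_rfl le_rfl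
  have big : ∀ u v, Conn (res (inV (rect 0 n 0 n)) ω) u v →
      Conn (res (inV (rect 0 (2 * n + 1) (-(n + 1)) (2 * n + 1))) ω) u v := fun u v h =>
    h.rect_mono (by omega) (by omega) (by omega) (by omega)
  have c2 := c2.rect_mono (x0' := 0) (x1' := 2 * n + 1) (y0' := -(n + 1)) (y1' := 2 * n + 1)
    (by omega) (by omega) (by omega) (by omega)
  have d2 := d2.rect_mono (x0' := 0) (x1' := 2 * n + 1) (y0' := -(n + 1)) (y1' := 2 * n + 1)
    (by omega) (by omega) (by omega) (by omega)
  have e1 : vrefY n (t', 2 * n + 1) = (t', -(n + 1)) := by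
    simp only [vrefY_apply, Prod.mk.injEq, true_and]; ring
  rw [e1] at d2 s3
  refine ⟨t', t, ?_, ?_, (d2.symm.trans ((big _ _ w1).trans (big _ _ w2).symm)).trans
    (((big _ _ z2).trans (big _ _ z1).symm).trans c2)⟩
  · simp only [rect] at *; omega
  · simp only [rect] at *; omega

lemma XR_loc (n : ℕ) : Loc (XR n) := loc_of_bdd XR_dep _ fun _ he => RR_big he

lemma Inc_map {A : Config → Prop} (τ : Edge ≃ Edge) (h : Inc A) :
    Inc (fun ω => A (fun e => ω (τ e))) := fun ω ω' hw => h _ _ fun e he => hw _ he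

lemma Pr_fkg3 {A B C : Config → Prop} (hA : Loc A) (hB : Loc B) (hC : Loc C)
    (iA : Inc A) (iB : Inc B) (iC : Inc C) {a b c : ℝ} (b0 : 0 ≤ b) (c0 : 0 ≤ c)
    (ha : a ≤ Pr A) (hb : b ≤ Pr B) (hc : c ≤ Pr C) :
    a * (b * c) ≤ Pr (fun ω => A ω ∧ B ω ∧ C ω) := by
  have h1 := Pr_fkg hB hC iB iC
  have h2 := Pr_fkg hA (hB.and hC) iA (iB.and iC)
  have h3 : b * c ≤ Pr B * Pr C := mul_le_mul hb hc c0 (Pr_nonneg _)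
  have h4 : a * (b * c) ≤ Pr A * Pr (fun ω => B ω ∧ C ω) :=
    mul_le_mul ha (h3.trans h1) (mul_nonneg b0 c0) (Pr_nonneg _)
  exact h4.trans h2

lemma hp_sq (n : ℕ) : 1 / 2 ≤ hp n n :=
  (hp_half n).trans (hp_mono (by omega) (by omega) le_rfl)

lemma hp_long {n : ℕ} (hn : 1 ≤ n) : 1 / 128 ≤ hp (3 * n + 2) (2 * n + 1) := by
  have h1 := XR_prob hn
  have h2 := XR_prob hn
  rw [← Pr_map (erefY n) (XR_loc n)] at h2
  have h3 : 1 / 2 ≤ Pr (VC 0 n 0 n) := by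
    rw [Pr_VC, sub_zero]; exact hp_sq n
  have h4 := Pr_fkg3 (XR_loc n) (Loc_map (erefY n) (XR_loc n)) (VC_loc 0 n 0 n) (XR_inc n)
    (Inc_map _ (XR_inc n)) (VC_inc 0 n 0 n) (by norm_num) (by norm_num) h1 h2 h3
  have h5 := Pr_mono ((XR_loc n).and ((Loc_map (erefY n) (XR_loc n)).and (VC_loc 0 n 0 n)))
    (VC_loc 0 (2 * n + 1) (-(n + 1)) (2 * n + 1))
    (fun ω hω => XR_glue (by omega) hω.1 hω.2.1 hω.2.2)
  rw [Pr_VC] at h5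
  have e1 : (2 * n + 1 - -(n + 1) : ℤ) = 3 * n + 2 := by ring
  rw [e1, sub_zero] at h5
  linarith

lemma hp_ext {n : ℕ} (hn : 1 ≤ n) {L : ℤ} (hL : 2 * n + 1 ≤ L) {c : ℝ} (hc : c ≤ hp L (2 * n + 1)) :
    c * (1 / 256) ≤ hp (L + (n + 1)) (2 * n + 1) := by
  have h1 : c ≤ Pr (HC 0 L 0 (2 * n + 1)) := hc
  have h2 : 1 / 128 ≤ Pr (HC (L - (2 * n + 1)) (L + (n + 1)) 0 (2 * n + 1)) := by
    rw [Pr_HC]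
    have e1 : L + (n + 1) - (L - (2 * n + 1)) = 3 * n + 2 := by ring
    rw [e1, sub_zero]
    exact hp_long hn
  have h3 : 1 / 2 ≤ Pr (VC (L - (2 * n + 1)) L 0 (2 * n + 1)) := by
    rw [Pr_VC]
    have e1 : L - (L - (2 * n + 1)) = 2 * n + 1 := by ring
    rw [e1, sub_zero]
    have := hp_sq (2 * n + 1)
    push_cast at this
    exact this
  have h4 := Pr_fkg3 (HC_loc _ _ _ _) (HC_loc _ _ _ _) (VC_loc _ _ _ _) (HC_inc _ _ _ _)
    (HC_inc _ _ _ _) (VC_inc _ _ _ _) (by norm_num) (by norm_num) h1 h2 h3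
  have h5 := Pr_mono ((HC_loc 0 L 0 (2 * n + 1)).and
    ((HC_loc (L - (2 * n + 1)) (L + (n + 1)) 0 (2 * n + 1)).and
      (VC_loc (L - (2 * n + 1)) L 0 (2 * n + 1))))
    (HC_loc 0 (L + (n + 1)) 0 (2 * n + 1))
    (fun ω hω => HC_glue hω.1 hω.2.1 hω.2.2 (by omega) (by omega))
  have : Pr (HC 0 (L + (n + 1)) 0 (2 * n + 1)) = hp (L + (n + 1)) (2 * n + 1) := rfl
  linarith

noncomputable def c0 : ℝ := 1 / 128 * (1 / 256) ^ 64

lemma c0_pos : 0 < c0 := by unfold c0; positivity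

lemma rsw {n : ℕ} (hn : 1 ≤ n) : c0 ≤ hp (64 * (n + 1)) (2 * n + 1) := by
  have : ∀ i : ℕ, 1 / 128 * (1 / 256 : ℝ) ^ i ≤ hp (3 * n + 2 + i * (n + 1)) (2 * n + 1) := by
    intro i
    induction i with
    | zero => simpa using hp_long hn
    | succ i ih =>
      have := hp_ext hn (by nlinarith) ih
      have e1 : (3 * n + 2 + (i + 1 : ℕ) * (n + 1) : ℤ) =
        3 * n + 2 + i * (n + 1) + (n + 1) := by push_cast; ring
      rw [e1, pow_succ, ← mul_assoc]
      exact this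
  refine (this 64).trans (hp_mono (by omega) (by push_cast; linarith) le_rfl)

/-- RSW in the form used below -/
lemma rsw' {m L h : ℤ} (hm : 4 ≤ m) (he : Even m) (hL0 : 0 ≤ L) (hL : L ≤ 32 * m)
    (hh : m - 1 ≤ h) : c0 ≤ hp L h := by
  obtain ⟨r, hr⟩ := he
  lift r to ℕ using by omega
  have := rsw (n := r - 1) (by omega)
  refine this.trans (hp_mono hL0 ?_ ?_) <;> omega

end DynPerc
end

section
open scoped BigOperators
namespace DynPerc
open Classical

def nm (v : Vertex) : ℤ := max |v.1| |v.2|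
def lo (e : Edge) : ℤ := min (nm e.1) (nm (tl e))
def ann (a b : ℤ) (e : Edge) : Prop := a ≤ lo e ∧ lo e < b

lemma nm_le {v : Vertex} {a : ℤ} : nm v ≤ a ↔ -a ≤ v.1 ∧ v.1 ≤ a ∧ -a ≤ v.2 ∧ v.2 ≤ a := by
  simp only [nm, max_le_iff, abs_le]; tauto

lemma le_nm {v : Vertex} {a : ℤ} :
    a ≤ nm v ↔ a ≤ v.1 ∨ v.1 ≤ -a ∨ a ≤ v.2 ∨ v.2 ≤ -a := by
  simp only [nm, le_max_iff, le_abs]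
  constructor
  · rintro ((h | h) | h | h) <;> omega
  · rintro (h | h | h | h) <;> omega

lemma nm_nonneg (v : Vertex) : 0 ≤ nm v := le_max_of_le_left (abs_nonneg _)
lemma lo_nonneg (e : Edge) : 0 ≤ lo e := le_min (nm_nonneg _) (nm_nonneg _)

lemma nm_tl (e : Edge) : nm (tl e) ≤ nm e.1 + 1 ∧ nm e.1 ≤ nm (tl e) + 1 := by
  have h1 := nm_le.1 (le_refl (nm e.1))
  have h2 := nm_le.1 (le_refl (nm (tl e)))
  obtain ⟨⟨x, y⟩, _ | _⟩ := e
  · simp only [tl_false] at *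
    constructor <;> rw [nm_le] <;> simp only <;> omega
  · simp only [tl_true] at *
    constructor <;> rw [nm_le] <;> simp only <;> omega

lemma ann_bdd {a b : ℤ} {e : Edge} (h : ann a b e) : e ∈ bigE b := by
  have h1 := nm_tl e
  have h2 := h.2
  have : nm e.1 ≤ b := by
    rw [lo, min_lt_iff] at h2
    omega
  rw [nm_le] at this
  rw [mem_bigE]
  omega

def Cross (a b : ℤ) (ω : Config) : Prop :=
  ∃ u v, nm u ≤ a ∧ b ≤ nm v ∧ Conn (res (ann a b) ω) u v

lemma Cross_dep (a b : ℤ) : Dep (Cross a b) {e | ann a b e} :=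
  Dep_res (ann a b) (fun ω => ∃ u v, nm u ≤ a ∧ b ≤ nm v ∧ Conn ω u v)

lemma Cross_loc (a b : ℤ) : Loc (Cross a b) := loc_of_bdd (Cross_dep a b) b fun _ he => ann_bdd he

lemma Cross_inc (a b : ℤ) : Inc (Cross a b) := by
  rintro ω ω' h ⟨u, v, h1, h2, h3⟩
  exact ⟨u, v, h1, h2, Inc_conn_res _ _ _ ω ω' h h3⟩

lemma cross_of_conn' {a b : ℤ} {ω : Config} {u v : Vertex} (hu : nm u ≤ a) (hv : b ≤ nm v)
    (h : Conn ω u v) :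
    ∃ u' v', nm u' ≤ a ∧ b ≤ nm v' ∧ Conn (res (ann a b) ω) u' v' ∧ Conn ω u u' := by
  by_contra hcon
  have : ∀ w, Conn ω u w → ∃ u', nm u' ≤ a ∧ Conn (res (ann a b) ω) u' w ∧ Conn ω u u' := by
    intro w hw
    induction hw with
    | refl => exact ⟨u, hu, Conn.refl _, Conn.refl _⟩
    | @tail w w' h1 h2 ih =>
      obtain ⟨u', i1, i2, i3⟩ := ih
      by_cases hw' : nm w' ≤ a
      · exact ⟨w', hw', Conn.refl _, Conn.tail h1 h2⟩
      · have hwb : nm w < b := by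
          by_contra hb
          exact hcon ⟨u', w, i1, by omega, i2, i3⟩
        refine ⟨u', i1, i2.tail ?_, i3⟩
        obtain ⟨e, he, hfg⟩ := openAdj_iff.1 h2
        refine openAdj_iff.2 ⟨e, res_true.2 ⟨he, ?_⟩, hfg⟩
        have := nm_tl e
        rw [ann, lo, le_min_iff, min_lt_iff]
        rcases hfg with ⟨rfl, rfl⟩ | ⟨rfl, rfl⟩ <;> omega
  obtain ⟨u', h1, h2, h3⟩ := this v h
  exact hcon ⟨u', v, h1, hv, h2, h3⟩

lemma cross_of_conn {a b : ℤ} {ω : Config} {u v : Vertex} (hu : nm u ≤ a) (hv : b ≤ nm v)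
    (h : Conn ω u v) : Cross a b ω := by
  obtain ⟨u', v', h1, h2, h3, -⟩ := cross_of_conn' hu hv h
  exact ⟨u', v', h1, h2, h3⟩

lemma Cross.sub {a b a' b' : ℤ} {ω : Config} (h : Cross a b ω) (ha : a ≤ a') (hb : b' ≤ b) :
    Cross a' b' ω := by
  obtain ⟨u, v, h1, h2, h3⟩ := h
  exact cross_of_conn (h1.trans ha) (hb.trans h2) h3.of_res

noncomputable def al (a b : ℤ) : ℝ := Pr (Cross a b)

lemma al_nonneg (a b : ℤ) : 0 ≤ al a b := Pr_nonneg _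
lemma al_le_one (a b : ℤ) : al a b ≤ 1 := Pr_le_one _

lemma al_mono {a b a' b' : ℤ} (ha : a ≤ a') (hb : b' ≤ b) : al a b ≤ al a' b' :=
  Pr_mono (Cross_loc _ _) (Cross_loc _ _) fun _ h => h.sub ha hb

lemma al_mul {a b c d : ℤ} (hab : a ≤ c) (hbc : b ≤ c) (hcd : b ≤ d) :
    al a d ≤ al a b * al c d := by
  have hdis : Disjoint ((bigE b).filter (ann a b)) ((bigE d).filter (ann c d)) := by
    rw [Finset.disjoint_left]
    intro e h1 h2
    simp only [Finset.mem_filter, ann] at h1 h2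
    omega
  have h1 : Dep (Cross a b) ↑((bigE b).filter (ann a b)) := (Cross_dep a b).mono fun e he => by
    have he : ann a b e := he
    simpa using ⟨ann_bdd he, he⟩
  have h2 : Dep (Cross c d) ↑((bigE d).filter (ann c d)) := (Cross_dep c d).mono fun e he => by
    have he : ann c d e := he
    simpa using ⟨ann_bdd he, he⟩
  rw [al, al, al, ← Pr_indep hdis h1 h2]
  exact Pr_mono (Cross_loc _ _) ((Cross_loc _ _).and (Cross_loc _ _))
    fun _ h => ⟨h.sub le_rfl hcd, h.sub hab le_rfl⟩

lemma Pr_incl {A B : Config → Prop} (hA : Loc A) (hB : Loc B) :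
    Pr (fun ω => A ω ∨ B ω) + Pr (fun ω => A ω ∧ B ω) = Pr A + Pr B := by
  obtain ⟨E, h1, h2⟩ := hA.common hB
  rw [Pr_eq (h1.or h2), Pr_eq (h1.and h2), Pr_eq h1, Pr_eq h2]
  simp only [probOn_eq_sum]
  rw [← add_div, ← add_div, ← Finset.sum_add_distrib, ← Finset.sum_add_distrib]
  congr 1
  refine Finset.sum_congr rfl fun F _ => ?_
  by_cases ha : A (cfg F) <;> by_cases hb : B (cfg F) <;> simp [ha, hb]

lemma Pr_or_fkg {A B : Config → Prop} (hA : Loc A) (hB : Loc B) (iA : Inc A) (iB : Inc B)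
    {a b : ℝ} (ha : Pr A ≤ 1 - a) (hb : Pr B ≤ 1 - b) (a0 : 0 ≤ a) :
    Pr (fun ω => A ω ∨ B ω) ≤ 1 - a * b := by
  have h1 := Pr_incl hA hB
  have h2 := Pr_fkg hA hB iA iB
  have h3 := Pr_le_one A
  have h4 := Pr_le_one B
  nlinarith [mul_nonneg (by linarith : 0 ≤ 1 - Pr A - a) (by linarith : 0 ≤ 1 - Pr B),
    mul_nonneg a0 (by linarith : 0 ≤ 1 - Pr B - b)]

lemma Inc.or {A B : Config → Prop} (h : Inc A) (h' : Inc B) : Inc (fun ω => A ω ∨ B ω) :=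
  fun ω ω' hw => Or.imp (h ω ω' hw) (h' ω ω' hw)

lemma hp_upper {m : ℤ} (hm : 4 ≤ m) (he : Even m) : hp m (4 * m) ≤ 1 - c0 := by
  have h1 : c0 ≤ Pr (fun ω => VC 0 (m - 1) (-1) (4 * m) (dualc ω)) := by
    rw [Pr_dual (VC_loc _ _ _ _), Pr_VC]
    exact rsw' hm he (by omega) (by omega) (by omega)
  have h2 : Pr (fun ω => VC 0 (m - 1) (-1) (4 * m) (dualc ω)) ≤
      Pr (fun ω => ¬ HC 0 m 0 (4 * m) ω) := by
    refine Pr_mono (Loc_dual (VC_loc _ _ _ _)) (HC_loc _ _ _ _).not ?_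
    rintro ω ⟨p, q, hp, hq, hv⟩ ⟨a, b, ha, hb, hc⟩
    refine block (y0 := 0) (y1 := 4 * m) rect_hor hc ha.2.2 hb.2.2 ?_ ?_ ?_ ?_ hv
    · intro e he
      rw [res_false, (dual_step he).1]
      simp
    · intro x y hxy
      have := (res_true.1 hxy).2.1
      simp only [rect] at this ⊢
      omega
    · norm_num
    · exact le_rfl
  rw [Pr_not (HC_loc _ _ _ _)] at h2
  have : Pr (HC 0 m 0 (4 * m)) = hp m (4 * m) := rfl
  linarith

lemma ann_in {a b : ℤ} {e : Edge} (h : ann a b e) : inV (fun z => nm z ≤ b) e := by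
  have := nm_tl e
  have h2 := h.2
  rw [lo, min_lt_iff] at h2
  simp only [inV]
  omega

lemma cross_sides {m : ℤ} (hm : 0 ≤ m) {ω : Config} (h : Cross m (2 * m) ω) :
    HC m (2 * m) (-(2 * m)) (2 * m) ω ∨ HC (-(2 * m)) (-m) (-(2 * m)) (2 * m) ω ∨
    VC (-(2 * m)) (2 * m) m (2 * m) ω ∨ VC (-(2 * m)) (2 * m) (-(2 * m)) (-m) ω := by
  obtain ⟨u, v, hu, hv, hc⟩ := h
  have hc := hc.res_mono fun e he => ann_in he
  have hPu : nm u ≤ 2 * m := by omega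
  have hPv : nm v ≤ 2 * m := hc.inV_end (P := fun z => nm z ≤ 2 * m) hPu
  have hP1 : ∀ z, nm z ≤ 2 * m → -(2 * m) ≤ z.2 ∧ z.2 ≤ 2 * m := fun z hz => by
    rw [nm_le] at hz; omega
  have hP2 : ∀ z, nm z ≤ 2 * m → -(2 * m) ≤ z.1 ∧ z.1 ≤ 2 * m := fun z hz => by
    rw [nm_le] at hz; omega
  rw [nm_le] at hu
  rw [le_nm] at hv
  rcases hv with hv | hv | hv | hv
  · left
    exact HC_of_conn (by omega) hP1 hPu hu.2.1 hv hc
  · right; left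
    exact HC_of_conn (by omega) hP1 hPv hv hu.1 hc.symm
  · right; right; left
    exact VC_of_conn (by omega) hP2 hPu hu.2.2.2 hv hc
  · right; right; right
    exact VC_of_conn (by omega) hP2 hPv hv hu.2.2.1 hc.symm

noncomputable def q0 : ℝ := 1 - c0 ^ 4

lemma c0_lt : c0 < 1 := by unfold c0; norm_num
lemma q0_pos : 0 < q0 := by
  have := pow_lt_one₀ c0_pos.le c0_lt (by norm_num : 4 ≠ 0)
  unfold q0; linarith
lemma q0_lt : q0 < 1 := by
  have := pow_pos c0_pos 4
  unfold q0; linarith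

lemma al_double {m : ℤ} (hm : 4 ≤ m) (he : Even m) : al m (2 * m) ≤ q0 := by
  have hu := hp_upper hm he
  have h1 : Pr (HC m (2 * m) (-(2 * m)) (2 * m)) ≤ 1 - c0 := by
    rw [Pr_HC]; convert hu using 2 <;> ring
  have h2 : Pr (HC (-(2 * m)) (-m) (-(2 * m)) (2 * m)) ≤ 1 - c0 := by
    rw [Pr_HC]; convert hu using 2 <;> ring
  have h3 : Pr (VC (-(2 * m)) (2 * m) m (2 * m)) ≤ 1 - c0 := by
    rw [Pr_VC]; convert hu using 2 <;> ring
  have h4 : Pr (VC (-(2 * m)) (2 * m) (-(2 * m)) (-m)) ≤ 1 - c0 := by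
    rw [Pr_VC]; convert hu using 2 <;> ring
  have k3 := Pr_or_fkg (VC_loc _ _ _ _) (VC_loc _ _ _ _) (VC_inc _ _ _ _) (VC_inc _ _ _ _)
    h3 h4 c0_pos.le
  have k2 := Pr_or_fkg (HC_loc _ _ _ _) ((VC_loc _ _ _ _).or (VC_loc _ _ _ _)) (HC_inc _ _ _ _)
    ((VC_inc _ _ _ _).or (VC_inc _ _ _ _)) h2 k3 c0_pos.le
  have k1 := Pr_or_fkg (HC_loc _ _ _ _) ((HC_loc _ _ _ _).or
    ((VC_loc _ _ _ _).or (VC_loc _ _ _ _))) (HC_inc _ _ _ _)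
    ((HC_inc _ _ _ _).or ((VC_inc _ _ _ _).or (VC_inc _ _ _ _))) h1 k2 c0_pos.le
  have h5 : al m (2 * m) ≤ _ := Pr_mono (Cross_loc _ _) ((HC_loc m (2 * m) (-(2 * m)) (2 * m)).or
    ((HC_loc (-(2 * m)) (-m) (-(2 * m)) (2 * m)).or ((VC_loc (-(2 * m)) (2 * m) m (2 * m)).or
      (VC_loc (-(2 * m)) (2 * m) (-(2 * m)) (-m))))) fun ω h => cross_sides (by omega) h
  refine h5.trans (k1.trans (le_of_eq ?_))
  unfold q0; ring

lemma al_decay {a : ℕ} (ha : 2 ≤ a) (j : ℕ) : al (2 ^ a) (2 ^ (a + j)) ≤ q0 ^ j := by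
  induction j with
  | zero => simpa using al_le_one _ _
  | succ j ih =>
    have h1 : al (2 ^ a) (2 ^ (a + (j + 1))) ≤
        al (2 ^ a) (2 ^ (a + j)) * al (2 ^ (a + j)) (2 ^ (a + (j + 1))) :=
      al_mul (pow_le_pow_right₀ (by norm_num) (by omega)) le_rfl
        (pow_le_pow_right₀ (by norm_num) (by omega))
    have h2 : al (2 ^ (a + j)) (2 ^ (a + (j + 1))) ≤ q0 := by
      have e1 : (2 : ℤ) ^ (a + (j + 1)) = 2 * 2 ^ (a + j) := by rw [← add_assoc, pow_succ]; ring
      rw [e1]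
      refine al_double ?_ ?_
      · calc (4 : ℤ) = 2 ^ 2 := by norm_num
          _ ≤ 2 ^ (a + j) := pow_le_pow_right₀ (by norm_num) (by omega)
      · exact (even_two).pow_of_ne_zero (by omega)
    rw [pow_succ]
    exact h1.trans (mul_le_mul ih h2 (al_nonneg _ _) (pow_nonneg q0_pos.le _))

end DynPerc
end

section
open scoped BigOperators
namespace DynPerc
open Classical

noncomputable def clu (ω : Config) (u : Vertex) : Config := fun e => ω e && decide (Conn ω u e.1)

lemma clu_true {ω : Config} {u : Vertex} {e : Edge} :
    clu ω u e = true ↔ ω e = true ∧ Conn ω u e.1 := by simp [clu]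

lemma clu_conn {ω : Config} {u v : Vertex} (h : Conn ω u v) : Conn (clu ω u) u v := by
  induction h with
  | refl => exact Conn.refl _
  | @tail y z h1 h2 ih =>
    refine ih.tail ?_
    obtain ⟨e, he, hfg⟩ := openAdj_iff.1 h2
    refine openAdj_iff.2 ⟨e, clu_true.2 ⟨he, ?_⟩, hfg⟩
    rcases hfg with ⟨rfl, rfl⟩ | ⟨rfl, rfl⟩
    · exact h1
    · exact Conn.tail h1 h2

lemma clu_of {ω : Config} {u p q : Vertex} (h : Conn (clu ω u) p q) : Conn ω p q :=
  h.mono fun _ he => (clu_true.1 he).1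

lemma clu_mem {ω : Config} {u p q : Vertex} (h : Conn (clu ω u) p q) (hne : p ≠ q) :
    Conn ω u p := by
  rcases Relation.ReflTransGen.cases_head h with h | ⟨y, h, -⟩
  · exact absurd h hne
  · obtain ⟨e, he, hfg⟩ := openAdj_iff.1 h
    have he := clu_true.1 he
    rcases hfg with ⟨rfl, rfl⟩ | ⟨rfl, rfl⟩
    · exact he.2
    · exact he.2.tail (openAdj_iff.2 ⟨e, he.1, Or.inl ⟨rfl, rfl⟩⟩)

lemma HV_conn {x0 x1 y0 y1 x2 x3 y2 y3 : ℤ} {ω ω' : Config}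
    (h : HC x0 x1 y0 y1 ω) (h' : VC x2 x3 y2 y3 ω')
    (h02 : x0 ≤ x2) (h31 : x3 ≤ x1) (h20 : y2 ≤ y0) (h13 : y1 ≤ y3) :
    ∃ z a b p q, Conn ω (x0, a) (x1, b) ∧ Conn ω' (p, y2) (q, y3) ∧ Conn ω (x0, a) z ∧
      Conn ω' (p, y2) z := by
  obtain ⟨a, b, ha, hb, hc⟩ := h
  obtain ⟨p, q, hp, hq, hv⟩ := h'
  obtain ⟨z, z1, z2⟩ := HV_meet ha hb rfl rfl hc hp rfl rfl hv h02 h31 h20 h13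
  exact ⟨z, a, b, p, q, hc.of_res, hv.of_res, z1.of_res, z2.of_res⟩

def OO (m : ℤ) (ω : Config) : Prop :=
  HC (-(2 * m)) (2 * m) m (2 * m) ω ∧ HC (-(2 * m)) (2 * m) (-(2 * m)) (-m) ω ∧
  VC m (2 * m) (-(2 * m)) (2 * m) ω ∧ VC (-(2 * m)) (-m) (-(2 * m)) (2 * m) ω

lemma circ {m : ℤ} (hm : 1 ≤ m) {ω : Config} (h : OO m ω) :
    ∃ c, ∀ u v, nm u ≤ m → 2 * m ≤ nm v → Conn ω u v → Conn ω u c := by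
  obtain ⟨⟨ta, tb, t1, t2, t3⟩, ⟨ba, bb, b1, b2, b3⟩, ⟨ra, rb, r1, r2, r3⟩,
    ⟨la, lb, l1, l2, l3⟩⟩ := h
  obtain ⟨z, z1, z2⟩ := HV_meet t1 t2 rfl rfl t3 r1 rfl rfl r3 (by omega) le_rfl (by omega) le_rfl
  have cr : Conn ω (-(2 * m), ta) (ra, -(2 * m)) := z1.of_res.trans z2.of_res.symm
  obtain ⟨z, z1, z2⟩ := HV_meet t1 t2 rfl rfl t3 l1 rfl rfl l3 le_rfl (by omega) (by omega) le_rfl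
  have cl : Conn ω (-(2 * m), ta) (la, -(2 * m)) := z1.of_res.trans z2.of_res.symm
  obtain ⟨z, z1, z2⟩ := HV_meet b1 b2 rfl rfl b3 l1 rfl rfl l3 le_rfl (by omega) le_rfl (by omega)
  have cb : Conn ω (-(2 * m), ta) (-(2 * m), ba) :=
    cl.trans (z2.of_res.trans z1.of_res.symm)
  refine ⟨(-(2 * m), ta), fun u v hu hv hc => ?_⟩
  have hcr := cross_sides (by omega) (cross_of_conn hu hv (clu_conn hc))
  rcases hcr with ⟨a, b, ha, hb, h⟩ | ⟨a, b, ha, hb, h⟩ | ⟨a, b, ha, hb, h⟩ | ⟨a, b, ha, hb, h⟩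
  · obtain ⟨z, z1, z2⟩ := HV_meet ha hb rfl rfl h r1 rfl rfl r3 le_rfl le_rfl le_rfl le_rfl
    have hm := clu_mem h.of_res (by simp; omega)
    exact (hm.trans (clu_of z1.of_res)).trans (cr.trans z2.of_res).symm
  · obtain ⟨z, z1, z2⟩ := HV_meet ha hb rfl rfl h l1 rfl rfl l3 le_rfl le_rfl le_rfl le_rfl
    have hm := clu_mem h.of_res (by simp; omega)
    exact (hm.trans (clu_of z1.of_res)).trans (cl.trans z2.of_res).symm
  · obtain ⟨z, z1, z2⟩ := HV_meet t1 t2 rfl rfl t3 ha rfl rfl h le_rfl le_rfl le_rfl le_rfl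
    have hm := clu_mem h.of_res (by simp; omega)
    exact (hm.trans (clu_of z2.of_res)).trans z1.of_res.symm
  · obtain ⟨z, z1, z2⟩ := HV_meet b1 b2 rfl rfl b3 ha rfl rfl h le_rfl le_rfl le_rfl le_rfl
    have hm := clu_mem h.of_res (by simp; omega)
    exact (hm.trans (clu_of z2.of_res)).trans (cb.trans z1.of_res).symm

lemma OO_loc (m : ℤ) : Loc (OO m) :=
  (HC_loc _ _ _ _).and ((HC_loc _ _ _ _).and ((VC_loc _ _ _ _).and (VC_loc _ _ _ _)))
lemma OO_inc (m : ℤ) : Inc (OO m) :=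
  (HC_inc _ _ _ _).and ((HC_inc _ _ _ _).and ((VC_inc _ _ _ _).and (VC_inc _ _ _ _)))

lemma OO_prob {m : ℤ} (hm : 4 ≤ m) (he : Even m) : c0 ^ 4 ≤ Pr (OO m) := by
  have hc := c0_pos.le
  have h1 : c0 ≤ Pr (HC (-(2 * m)) (2 * m) m (2 * m)) := by
    rw [Pr_HC]; exact rsw' hm he (by omega) (by omega) (by omega)
  have h2 : c0 ≤ Pr (HC (-(2 * m)) (2 * m) (-(2 * m)) (-m)) := by
    rw [Pr_HC]; exact rsw' hm he (by omega) (by omega) (by omega)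
  have h3 : c0 ≤ Pr (VC m (2 * m) (-(2 * m)) (2 * m)) := by
    rw [Pr_VC]; exact rsw' hm he (by omega) (by omega) (by omega)
  have h4 : c0 ≤ Pr (VC (-(2 * m)) (-m) (-(2 * m)) (2 * m)) := by
    rw [Pr_VC]; exact rsw' hm he (by omega) (by omega) (by omega)
  have k1 := Pr_fkg3 (HC_loc _ _ _ _) (VC_loc _ _ _ _) (VC_loc _ _ _ _) (HC_inc _ _ _ _)
    (VC_inc _ _ _ _) (VC_inc _ _ _ _) hc hc h2 h3 h4
  have k2 := Pr_fkg (HC_loc (-(2 * m)) (2 * m) m (2 * m)) ((HC_loc (-(2 * m)) (2 * m) (-(2 * m)) (-m)).and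
    ((VC_loc m (2 * m) (-(2 * m)) (2 * m)).and (VC_loc (-(2 * m)) (-m) (-(2 * m)) (2 * m)))) (HC_inc _ _ _ _)
    ((HC_inc _ _ _ _).and ((VC_inc _ _ _ _).and (VC_inc _ _ _ _)))
  refine le_trans ?_ k2
  calc c0 ^ 4 = c0 * (c0 * (c0 * c0)) := by ring
    _ ≤ _ := mul_le_mul h1 k1 (by positivity) (Pr_nonneg _)

/-- gluing arms -/
lemma al_ext {m b : ℤ} (hm : 4 ≤ m) (he : Even m) (hb : 2 * m ≤ b) :
    al 0 (2 * m) * (c0 ^ 4 * al m b) ≤ al 0 b := by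
  have h1 := Pr_fkg3 (Cross_loc 0 (2 * m)) (OO_loc m) (Cross_loc m b) (Cross_inc _ _) (OO_inc m)
    (Cross_inc _ _) (pow_nonneg c0_pos.le 4) (al_nonneg m b) (le_refl _) (OO_prob hm he) (le_refl _)
  refine h1.trans (Pr_mono ((Cross_loc _ _).and ((OO_loc m).and (Cross_loc _ _))) (Cross_loc _ _) ?_)
  rintro ω ⟨⟨u, v, h1, h2, h3⟩, hO, ⟨u', v', h1', h2', h3'⟩⟩
  obtain ⟨c, hc⟩ := circ (by omega) hO
  have k1 := hc u v (by omega) h2 h3.of_res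
  have k2 := hc u' v' h1' (by omega) h3'.of_res
  exact cross_of_conn h1 h2' (k1.trans (k2.symm.trans h3'.of_res))

lemma al_lower {m : ℤ} (hm : 4 ≤ m) (he : Even m) : c0 ≤ al m (32 * m) := by
  have h1 : c0 ≤ Pr (HC 0 (32 * m) 0 m) := by
    rw [Pr_HC]; exact rsw' hm he (by omega) (by omega) (by omega)
  refine h1.trans (Pr_mono (HC_loc _ _ _ _) (Cross_loc _ _) ?_)
  rintro ω ⟨a, b, ha, hb, hc⟩
  simp only [rect] at ha hb
  refine cross_of_conn ?_ ?_ hc.of_res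
  · rw [nm_le]; simp only; omega
  · rw [le_nm]; simp only; omega

/-- constant in doubling and quasi-multiplicativity -/
noncomputable def c1 : ℝ := c0 ^ 9
lemma c1_pos : 0 < c1 := pow_pos c0_pos _
lemma c1_le : c1 ≤ 1 := pow_le_one₀ c0_pos.le c0_lt.le

lemma al_16 {s : ℕ} (hs : 3 ≤ s) : c0 ^ 5 * al 0 (2 ^ s) ≤ al 0 (2 ^ (s + 4)) := by
  obtain ⟨r, rfl⟩ : ∃ r, s = r + 1 := ⟨s - 1, by omega⟩
  have hm : (4 : ℤ) ≤ 2 ^ r := by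
    calc (4 : ℤ) = 2 ^ 2 := by norm_num
      _ ≤ 2 ^ r := pow_le_pow_right₀ (by norm_num) (by omega)
  have he : Even ((2 : ℤ) ^ r) := (even_two).pow_of_ne_zero (by omega)
  have h1 := al_ext (m := 2 ^ r) (b := 32 * 2 ^ r) hm he (by omega)
  have h2 := al_lower hm he
  have e1 : (2 : ℤ) ^ (r + 1) = 2 * 2 ^ r := by ring
  have e2 : (2 : ℤ) ^ (r + 1 + 4) = 32 * 2 ^ r := by ring
  rw [e1, e2]
  refine le_trans ?_ h1
  have h3 : c0 ^ 4 * c0 ≤ c0 ^ 4 * al (2 ^ r) (32 * 2 ^ r) :=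
    mul_le_mul_of_nonneg_left h2 (pow_nonneg c0_pos.le _)
  have := mul_le_mul_of_nonneg_left h3 (al_nonneg 0 (2 * 2 ^ r))
  linarith [this]

lemma al_dbl {s : ℕ} (hs : 3 ≤ s) : c1 * al 0 (2 ^ s) ≤ al 0 (2 ^ (s + 1)) := by
  have h1 := al_16 hs
  have h2 : al 0 (2 ^ (s + 4)) ≤ al 0 (2 ^ (s + 1)) :=
    al_mono le_rfl (pow_le_pow_right₀ (by norm_num) (by omega))
  have h3 : c1 ≤ c0 ^ 5 := pow_le_pow_of_le_one c0_pos.le c0_lt.le (by norm_num)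
  have := mul_le_mul_of_nonneg_right h3 (al_nonneg 0 (2 ^ s))
  linarith

lemma al_qm {s : ℕ} (hs : 3 ≤ s) (b : ℤ) :
    c1 * (al 0 (2 ^ s) * al (2 ^ (s + 3)) b) ≤ al 0 b := by
  have h1 := al_16 hs
  have hc := c0_pos.le
  have hn := al_nonneg 0 (2 ^ s)
  have hn' := al_nonneg (2 ^ (s + 3)) b
  have e : c1 = c0 ^ 5 * c0 ^ 4 := by rw [c1]; ring
  by_cases hb : (2 : ℤ) ^ (s + 4) ≤ b
  · have e1 : (2 : ℤ) ^ (s + 4) = 2 * 2 ^ (s + 3) := by ring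
    have h2 := al_ext (m := 2 ^ (s + 3)) (b := b) ?_ ?_ (by omega)
    · rw [← e1] at h2
      refine le_trans ?_ h2
      rw [e]
      have := mul_le_mul_of_nonneg_right h1 (mul_nonneg (pow_nonneg hc 4) hn')
      linarith [this]
    · calc (4 : ℤ) = 2 ^ 2 := by norm_num
        _ ≤ 2 ^ (s + 3) := pow_le_pow_right₀ (by norm_num) (by omega)
    · exact (even_two).pow_of_ne_zero (by omega)
  · have h2 : al 0 (2 ^ (s + 4)) ≤ al 0 b := al_mono le_rfl (by omega)
    refine le_trans ?_ (h1.trans h2)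
    have h3 : al (2 ^ (s + 3)) b ≤ 1 := al_le_one _ _
    have h4 : c0 ^ 4 ≤ 1 := pow_le_one₀ hc c0_lt.le
    rw [e]
    have h5 : c0 ^ 4 * al (2 ^ (s + 3)) b ≤ 1 := mul_le_one₀ h4 hn' h3
    have := mul_le_mul_of_nonneg_left h5 (mul_nonneg (pow_nonneg hc 5) hn)
    linarith [this]

end DynPerc
end

section
open scoped BigOperators
namespace DynPerc
open Classical

/-! Fourier estimates on annuli -/

def Bd (a b : ℤ) (u : Vertex) : Prop := nm u ≤ a ∨ b ≤ nm u

def Rch (a b : ℤ) (ω : Config) (w : Vertex) : Prop := ∃ u, Bd a b u ∧ Conn ω u w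

noncomputable def An (E : Finset Edge) (a b : ℤ) : Finset Edge := E.filter (ann a b)

lemma mem_An {E : Finset Edge} {a b : ℤ} {e : Edge} : e ∈ An E a b ↔ e ∈ E ∧ ann a b e := by
  simp [An]

noncomputable def JJ (E : Finset Edge) (a b : ℤ) (x : Finset Edge) : Finset Edge :=
  (An E a b).filter fun e => Rch a b (cfg x) e.1 ∨ Rch a b (cfg x) (tl e)

lemma Rch.step {a b : ℤ} {ω : Config} {v w : Vertex} (h : Rch a b ω v) (hs : OpenAdj ω v w) :
    Rch a b ω w := by
  obtain ⟨u, h1, h2⟩ := h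
  exact ⟨u, h1, h2.tail hs⟩

lemma mem_JJ_of {E : Finset Edge} {a b : ℤ} {x : Finset Edge} {e : Edge} {v w : Vertex}
    (he : e ∈ An E a b) (hv : Rch a b (cfg x) v)
    (h : (v = e.1 ∧ w = tl e) ∨ (w = e.1 ∧ v = tl e)) : e ∈ JJ E a b x := by
  rw [JJ, Finset.mem_filter]
  refine ⟨he, ?_⟩
  rcases h with ⟨rfl, rfl⟩ | ⟨rfl, rfl⟩
  · exact Or.inl hv
  · exact Or.inr hv

lemma agree_iff {x x' J : Finset Edge} (h : x' ∩ J = x ∩ J) {e : Edge} (he : e ∈ J) :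
    e ∈ x' ↔ e ∈ x := by
  have : e ∈ x' ∩ J ↔ e ∈ x ∩ J := by rw [h]
  simpa [he] using this

lemma Rch_agree {E : Finset Edge} {a b : ℤ} {x x' : Finset Edge} (hx : x ⊆ An E a b)
    (hx' : x' ⊆ An E a b) (h : x' ∩ JJ E a b x = x ∩ JJ E a b x) (w : Vertex) :
    Rch a b (cfg x) w ↔ Rch a b (cfg x') w := by
  constructor
  · rintro ⟨u, h1, h2⟩
    have : Rch a b (cfg x) w ∧ Rch a b (cfg x') w := by
      induction h2 with
      | refl => exact ⟨⟨u, h1, Conn.refl _⟩, ⟨u, h1, Conn.refl _⟩⟩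
      | tail _ hst ih =>
        refine ⟨ih.1.step hst, ih.2.step ?_⟩
        obtain ⟨e, he, hfg⟩ := openAdj_iff.1 hst
        refine openAdj_iff.2 ⟨e, ?_, hfg⟩
        rw [cfg_eq_true] at *
        exact (agree_iff h (mem_JJ_of (hx he) ih.1 hfg)).2 he
    exact this.2
  · rintro ⟨u, h1, h2⟩
    induction h2 with
    | refl => exact ⟨u, h1, Conn.refl _⟩
    | tail _ hst ih =>
      refine ih.step ?_
      obtain ⟨e, he, hfg⟩ := openAdj_iff.1 hst
      refine openAdj_iff.2 ⟨e, ?_, hfg⟩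
      rw [cfg_eq_true] at *
      exact (agree_iff h (mem_JJ_of (hx' he) ih hfg)).1 he

lemma JJ_stop (E : Finset Edge) (a b : ℤ) : IsStop (An E a b) (JJ E a b) := by
  intro x hx x' hx' h
  unfold JJ
  refine Finset.filter_congr fun e _ => ?_
  rw [Rch_agree hx hx' h, Rch_agree hx hx' h]

lemma Bd_of_not_ann {a b : ℤ} {e : Edge} (h : ¬ ann a b e) : Bd a b e.1 ∧ Bd a b (tl e) := by
  have := nm_tl e
  rw [ann, lo, le_min_iff, min_lt_iff] at h
  unfold Bd
  omega

lemma zero_agree {E : Finset Edge} {a b : ℤ} (ha : 0 ≤ a) {x x' y : Finset Edge}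
    (hx : x ⊆ An E a b)
    (h : x' ∩ JJ E a b x = x ∩ JJ E a b x) (hy : y ⊆ E \ An E a b) (v : Vertex)
    (hv : Conn (cfg (x ∪ y)) (0, 0) v) : Rch a b (cfg x) v ∧ Conn (cfg (x' ∪ y)) (0, 0) v := by
  induction hv with
  | refl => exact ⟨⟨(0, 0), Or.inl (by rw [nm_le]; simp only; omega), Conn.refl _⟩, Conn.refl _⟩
  | @tail p q _ hst ih =>
    obtain ⟨e, he, hfg⟩ := openAdj_iff.1 hst
    rw [cfg_eq_true, Finset.mem_union] at he
    rcases he with he | he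
    · refine ⟨ih.1.step (openAdj_iff.2 ⟨e, by rwa [cfg_eq_true], hfg⟩), ih.2.tail
        (openAdj_iff.2 ⟨e, ?_, hfg⟩)⟩
      rw [cfg_eq_true, Finset.mem_union]
      exact Or.inl ((agree_iff h (mem_JJ_of (hx he) ih.1 hfg)).2 he)
    · refine ⟨?_, ih.2.tail (openAdj_iff.2 ⟨e, ?_, hfg⟩)⟩
      · have h1 := hy he
        rw [Finset.mem_sdiff, mem_An] at h1
        have h2 := Bd_of_not_ann (fun h3 => h1.2 ⟨h1.1, h3⟩ : ¬ ann a b e)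
        refine ⟨q, ?_, Conn.refl _⟩
        rcases hfg with ⟨rfl, rfl⟩ | ⟨rfl, rfl⟩
        · exact h2.2
        · exact h2.1
      · rw [cfg_eq_true, Finset.mem_union]
        exact Or.inr he

/-- radial indicator -/
noncomputable def fR (R : ℝ) (F : Finset Edge) : ℝ := if ZeroToBoundary R (cfg F) then 1 else 0

lemma fR_agree (R : ℝ) {E : Finset Edge} {a b : ℤ} (ha : 0 ≤ a) {x x' y : Finset Edge}
    (hx : x ⊆ An E a b) (hx' : x' ⊆ An E a b)
    (h : x' ∩ JJ E a b x = x ∩ JJ E a b x) (hy : y ⊆ E \ An E a b) :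
    fR R (x' ∪ y) = fR R (x ∪ y) := by
  have h' : x ∩ JJ E a b x' = x' ∩ JJ E a b x' := by
    rw [JJ_stop E a b x hx x' hx' h, h]
  have : ZeroToBoundary R (cfg (x' ∪ y)) ↔ ZeroToBoundary R (cfg (x ∪ y)) := by
    constructor
    · rintro ⟨v, h1, h2⟩
      exact ⟨v, (zero_agree ha hx' h' hy v h1).2, h2⟩
    · rintro ⟨v, h1, h2⟩
      exact ⟨v, (zero_agree ha hx h hy v h1).2, h2⟩
  unfold fR
  simp only [this]

def ArmAt (c : Vertex) (w : ℤ) (ω : Config) : Prop := Cross 0 w (fun e => ω (etrans c.1 c.2 e))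

lemma ArmAt_loc (c : Vertex) (w : ℤ) : Loc (ArmAt c w) := Loc_map _ (Cross_loc 0 w)
lemma ArmAt_pr (c : Vertex) (w : ℤ) : Pr (ArmAt c w) = al 0 w := Pr_map _ (Cross_loc 0 w)

lemma armAt_of {a b w : ℤ} {c : Vertex} {ω : Config} (h1 : a + w ≤ nm c) (h2 : nm c ≤ b - w)
    (h : Rch a b ω c) : ArmAt c w ω := by
  obtain ⟨u, hu, hc⟩ := h
  have h3 : Conn (fun e => ω (etrans c.1 c.2 e)) (0, 0) (u.1 - c.1, u.2 - c.2) := by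
    rw [(aut_trans c.1 c.2).conn]
    simp only [vtrans_apply, zero_add, sub_add_cancel]
    exact hc.symm
  refine cross_of_conn ?_ ?_ h3
  · rw [nm_le]; simp
  · rw [le_nm]
    have k1 := le_nm.1 h1
    have k2 := nm_le.1 h2
    simp only
    rcases hu with hu | hu
    · rw [nm_le] at hu; omega
    · rw [le_nm] at hu; omega

lemma JJ_prob {E : Finset Edge} {a b w : ℤ} {e : Edge}
    (he : ann (a + w) (b - w) e) :
    Ex (An E a b) (fun x => if e ∈ JJ E a b x then 1 else 0) ≤ 2 * al 0 w := by
  set X := An E a b with hX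
  set A : Config → Prop := fun ω => Rch a b (res (fun e => e ∈ X) ω) e.1 ∨
    Rch a b (res (fun e => e ∈ X) ω) (tl e) with hA
  have hD : Dep A ↑X := Dep_res (fun e => e ∈ X) (fun ω => Rch a b ω e.1 ∨ Rch a b ω (tl e))
  have h1 : Ex X (fun x => if e ∈ JJ E a b x then 1 else 0) ≤ Pr A := by
    rw [Pr_Ex hD]
    refine Ex_mono fun x hx => ?_
    have hr : res (fun e => e ∈ X) (cfg x) = cfg x := by
      funext e
      rw [Bool.eq_iff_iff, res_true, cfg_eq_true]
      exact ⟨fun h => h.1, fun h => ⟨h, hx h⟩⟩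
    by_cases hj : e ∈ JJ E a b x
    · have : A (cfg x) := by
        rw [hA]; simp only [hr]
        exact (Finset.mem_filter.1 hj).2
      simp [hj, this]
    · simp only [hj, if_false]; split_ifs <;> norm_num
  refine h1.trans ?_
  have h2 : Pr A ≤ Pr (fun ω => ArmAt e.1 w ω ∨ ArmAt (tl e) w ω) := by
    refine Pr_mono ⟨X, hD⟩ ((ArmAt_loc _ _).or (ArmAt_loc _ _)) ?_
    intro ω hω
    have h3 := nm_tl e
    rw [ann, lo, le_min_iff, min_lt_iff] at he
    have mono : ∀ v, Rch a b (res (fun e => e ∈ X) ω) v → Rch a b ω v := by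
      rintro v ⟨u, i1, i2⟩
      exact ⟨u, i1, i2.of_res⟩
    rcases hω with hω | hω
    · exact Or.inl (armAt_of (by omega) (by omega) (mono _ hω))
    · exact Or.inr (armAt_of (by omega) (by omega) (mono _ hω))
  have h3 := Pr_or_le (ArmAt_loc e.1 w) (ArmAt_loc (tl e) w)
  rw [ArmAt_pr, ArmAt_pr] at h3
  linarith

lemma An_sub (E : Finset Edge) (a b : ℤ) : An E a b ⊆ E := Finset.filter_subset _ _

lemma W_stop (R : ℝ) (E : Finset Edge) {a b w : ℤ} (ha : 0 ≤ a) (hw : 0 ≤ w) (k : ℕ)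
    (P Q : Finset Edge → Prop)
    (hQ : ∀ S S' : Finset Edge, S \ An E a b = S' \ An E a b → (Q S ↔ Q S'))
    (hP : ∀ S ⊆ E, P S → (∀ e ∈ S, ann a b e → ann (a + w) (b - w) e) ∧ (∃ e ∈ S, ann a b e) ∧
      (S ∩ An E a b).card < k ∧ Q S) :
    Wt E (fR R) P ≤ (k : ℝ) ^ 2 * (2 * al 0 w) * Wt E (fR R) Q := by
  have hE : An E a b ∪ (E \ An E a b) = E := Finset.union_sdiff_of_subset (An_sub _ _ _)
  have h := Wt_stop (X := An E a b) (Y := E \ An E a b) (A := An E (a + w) (b - w))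
    Finset.disjoint_sdiff (JJ_stop E a b) ?_ (fR R) ?_ (δ := 2 * al 0 w) ?_ ?_ k Q hQ
  · rw [hE] at h
    refine le_trans (Wt_mono fun S hS hPS => ?_) h
    obtain ⟨h1, ⟨e, h2, h2'⟩, h3, h4⟩ := hP S hS hPS
    refine ⟨?_, ⟨e, ?_⟩, ?_, h4⟩
    · intro e he
      rw [Finset.mem_inter, mem_An] at he
      exact mem_An.2 ⟨he.2.1, h1 e he.1 he.2.2⟩
    · rw [Finset.mem_inter, mem_An]
      exact ⟨h2, hS h2, h2'⟩
    · exact h3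
  · intro e he
    rw [mem_An] at *
    refine ⟨he.1, ?_⟩
    have := he.2
    unfold ann at *
    omega
  · intro x hx x' hx' hh y hy
    exact fR_agree R ha hx hx' hh hy
  · exact mul_nonneg (by norm_num) (al_nonneg _ _)
  · intro e he
    exact JJ_prob (mem_An.1 he).2

end DynPerc
end

section
open scoped BigOperators
namespace DynPerc
open Classical

lemma supn_eq (v : Vertex) : supn v = (nm v : ℝ) := by
  simp [supn, nm, Int.cast_max, Int.cast_abs]

lemma ztb_iff {R : ℝ} {ω : Config} :
    ZeroToBoundary R ω ↔ ∃ v, Conn ω (0, 0) v ∧ ⌈R⌉ ≤ nm v := by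
  unfold ZeroToBoundary
  refine exists_congr fun v => and_congr Iff.rfl ?_
  rw [supn_eq, Int.ceil_le]

lemma ztb_cross {R : ℝ} {ω : Config} : ZeroToBoundary R ω ↔ Cross 0 ⌈R⌉ ω := by
  rw [ztb_iff]
  constructor
  · rintro ⟨v, h1, h2⟩
    exact cross_of_conn (by rw [nm_le]; simp) h2 h1
  · rintro ⟨u, v, h1, h2, h3⟩
    rw [nm_le] at h1
    have : u = (0, 0) := by ext <;> simp only <;> omega
    rw [← this]
    exact ⟨v, h3.of_res, h2⟩

lemma mem_E {R : ℝ} {e : Edge} (h : lo e < ⌈R⌉) : e ∈ edgeFinset R := by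
  have h0 : ∃ m : ℤ, (m : ℝ) < R ∧ lo e = m := ⟨lo e, Int.lt_ceil.1 h, rfl⟩
  obtain ⟨m, hm, hl⟩ := h0
  have hn : m < ⌈R⌉ := by omega
  have h1 : nm e.1 ≤ m ∨ nm (tl e) ≤ m := by
    rw [lo] at hl
    have := le_of_eq hl
    rwa [min_le_iff] at this
  have c1 : ∀ z : ℤ, z ≤ m → (z : ℝ) ≤ R := fun z hz => by
    have : (z : ℝ) ≤ m := by exact_mod_cast hz
    linarith
  have c2 : ∀ z : ℤ, -m ≤ z → -R ≤ (z : ℝ) := fun z hz => by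
    have : -(m : ℝ) ≤ z := by exact_mod_cast hz
    linarith
  obtain ⟨⟨x, y⟩, _ | _⟩ := e
  · simp only [tl_false, nm_le] at h1
    simp only [edgeFinset, Finset.mem_filter, Finset.mem_product, Finset.mem_Icc, Finset.mem_univ,
      Intersects, and_true, Bool.false_eq_true, if_false, abs_le]
    refine ⟨by omega, ⟨c2 _ (by omega), c1 _ (by omega)⟩, c1 _ (by omega), ?_⟩
    have := c2 (y + 1) (by omega)
    push_cast at this
    exact this
  · simp only [tl_true, nm_le] at h1
    simp only [edgeFinset, Finset.mem_filter, Finset.mem_product, Finset.mem_Icc, Finset.mem_univ,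
      Intersects, and_true, if_true, abs_le]
    refine ⟨by omega, ⟨c2 _ (by omega), c1 _ (by omega)⟩, c1 _ (by omega), ?_⟩
    have := c2 (x + 1) (by omega)
    push_cast at this
    exact this

lemma lo_le_E {R : ℝ} {e : Edge} (h : e ∈ edgeFinset R) : lo e ≤ ⌈R⌉ := by
  have cR := Int.le_ceil R
  have c1 : ∀ z : ℤ, (z : ℝ) ≤ R → z ≤ ⌈R⌉ := fun z hz => by exact_mod_cast hz.trans cR
  have c2 : ∀ z : ℤ, -R ≤ (z : ℝ) → -⌈R⌉ ≤ z := fun z hz => by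
    have : -(⌈R⌉ : ℝ) ≤ z := by linarith
    exact_mod_cast this
  rw [lo, min_le_iff]
  obtain ⟨⟨x, y⟩, _ | _⟩ := e
  · simp only [edgeFinset, Finset.mem_filter, Finset.mem_product, Finset.mem_Icc, Finset.mem_univ,
      Intersects, and_true, Bool.false_eq_true, if_false, abs_le] at h
    obtain ⟨-, ⟨h1, h2⟩, h3, h4⟩ := h
    have := c2 x h1
    have := c1 x h2
    have := c1 y h3
    have := c2 (y + 1) (by push_cast; exact h4)
    simp only [tl_false, nm_le]
    omega
  · simp only [edgeFinset, Finset.mem_filter, Finset.mem_product, Finset.mem_Icc, Finset.mem_univ,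
      Intersects, and_true, if_true, abs_le] at h
    obtain ⟨-, ⟨h1, h2⟩, h3, h4⟩ := h
    have := c2 y h1
    have := c1 y h2
    have := c1 x h3
    have := c2 (x + 1) (by push_cast; exact h4)
    simp only [tl_true, nm_le]
    omega

lemma Cross_dep_E {R : ℝ} {a b : ℤ} (hb : b ≤ ⌈R⌉) :
    Dep (Cross a b) ↑(An (edgeFinset R) a b) :=
  (Cross_dep a b).mono fun e he => by
    have he : ann a b e := he
    rw [Finset.mem_coe, mem_An]
    exact ⟨mem_E (he.2.trans_le hb), he⟩

lemma alpha1_eq (R : ℝ) : alpha1 R = al 0 ⌈R⌉ := by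
  rw [alpha1, al, Pr_eq ((Cross_dep_E le_rfl).mono (Finset.coe_subset.2 (An_sub (edgeFinset R) _ _)))]
  congr 1
  funext ω
  exact propext ztb_cross

lemma W_proj (R : ℝ) {p a1 b1 p' q' a2 b2 : ℤ} (h0 : 0 ≤ p) (h1 : p ≤ a1)
    (h2 : b1 ≤ p') (h3 : p ≤ p') (h4 : q' ≤ a2) (h5 : b1 ≤ a2) (h5' : p ≤ a2) (h6 : p ≤ ⌈R⌉)
    (h7 : b1 ≤ ⌈R⌉) (h8 : q' ≤ ⌈R⌉) (h9 : b2 ≤ ⌈R⌉) :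
    Wt (edgeFinset R) (fR R) (fun S => ∀ e ∈ S, ¬ ann a1 b1 e ∧ ¬ ann a2 b2 e) ≤
      (al a1 b1 * al a2 b2) ^ 2 * (al 0 p * al p' q') := by
  set E := edgeFinset R with hE
  set V := An E a1 b1 ∪ An E a2 b2 with hV
  have hVE : V ⊆ E := Finset.union_subset (An_sub _ _ _) (An_sub _ _ _)
  have hVY : Disjoint V (E \ V) := Finset.disjoint_sdiff
  have hU : V ∪ (E \ V) = E := Finset.union_sdiff_of_subset hVE
  set GG : Config → Prop := fun ω => Cross a1 b1 ω ∧ Cross a2 b2 ω with hGG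
  set II : Config → Prop := fun ω => Cross 0 p ω ∧ Cross p' q' ω with hII
  have dG : Dep GG ↑V := ((Cross_dep_E h7).mono (Finset.coe_subset.2 Finset.subset_union_left)).and
    ((Cross_dep_E h9).mono (Finset.coe_subset.2 Finset.subset_union_right))
  have dI : Dep II ↑(E \ V) := by
    refine ((Cross_dep_E h6).mono ?_).and ((Cross_dep_E h8).mono ?_) <;>
    · rw [Finset.coe_subset]
      intro e he
      rw [mem_An] at he
      rw [Finset.mem_sdiff, hV, Finset.mem_union, mem_An, mem_An]
      refine ⟨he.1, ?_⟩
      have := he.2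
      unfold ann at *
      omega
  have key := Wt_proj hVY (fR R) (fun v => GG (cfg v)) (fun y => II (cfg y))
    (fun F => by unfold fR; split_ifs <;> norm_num) ?_
  · rw [hU] at key
    refine le_trans (Wt_mono ?_) (key.trans (le_of_eq ?_))
    · intro S hS h
      rw [Finset.eq_empty_iff_forall_notMem]
      intro e he
      rw [Finset.mem_inter, hV, Finset.mem_union, mem_An, mem_An] at he
      have := h e he.1
      tauto
    · rw [← Pr_Ex dG, ← Pr_Ex dI, hGG, hII, al, al, al, al,
        Pr_indep (X := An E a1 b1) (Y := An E a2 b2) ?_ (Cross_dep_E h7) (Cross_dep_E h9),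
        Pr_indep (X := An E 0 p) (Y := An E p' q') ?_ (Cross_dep_E h6) (Cross_dep_E h8)]
      all_goals
        rw [Finset.disjoint_left]
        intro e he he'
        rw [mem_An] at he he'
        have := he.2
        have := he'.2
        unfold ann at *
        omega
  · intro v hv y hy
    unfold fR
    by_cases hz : ZeroToBoundary R (cfg (v ∪ y))
    · rw [ztb_cross] at hz
      have e1 : GG (cfg v) := by
        rw [← dG _ _ (cfg_union_left hVY hy)]
        exact ⟨hz.sub (by omega) h7, hz.sub (by omega) h9⟩
      have e2 : II (cfg y) := by
        rw [← dI _ _ (cfg_union_right hVY hv)]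
        exact ⟨hz.sub (by omega) h6, hz.sub (by omega) h8⟩
      simp [hz, ztb_cross, e1, e2]
    · simp only [hz, if_false]; split_ifs <;> norm_num

lemma ring_exists {S : Finset Edge} {k N : ℕ} (hS : S.card < k) (hk : k ≤ N) (p w : ℤ) :
    ∃ t ∈ Finset.range N, ∀ e ∈ S, ¬ ann (p + t * w) (p + (t + 1) * w) e := by
  by_contra hcon
  push Not at hcon
  choose! g hg hg' using hcon
  have : N ≤ S.card := by
    have := Finset.card_le_card_of_injOn (s := Finset.range N) (t := S) g (fun t ht => hg t ht) ?_
    · simpa using this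
    · intro t ht t' ht' he
      have i1 := hg' t (by simpa using ht)
      have i2 := hg' t' (by simpa using ht')
      rw [he] at i1
      unfold ann at i1 i2
      by_contra hne
      rcases lt_or_gt_of_ne hne with h | h
      · have h : (t : ℤ) + 1 ≤ t' := by exact_mod_cast h
        have hw : 0 < w := by nlinarith
        nlinarith
      · have h : (t' : ℤ) + 1 ≤ t := by exact_mod_cast h
        have hw : 0 < w := by nlinarith
        nlinarith
  omega

end DynPerc
end

section
open scoped BigOperators
namespace DynPerc
open Classical

def Top (k : ℕ) (a b : ℤ) (S : Finset Edge) : Prop :=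
  S.card < k ∧ (∃ e ∈ S, ann a b e) ∧ ∀ e ∈ S, lo e < b

lemma mem_of_sdiff {S S' X : Finset Edge} (h : S \ X = S' \ X) {e : Edge} (he : e ∉ X) :
    e ∈ S ↔ e ∈ S' := by
  have : e ∈ S \ X ↔ e ∈ S' \ X := by rw [h]
  simpa [he] using this

lemma card_inter_lt {S X : Finset Edge} {k : ℕ} (h : S.card < k) : (S ∩ X).card < k :=
  (Finset.card_le_card Finset.inter_subset_left).trans_lt h

lemma ring_bd {N t : ℕ} {w K : ℤ} (hw : 0 < w) (hNw : N * w = K) (ht : t ∈ Finset.range N) :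
    0 ≤ (t : ℤ) * w ∧ (t : ℤ) * w + w ≤ K := by
  have h1 : (t : ℤ) + 1 ≤ N := by exact_mod_cast Finset.mem_range.1 ht
  constructor
  · positivity
  · nlinarith

lemma W_a (R : ℝ) {k N : ℕ} {M I w : ℤ} (hk : k ≤ N) (hw : 0 < w) (hNw : N * w = 2 * M)
    (hI : 0 ≤ I) (hIM : I ≤ M) (hM : 4 * M ≤ ⌈R⌉) :
    Wt (edgeFinset R) (fR R) (fun S => Top k (4 * M) (8 * M) S ∧ ∀ e ∈ S, ¬ ann I M e) ≤
      N * ((k : ℝ) ^ 2 * (2 * al 0 w) * ((al I M * al (16 * M) ⌈R⌉) ^ 2 * al 0 I)) := by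
  have hb := Wt_biUnion (E := edgeFinset R) (f := fR R) (Finset.range N)
    (fun S => Top k (4 * M) (8 * M) S ∧ ∀ e ∈ S, ¬ ann I M e)
    (fun t S => (Top k (4 * M) (8 * M) S ∧ ∀ e ∈ S, ¬ ann I M e) ∧
      ∀ e ∈ S, ¬ ann (2 * M + t * w) (2 * M + (t + 1) * w) e) (by
      intro S _ hS
      obtain ⟨t, ht, h⟩ := ring_exists hS.1.1 hk (2 * M) w
      exact ⟨t, ht, hS, h⟩)
  refine hb.trans ?_
  rw [← nsmul_eq_mul]
  refine (Finset.sum_le_card_nsmul _ _ _ fun t ht => ?_).trans (by rw [Finset.card_range])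
  obtain ⟨t1, t2⟩ := ring_bd hw hNw ht
  have e1 : ((t : ℤ) + 1) * w = t * w + w := by ring
  rw [e1]
  generalize (t : ℤ) * w = T at *
  have hs := W_stop R (edgeFinset R) (a := 2 * M + T) (b := 16 * M) (w := w) (by omega) hw.le k
    (fun S => (Top k (4 * M) (8 * M) S ∧ ∀ e ∈ S, ¬ ann I M e) ∧
      ∀ e ∈ S, ¬ ann (2 * M + T) (2 * M + (T + w)) e)
    (fun S => ∀ e ∈ S, ¬ ann I M e ∧ ¬ ann (16 * M) ⌈R⌉ e) ?_ ?_
  · refine hs.trans ?_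
    have hp := W_proj R (p := I) (a1 := I) (b1 := M) (p' := M) (q' := M) (a2 := 16 * M)
      (b2 := ⌈R⌉) hI le_rfl le_rfl hIM (by omega) (by omega) (by omega) (by omega) (by omega)
      (by omega) le_rfl
    have h1 : al 0 I * al M M ≤ al 0 I := mul_le_of_le_one_right (al_nonneg _ _) (al_le_one _ _)
    have h2 := mul_le_mul_of_nonneg_left h1 (sq_nonneg (al I M * al (16 * M) ⌈R⌉))
    refine mul_le_mul_of_nonneg_left (hp.trans h2) ?_
    have := al_nonneg 0 w
    positivity
  · intro S S' hSS
    refine forall_congr' fun e => ?_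
    by_cases he : e ∈ An (edgeFinset R) (2 * M + T) (16 * M)
    · have := (mem_An.1 he).2
      unfold ann at *
      constructor <;> intro _ _ <;> omega
    · rw [mem_of_sdiff hSS he]
  · rintro S - ⟨⟨⟨h1, ⟨e, he, he'⟩, h3⟩, h4⟩, h5⟩
    refine ⟨?_, ⟨e, he, ?_⟩, card_inter_lt h1, ?_⟩
    · intro e he ha
      have i1 := h3 e he
      have i2 := h5 e he
      unfold ann at *
      omega
    · unfold ann at *
      omega
    · intro e he
      refine ⟨h4 e he, ?_⟩
      have i1 := h3 e he
      unfold ann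
      omega

lemma W_b (R : ℝ) {k N : ℕ} {M L w w' : ℤ} (hk : k ≤ N) (hw : 0 < w) (hNw : N * w = 2 * M)
    (hw' : 0 < w') (hNw' : N * w' = L) (hLM : 8 * L ≤ 2 * M) (hM : 4 * M ≤ ⌈R⌉) :
    Wt (edgeFinset R) (fR R) (fun S => Top k (4 * M) (8 * M) S ∧ ∃ e ∈ S, ann (2 * L) (4 * L) e) ≤
      N * (N * (N * ((k : ℝ) ^ 2 * (2 * al 0 w) * ((k : ℝ) ^ 2 * (2 * al 0 w') *
        (al (16 * M) ⌈R⌉ ^ 2 * (al 0 L * al (8 * L) (2 * M))))))) := by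
  have hb := Wt_biUnion (E := edgeFinset R) (f := fR R)
    (Finset.range N ×ˢ (Finset.range N ×ˢ Finset.range N))
    (fun S => Top k (4 * M) (8 * M) S ∧ ∃ e ∈ S, ann (2 * L) (4 * L) e)
    (fun t S => (Top k (4 * M) (8 * M) S ∧ ∃ e ∈ S, ann (2 * L) (4 * L) e) ∧
      (∀ e ∈ S, ¬ ann (2 * M + t.1 * w) (2 * M + (t.1 + 1) * w) e) ∧
      (∀ e ∈ S, ¬ ann (L + t.2.1 * w') (L + (t.2.1 + 1) * w') e) ∧
      (∀ e ∈ S, ¬ ann (4 * L + t.2.2 * w') (4 * L + (t.2.2 + 1) * w') e)) (by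
      intro S _ hS
      obtain ⟨t, ht, h⟩ := ring_exists hS.1.1 hk (2 * M) w
      obtain ⟨t', ht', h'⟩ := ring_exists hS.1.1 hk L w'
      obtain ⟨t'', ht'', h''⟩ := ring_exists hS.1.1 hk (4 * L) w'
      exact ⟨(t, t', t''), by simp only [Finset.mem_product]; exact ⟨ht, ht', ht''⟩, hS, h, h', h''⟩)
  refine hb.trans ?_
  rw [← nsmul_eq_mul, ← nsmul_eq_mul, ← nsmul_eq_mul, smul_smul, smul_smul]
  refine (Finset.sum_le_card_nsmul _ _ _ fun t ht => ?_).trans (by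
    rw [Finset.card_product, Finset.card_product, Finset.card_range, mul_assoc])
  obtain ⟨t, t', t''⟩ := t
  simp only [Finset.mem_product] at ht
  obtain ⟨t1, t2⟩ := ring_bd hw hNw ht.1
  obtain ⟨t3, t4⟩ := ring_bd hw' hNw' ht.2.1
  obtain ⟨t5, t6⟩ := ring_bd hw' hNw' ht.2.2
  have e1 : ((t : ℤ) + 1) * w = t * w + w := by ring
  have e2 : ((t' : ℤ) + 1) * w' = t' * w' + w' := by ring
  have e3 : ((t'' : ℤ) + 1) * w' = t'' * w' + w' := by ring
  simp only [e1, e2, e3]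
  generalize (t : ℤ) * w = T at *
  generalize (t' : ℤ) * w' = T' at *
  generalize (t'' : ℤ) * w' = T'' at *
  set E := edgeFinset R with hE
  have hs := W_stop R E (a := 2 * M + T) (b := 16 * M) (w := w) (by omega) hw.le k
    (fun S => (Top k (4 * M) (8 * M) S ∧ ∃ e ∈ S, ann (2 * L) (4 * L) e) ∧
      (∀ e ∈ S, ¬ ann (2 * M + T) (2 * M + (T + w)) e) ∧
      (∀ e ∈ S, ¬ ann (L + T') (L + (T' + w')) e) ∧
      (∀ e ∈ S, ¬ ann (4 * L + T'') (4 * L + (T'' + w')) e))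
    (fun S => (∀ e ∈ S, ann (L + T') (4 * L + (T'' + w')) e →
        ann (L + T' + w') (4 * L + (T'' + w') - w') e) ∧
      (∃ e ∈ S, ann (L + T') (4 * L + (T'' + w')) e) ∧
      (S ∩ An E (L + T') (4 * L + (T'' + w'))).card < k ∧
      ∀ e ∈ S, ¬ ann (16 * M) ⌈R⌉ e) ?_ ?_
  · refine hs.trans (mul_le_mul_of_nonneg_left ?_ (by have := al_nonneg 0 w; positivity))
    have hs' := W_stop R E (a := L + T') (b := 4 * L + (T'' + w')) (w := w') (by omega) hw'.le k
      (fun S => (∀ e ∈ S, ann (L + T') (4 * L + (T'' + w')) e →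
        ann (L + T' + w') (4 * L + (T'' + w') - w') e) ∧
      (∃ e ∈ S, ann (L + T') (4 * L + (T'' + w')) e) ∧
      (S ∩ An E (L + T') (4 * L + (T'' + w'))).card < k ∧
      ∀ e ∈ S, ¬ ann (16 * M) ⌈R⌉ e) (fun S => ∀ e ∈ S, ¬ ann (16 * M) ⌈R⌉ e) ?_
      (fun S _ h => h)
    · refine hs'.trans (mul_le_mul_of_nonneg_left ?_ (by have := al_nonneg 0 w'; positivity))
      have hp := W_proj R (p := L) (a1 := L) (b1 := L) (p' := 8 * L) (q' := 2 * M) (a2 := 16 * M)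
        (b2 := ⌈R⌉) (by omega) le_rfl (by omega) (by omega) (by omega) (by omega) (by omega)
        (by omega) (by omega) (by omega) le_rfl
      refine (Wt_mono fun S _ h e he => ⟨?_, h e he⟩).trans (hp.trans ?_)
      swap
      · unfold ann; omega
      · refine mul_le_mul_of_nonneg_right ?_ (mul_nonneg (al_nonneg _ _) (al_nonneg _ _))
        refine pow_le_pow_left₀ (mul_nonneg (al_nonneg _ _) (al_nonneg _ _)) ?_ 2
        exact mul_le_of_le_one_left (al_nonneg _ _) (al_le_one _ _)
    · intro S S' hSS
      refine forall_congr' fun e => ?_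
      by_cases he : e ∈ An E (L + T') (4 * L + (T'' + w'))
      · have := (mem_An.1 he).2
        unfold ann at *
        constructor <;> intro _ _ <;> omega
      · rw [mem_of_sdiff hSS he]
  · intro S S' hSS
    have hm : ∀ e, ¬ ann (2 * M + T) (16 * M) e → (e ∈ S ↔ e ∈ S') := fun e he =>
      mem_of_sdiff hSS fun h => he (mem_An.1 h).2
    have hi : ∀ e, ann (L + T') (4 * L + (T'' + w')) e → ¬ ann (2 * M + T) (16 * M) e := by
      intro e; unfold ann; omega
    refine and_congr (forall_congr' fun e => ?_) (and_congr (exists_congr fun e => ?_)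
      (and_congr ?_ (forall_congr' fun e => ?_)))
    · by_cases h : ann (L + T') (4 * L + (T'' + w')) e
      · rw [hm e (hi e h)]
      · simp [h]
    · by_cases h : ann (L + T') (4 * L + (T'' + w')) e
      · rw [hm e (hi e h)]
      · simp [h]
    · have : S ∩ An E (L + T') (4 * L + (T'' + w')) = S' ∩ An E (L + T') (4 * L + (T'' + w')) := by
        ext e
        rw [Finset.mem_inter, Finset.mem_inter]
        refine and_congr_left fun h => hm e (hi e (mem_An.1 h).2)
      rw [this]
    · by_cases h : ann (16 * M) ⌈R⌉ e
      · rw [hm e (by unfold ann at *; omega)]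
      · simp [h]
  · rintro S - ⟨⟨⟨h1, ⟨e, he, he'⟩, h3⟩, ⟨e2, he2, he2'⟩⟩, h5, h6, h7⟩
    refine ⟨?_, ⟨e, he, ?_⟩, card_inter_lt h1, ?_, ⟨e2, he2, ?_⟩, card_inter_lt h1, ?_⟩
    · intro e he ha
      have i1 := h3 e he
      have i2 := h5 e he
      unfold ann at *
      omega
    · unfold ann at *
      omega
    · intro e he ha
      have i1 := h6 e he
      have i2 := h7 e he
      unfold ann at *
      omega
    · unfold ann at *
      omega
    · intro e he
      have i1 := h3 e he
      unfold ann
      omega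

end DynPerc
end

section
open scoped BigOperators
namespace DynPerc
open Classical

lemma al_dbl_iter {s : ℕ} (hs : 3 ≤ s) (m : ℕ) : c1 ^ m * al 0 (2 ^ s) ≤ al 0 (2 ^ (s + m)) := by
  induction m with
  | zero => simp
  | succ m ih =>
    have h1 := al_dbl (s := s + m) (by omega)
    have h2 := mul_le_mul_of_nonneg_left ih c1_pos.le
    rw [← add_assoc]
    calc _ = c1 * (c1 ^ m * al 0 (2 ^ s)) := by ring
      _ ≤ _ := h2.trans h1

lemma alg_a {cx c b D y z x Q α : ℝ} (hc : 0 ≤ c) (hx : 0 ≤ cx * x) (hb : 0 ≤ b) (hD : 0 ≤ D)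
    (hy : 0 ≤ y) (hz : 0 ≤ z) (h1 : cx * x ≤ b) (h2 : c * (b * D) ≤ α) (h3 : c ^ 3 * (z * y) ≤ b)
    (h4 : y ≤ Q) : cx * c ^ 5 * (x * ((y * D) ^ 2 * z)) ≤ Q * α ^ 2 := by
  have hQ : 0 ≤ Q := hy.trans h4
  have h5 : 0 ≤ c ^ 3 * (z * y) := by positivity
  have h6 : c * (b * D) * (c * (b * D)) ≤ α * α := mul_le_mul h2 h2 (by positivity)
    (le_trans (by positivity) h2)
  calc cx * c ^ 5 * (x * ((y * D) ^ 2 * z)) = (cx * x) * (c ^ 3 * (z * y)) * y * (c * D) ^ 2 := by ring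
    _ ≤ b * b * Q * (c * D) ^ 2 := by gcongr
    _ = Q * (c * (b * D) * (c * (b * D))) := by ring
    _ ≤ Q * (α * α) := by gcongr
    _ = _ := by ring

lemma alg_b {cx c b D z x x' Q α : ℝ} (hc : 0 ≤ c) (hc1 : c ≤ 1) (hcx : 0 ≤ cx) (hx : 0 ≤ x) (hx' : 0 ≤ x') (hb : 0 ≤ b)
    (hD : 0 ≤ D) (hz : 0 ≤ z) (h1 : cx * x ≤ b) (h2 : c * (b * D) ≤ α)
    (h3 : c ^ 2 * z ≤ b) (h4 : x' ≤ Q) : cx * c ^ 5 * (x * (x' * (D ^ 2 * z))) ≤ Q * α ^ 2 := by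
  have hQ : 0 ≤ Q := hx'.trans h4
  have h5 : 0 ≤ c ^ 2 * z := by positivity
  have h6 : c * (b * D) * (c * (b * D)) ≤ α * α := mul_le_mul h2 h2 (by positivity)
    (le_trans (by positivity) h2)
  calc cx * c ^ 5 * (x * (x' * (D ^ 2 * z))) = (cx * x) * (c ^ 2 * z) * x' * (c * D) ^ 2 * c := by ring
    _ ≤ b * b * Q * (c * D) ^ 2 * 1 := by gcongr
    _ = Q * (c * (b * D) * (c * (b * D))) := by ring
    _ ≤ Q * (α * α) := by gcongr
    _ = _ := by ring

lemma D_bound {m : ℕ} (hm : 3 ≤ m) (n : ℤ) :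
    c1 * (al 0 (2 ^ (m + 2)) * al (16 * 2 ^ m) n) ≤ al 0 n := by
  have h1 := al_qm (s := m + 2) (by omega) n
  have h2 : al (16 * 2 ^ m) n ≤ al (2 ^ (m + 2 + 3)) n := al_mono (by
    have : (2 : ℤ) ^ (m + 2 + 3) = 32 * 2 ^ m := by ring
    have : (0 : ℤ) < 2 ^ m := by positivity
    omega) le_rfl
  refine le_trans ?_ h1
  have := c1_pos
  have := al_nonneg 0 (2 ^ (m + 2))
  gcongr

lemma Wa_num (R : ℝ) {k κ m s i t : ℕ} (hk : k ≤ 2 ^ κ) (hs : s + κ = m + 1) (hs3 : 3 ≤ s)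
    (hi : 3 ≤ i) (hm : m = i + t) (hM : 4 * 2 ^ m ≤ ⌈R⌉) :
    c1 ^ (κ + 6) * Wt (edgeFinset R) (fR R) (fun S => Top k (4 * 2 ^ m) (8 * 2 ^ m) S ∧
      ∀ e ∈ S, ¬ ann (2 ^ i) (2 ^ m) e) ≤ 4 * (2 ^ κ) ^ 7 * (q0 ^ t * al 0 ⌈R⌉ ^ 2) := by
  have hc := c1_pos
  have hW := W_a R (k := k) (N := 2 ^ κ) (M := 2 ^ m) (I := 2 ^ i) (w := 2 ^ s) hk (by positivity)
    (by push_cast; rw [← pow_add, add_comm κ, hs]; ring) (by positivity)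
    (pow_le_pow_right₀ (by norm_num) (by omega)) hM
  have h1 : c1 ^ (κ + 1) * al 0 (2 ^ s) ≤ al 0 (2 ^ (m + 2)) := by
    have := al_dbl_iter hs3 (κ + 1)
    rwa [← add_assoc, hs] at this
  have h3 : c1 ^ 3 * (al 0 (2 ^ i) * al (2 ^ i) (2 ^ m)) ≤ al 0 (2 ^ (m + 2)) := by
    have k1 := al_qm hi (2 ^ m)
    have k2 : al (2 ^ i) (2 ^ m) ≤ al (2 ^ (i + 3)) (2 ^ m) :=
      al_mono (pow_le_pow_right₀ (by norm_num) (by omega)) le_rfl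
    have k3 := al_dbl_iter (s := m) (by omega) 2
    have := al_nonneg 0 (2 ^ i)
    calc _ = c1 ^ 2 * (c1 * (al 0 (2 ^ i) * al (2 ^ i) (2 ^ m))) := by ring
      _ ≤ c1 ^ 2 * (c1 * (al 0 (2 ^ i) * al (2 ^ (i + 3)) (2 ^ m))) := by gcongr
      _ ≤ c1 ^ 2 * al 0 (2 ^ m) := by gcongr
      _ ≤ _ := k3
  have h4 : al (2 ^ i) (2 ^ m) ≤ q0 ^ t := by rw [hm]; exact al_decay (by omega) t
  have key := alg_a hc.le (mul_nonneg (pow_nonneg hc.le _) (al_nonneg _ _)) (al_nonneg _ _)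
    (al_nonneg _ _) (al_nonneg _ _) (al_nonneg _ _) h1 (D_bound (by omega) ⌈R⌉) h3 h4
  have hX : 0 ≤ q0 ^ t * al 0 ⌈R⌉ ^ 2 := by have := q0_pos; positivity
  generalize q0 ^ t * al 0 ⌈R⌉ ^ 2 = X at *
  have hkr : (k : ℝ) ≤ 2 ^ κ := by exact_mod_cast hk
  have hN : (1 : ℝ) ≤ 2 ^ κ := one_le_pow₀ (by norm_num)
  push_cast at hW
  calc _ ≤ c1 ^ (κ + 6) * _ := mul_le_mul_of_nonneg_left hW (by positivity)
    _ = (2 ^ κ * k ^ 2 * 2) * (c1 ^ (κ + 1) * c1 ^ 5 * (al 0 (2 ^ s) *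
        ((al (2 ^ i) (2 ^ m) * al (16 * 2 ^ m) ⌈R⌉) ^ 2 * al 0 (2 ^ i)))) := by ring
    _ ≤ (2 ^ κ * k ^ 2 * 2) * X := by gcongr
    _ ≤ 4 * (2 ^ κ) ^ 7 * X := by
        refine mul_le_mul_of_nonneg_right ?_ hX
        calc (2 ^ κ * k ^ 2 * 2 : ℝ) ≤ 2 ^ κ * (2 ^ κ) ^ 2 * 2 := by gcongr
          _ = 2 * (2 ^ κ) ^ 3 := by ring
          _ ≤ 4 * (2 ^ κ) ^ 7 := by
            have := pow_le_pow_right₀ hN (show 3 ≤ 7 by norm_num)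
            have h0 : (0 : ℝ) ≤ (2 ^ κ) ^ 3 := by positivity
            linarith

lemma Wb_num (R : ℝ) {k κ m s l s' : ℕ} (hk : k ≤ 2 ^ κ) (hs : s + κ = m + 1) (hs3 : 3 ≤ s)
    (hs' : s' + 2 + κ = l) (hs3' : 1 ≤ s') (hl : l + 2 ≤ m) (hM : 4 * 2 ^ m ≤ ⌈R⌉) :
    c1 ^ (κ + 6) * Wt (edgeFinset R) (fR R) (fun S => Top k (4 * 2 ^ m) (8 * 2 ^ m) S ∧
      ∃ e ∈ S, ann (2 * 2 ^ l) (4 * 2 ^ l) e) ≤ 4 * (2 ^ κ) ^ 7 * (q0 ^ s' * al 0 ⌈R⌉ ^ 2) := by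
  have hc := c1_pos
  have hlm : (8 : ℤ) * 2 ^ l ≤ 2 * 2 ^ m := by
    have : (2 : ℤ) ^ (l + 2) ≤ 2 ^ m := pow_le_pow_right₀ (by norm_num) hl
    have e : (2 : ℤ) ^ (l + 2) = 4 * 2 ^ l := by ring
    omega
  have hW := W_b R (k := k) (N := 2 ^ κ) (M := 2 ^ m) (L := 2 ^ l) (w := 2 ^ s) (w' := 2 ^ (s' + 2))
    hk (by positivity)
    (by push_cast; rw [← pow_add, add_comm κ, hs]; ring) (by positivity)
    (by push_cast; rw [← pow_add, add_comm κ, hs']) hlm hM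
  have h1 : c1 ^ (κ + 1) * al 0 (2 ^ s) ≤ al 0 (2 ^ (m + 2)) := by
    have := al_dbl_iter hs3 (κ + 1)
    rwa [← add_assoc, hs] at this
  have h3 : c1 ^ 2 * (al 0 (2 ^ l) * al (8 * 2 ^ l) (2 * 2 ^ m)) ≤ al 0 (2 ^ (m + 2)) := by
    have k1 := al_qm (s := l) (by omega) (2 ^ (m + 1))
    have k3 := al_dbl (s := m + 1) (by omega)
    have e1 : (8 : ℤ) * 2 ^ l = 2 ^ (l + 3) := by ring
    have e2 : (2 : ℤ) * 2 ^ m = 2 ^ (m + 1) := by ring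
    rw [e1, e2]
    calc _ = c1 * (c1 * (al 0 (2 ^ l) * al (2 ^ (l + 3)) (2 ^ (m + 1)))) := by ring
      _ ≤ c1 * al 0 (2 ^ (m + 1)) := by gcongr
      _ ≤ _ := k3
  have h4 : al 0 (2 ^ (s' + 2)) ≤ q0 ^ s' := by
    refine le_trans (al_mono (a' := 2 ^ 2) (by norm_num) le_rfl) ?_
    rw [add_comm]
    exact al_decay le_rfl s'
  have key := alg_b hc.le c1_le (pow_nonneg hc.le _) (al_nonneg 0 (2 ^ s))
    (al_nonneg 0 (2 ^ (s' + 2))) (al_nonneg _ _) (al_nonneg _ _)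
    (mul_nonneg (al_nonneg _ _) (al_nonneg _ _)) h1 (D_bound (by omega) ⌈R⌉) h3 h4
  have hX : 0 ≤ q0 ^ s' * al 0 ⌈R⌉ ^ 2 := by have := q0_pos; positivity
  generalize q0 ^ s' * al 0 ⌈R⌉ ^ 2 = X at *
  have hkr : (k : ℝ) ≤ 2 ^ κ := by exact_mod_cast hk
  push_cast at hW
  calc _ ≤ c1 ^ (κ + 6) * _ := mul_le_mul_of_nonneg_left hW (by positivity)
    _ = ((2 ^ κ) ^ 3 * k ^ 4 * 4) * (c1 ^ (κ + 1) * c1 ^ 5 * (al 0 (2 ^ s) *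
        (al 0 (2 ^ (s' + 2)) * (al (16 * 2 ^ m) ⌈R⌉ ^ 2 *
          (al 0 (2 ^ l) * al (8 * 2 ^ l) (2 * 2 ^ m)))))) := by ring
    _ ≤ ((2 ^ κ) ^ 3 * k ^ 4 * 4) * X := by gcongr
    _ ≤ 4 * (2 ^ κ) ^ 7 * X := by
        refine mul_le_mul_of_nonneg_right ?_ hX
        calc ((2 ^ κ) ^ 3 * k ^ 4 * 4 : ℝ) ≤ (2 ^ κ) ^ 3 * (2 ^ κ) ^ 4 * 4 := by gcongr
          _ = _ := by ring

end DynPerc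
end

section
open scoped BigOperators
namespace DynPerc
open Classical

lemma dyadic {z : ℤ} (hz : 0 < z) : ∃ i : ℕ, (2 : ℤ) ^ i ≤ z ∧ z < 2 ^ (i + 1) := by
  refine ⟨Nat.log 2 z.toNat, ?_, ?_⟩
  · have := Nat.pow_log_le_self 2 (x := z.toNat) (by omega)
    zify at this
    omega
  · have := Nat.lt_pow_succ_log_self (b := 2) (by norm_num) z.toNat
    zify at this
    omega

lemma pow2_lt {a b : ℕ} (h : (2 : ℤ) ^ a < 2 ^ b) : a < b :=
  (pow_lt_pow_iff_right₀ (by norm_num : (1 : ℤ) < 2)).1 h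

lemma Wt_or {E : Finset Edge} {f : Finset Edge → ℝ} (Q Q1 Q2 : Finset Edge → Prop)
    (h : ∀ S ⊆ E, Q S → Q1 S ∨ Q2 S) : Wt E f Q ≤ Wt E f Q1 + Wt E f Q2 := by
  have := Wt_biUnion (E := E) (f := f) (Finset.univ : Finset Bool) Q
    (fun b => if b then Q1 else Q2) (fun S hS hQ => by
      rcases h S hS hQ with h | h
      · exact ⟨true, Finset.mem_univ _, by simpa using h⟩
      · exact ⟨false, Finset.mem_univ _, by simpa using h⟩)
  simpa using this

lemma W_top (R : ℝ) {k κ j : ℕ} (hk : k ≤ 2 ^ κ) (hj : 2 * κ + 10 ≤ j) :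
    Wt (edgeFinset R) (fR R) (Top k (2 ^ j) (2 ^ (j + 1))) ≤
      (j + 1) * (4 * (2 ^ κ) ^ 7 / c1 ^ (κ + 6) * (q0 ^ (j / 2 - 3 - κ) * al 0 ⌈R⌉ ^ 2)) := by
  have hc := c1_pos
  have hq := q0_pos
  set U := 4 * (2 ^ κ) ^ 7 / c1 ^ (κ + 6) * (q0 ^ (j / 2 - 3 - κ) * al 0 ⌈R⌉ ^ 2) with hU
  have hU0 : 0 ≤ U := by positivity
  by_cases hn : (2 : ℤ) ^ j ≤ ⌈R⌉
  swap
  · have : Wt (edgeFinset R) (fR R) (Top k (2 ^ j) (2 ^ (j + 1))) = 0 := by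
      unfold Wt
      refine Finset.sum_eq_zero fun S hS => if_neg ?_
      rintro ⟨-, ⟨e, he, h1⟩, -⟩
      have := lo_le_E (Finset.mem_powerset.1 hS he)
      unfold ann at h1
      omega
    rw [this]; positivity
  obtain ⟨m, rfl⟩ : ∃ m, j = m + 2 := ⟨j - 2, by omega⟩
  set i0 := (m + 2) / 2 with hi0
  have e1 : (2 : ℤ) ^ (m + 2) = 4 * 2 ^ m := by ring
  have e2 : (2 : ℤ) ^ (m + 2 + 1) = 8 * 2 ^ m := by ring
  have hU' : ∀ (t : ℕ) (W : ℝ), i0 - 3 - κ ≤ t →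
      c1 ^ (κ + 6) * W ≤ 4 * (2 ^ κ) ^ 7 * (q0 ^ t * al 0 ⌈R⌉ ^ 2) → W ≤ U := by
    intro t W ht hW
    have h1 : q0 ^ t ≤ q0 ^ (i0 - 3 - κ) := pow_le_pow_of_le_one hq.le q0_lt.le ht
    have h2 : c1 ^ (κ + 6) * W ≤ 4 * (2 ^ κ) ^ 7 * (q0 ^ (i0 - 3 - κ) * al 0 ⌈R⌉ ^ 2) :=
      hW.trans (by gcongr)
    rw [hU, div_mul_eq_mul_div, le_div_iff₀ (by positivity)]
    linarith
  have hA := Wt_or (E := edgeFinset R) (f := fR R) (Top k (2 ^ (m + 2)) (2 ^ (m + 2 + 1)))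
    (fun S => Top k (4 * 2 ^ m) (8 * 2 ^ m) S ∧ ∀ e ∈ S, ¬ ann (2 ^ i0) (2 ^ m) e)
    (fun S => Top k (4 * 2 ^ m) (8 * 2 ^ m) S ∧ ∃ e ∈ S, ann (2 ^ i0) (2 ^ m) e) (by
      intro S _ h
      rw [e1, e2] at h
      by_cases h' : ∃ e ∈ S, ann (2 ^ i0) (2 ^ m) e
      · exact Or.inr ⟨h, h'⟩
      · push Not at h'
        exact Or.inl ⟨h, h'⟩)
  have hB := Wt_biUnion (E := edgeFinset R) (f := fR R) (Finset.Ico i0 m)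
    (fun S => Top k (4 * 2 ^ m) (8 * 2 ^ m) S ∧ ∃ e ∈ S, ann (2 ^ i0) (2 ^ m) e)
    (fun i S => Top k (4 * 2 ^ m) (8 * 2 ^ m) S ∧ ∃ e ∈ S, ann (2 ^ i) (2 ^ (i + 1)) e) (by
      rintro S - ⟨h, e, he, h1, h2⟩
      obtain ⟨i, h3, h4⟩ := dyadic (z := lo e) (lt_of_lt_of_le (by positivity) h1)
      have h5 := pow2_lt (lt_of_le_of_lt h3 h2)
      have h6 := pow2_lt (lt_of_le_of_lt h1 h4)
      exact ⟨i, by rw [Finset.mem_Ico]; omega, h, e, he, h3, h4⟩)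
  have hAn := hU' (m - i0) _ (by omega) (Wa_num R (k := k) (m := m) (s := m + 1 - κ) (i := i0) (t := m - i0) hk
    (by omega) (by omega) (by omega) (by omega) (by omega))
  have hBn : ∑ i ∈ Finset.Ico i0 m, Wt (edgeFinset R) (fR R) (fun S =>
      Top k (4 * 2 ^ m) (8 * 2 ^ m) S ∧ ∃ e ∈ S, ann (2 ^ i) (2 ^ (i + 1)) e) ≤ m * U := by
    calc _ ≤ (Finset.Ico i0 m).card • U := by
          refine Finset.sum_le_card_nsmul _ _ _ fun i hi => ?_
          rw [Finset.mem_Ico] at hi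
          obtain ⟨l, rfl⟩ : ∃ l, i = l + 1 := ⟨i - 1, by omega⟩
          by_cases hlm : l + 2 ≤ m
          · have := Wb_num R (k := k) (m := m) (s := m + 1 - κ) (l := l) (s' := l - 2 - κ) hk
              (by omega) (by omega) (by omega) (by omega) hlm (by omega)
            have e3 : (2 : ℤ) ^ (l + 1) = 2 * 2 ^ l := by ring
            have e4 : (2 : ℤ) ^ (l + 1 + 1) = 4 * 2 ^ l := by ring
            rw [e3, e4]
            exact hU' _ _ (by omega) this
          · omega
      _ = ((m - i0 : ℕ) : ℝ) * U := by rw [nsmul_eq_mul, Nat.card_Ico]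
      _ ≤ m * U := by
          gcongr
          omega
  have : Wt (edgeFinset R) (fR R) (Top k (2 ^ (m + 2)) (2 ^ (m + 2 + 1))) ≤ U + m * U := by
    linarith
  push_cast
  linarith

lemma poly_geom {u : ℝ} (h0 : 0 < u) (h1 : u < 1) :
    ∃ C : ℝ, 0 < C ∧ ∀ j : ℕ, ((j : ℝ) + 1) * u ^ j ≤ C := by
  have h := tendsto_self_mul_const_pow_of_lt_one h0.le h1
  obtain ⟨C, hC⟩ := h.bddAbove_range
  refine ⟨|C| + 1, by positivity, fun j => ?_⟩
  have h2 : (j : ℝ) * u ^ j ≤ C := hC ⟨j, rfl⟩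
  have h3 : u ^ j ≤ 1 := pow_le_one₀ h0.le h1.le
  have := le_abs_self C
  linarith

lemma geom_Icc {v : ℝ} (h0 : 0 < v) (h1 : v < 1) (a b : ℕ) :
    ∑ j ∈ Finset.Ico a b, v ^ j ≤ v ^ a / (1 - v) := by
  rw [Finset.sum_Ico_eq_sum_range]
  simp only [pow_add]
  rw [← Finset.mul_sum, div_eq_mul_inv]
  refine mul_le_mul_of_nonneg_left ?_ (by positivity)
  rw [← tsum_geometric_of_lt_one h0.le h1]
  exact (summable_geometric_of_lt_one h0.le h1).sum_le_tsum _ (fun _ _ => by positivity)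

lemma W_main : ∃ C v B : ℝ, 0 < C ∧ 0 < v ∧ v < 1 ∧ 0 < B ∧ ∀ (R : ℝ) (k κ j1 : ℕ), k ≤ 2 ^ κ →
    2 * κ + 10 ≤ j1 → Wt (edgeFinset R) (fR R) (fun S => S.card < k ∧ ∃ e ∈ S, 2 ^ j1 ≤ lo e) ≤
      C * B ^ κ * v ^ j1 * al 0 ⌈R⌉ ^ 2 := by
  have hc := c1_pos
  have hq := q0_pos
  obtain ⟨u, hu⟩ : ∃ u, u = Real.sqrt (Real.sqrt q0) := ⟨_, rfl⟩
  have u0 : 0 < u := by rw [hu]; positivity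
  have u1 : u < 1 := by
    rw [hu, Real.sqrt_lt' one_pos, one_pow, Real.sqrt_lt' one_pos, one_pow]; exact q0_lt
  have u4 : u ^ 4 = q0 := by
    rw [show 4 = 2 * 2 by norm_num, pow_mul, hu, Real.sq_sqrt (by positivity), Real.sq_sqrt hq.le]
  obtain ⟨C, hC, hCj⟩ := poly_geom u0 u1
  refine ⟨C * (4 / (c1 ^ 6 * q0 ^ 3)) / u ^ 2 / (1 - u), u, 2 ^ 7 / (c1 * q0), ?_, u0, u1,
    by positivity, ?_⟩
  · have : 0 < 1 - u := by linarith
    positivity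
  intro R k κ j1 hk hj
  set Λ : ℕ := Nat.log 2 ⌈R⌉.toNat + 1 with hΛ
  have hb := Wt_biUnion (E := edgeFinset R) (f := fR R) (Finset.Ico j1 Λ)
    (fun S => S.card < k ∧ ∃ e ∈ S, 2 ^ j1 ≤ lo e) (fun j => Top k (2 ^ j) (2 ^ (j + 1))) (by
      rintro S hS ⟨h1, e, he, h2⟩
      obtain ⟨e', he', hmax⟩ := S.exists_max_image lo ⟨e, he⟩
      have h3 : 2 ^ j1 ≤ lo e' := h2.trans (hmax e he)
      have hpos : 0 < lo e' := lt_of_lt_of_le (by positivity) h3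
      obtain ⟨i, h4, h5⟩ := dyadic hpos
      refine ⟨i, ?_, h1, ⟨e', he', h4, h5⟩, fun e he => (hmax e he).trans_lt h5⟩
      have h6 := pow2_lt (lt_of_le_of_lt h3 h5)
      have h7 := lo_le_E (hS he')
      rw [Finset.mem_Ico]
      refine ⟨by omega, ?_⟩
      have h8 : 2 ^ i ≤ ⌈R⌉.toNat := by zify; omega
      have := Nat.le_log_of_pow_le (by norm_num) h8
      omega)
  refine hb.trans ?_
  have hterm : ∀ j ∈ Finset.Ico j1 Λ, Wt (edgeFinset R) (fR R) (Top k (2 ^ j) (2 ^ (j + 1))) ≤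
      (C * (4 / (c1 ^ 6 * q0 ^ 3)) / u ^ 2 * (2 ^ 7 / (c1 * q0)) ^ κ * al 0 ⌈R⌉ ^ 2) * u ^ j := by
    intro j hjm
    rw [Finset.mem_Ico] at hjm
    refine (W_top R hk (by omega : 2 * κ + 10 ≤ j)).trans ?_
    have e1 : q0 ^ (j / 2 - 3 - κ) = q0 ^ (j / 2) / (q0 ^ 3 * q0 ^ κ) := by
      rw [eq_div_iff (by positivity), ← pow_add, ← pow_add]
      congr 1
      omega
    have e2 : q0 ^ (j / 2) ≤ u ^ j * u ^ j / u ^ 2 := by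
      rw [← u4, ← pow_mul, le_div_iff₀ (by positivity), ← pow_add, ← pow_add]
      exact pow_le_pow_of_le_one u0.le u1.le (by omega)
    rw [e1]
    have e3 : (4 * (2 ^ κ) ^ 7 / c1 ^ (κ + 6) * (q0 ^ (j / 2) / (q0 ^ 3 * q0 ^ κ) * al 0 ⌈R⌉ ^ 2)) =
        (4 / (c1 ^ 6 * q0 ^ 3)) * (2 ^ 7 / (c1 * q0)) ^ κ * al 0 ⌈R⌉ ^ 2 * q0 ^ (j / 2) := by
      rw [div_pow, mul_pow, ← pow_mul, ← pow_mul, pow_add, mul_comm κ 7]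
      field_simp
    rw [e3]
    have h9 := hCj j
    calc _ ≤ ((j : ℝ) + 1) * ((4 / (c1 ^ 6 * q0 ^ 3)) * (2 ^ 7 / (c1 * q0)) ^ κ * al 0 ⌈R⌉ ^ 2 *
          (u ^ j * u ^ j / u ^ 2)) := by gcongr
      _ = (4 / (c1 ^ 6 * q0 ^ 3)) * (2 ^ 7 / (c1 * q0)) ^ κ * al 0 ⌈R⌉ ^ 2 *
          (((j : ℝ) + 1) * u ^ j) * u ^ j / u ^ 2 := by ring
      _ ≤ (4 / (c1 ^ 6 * q0 ^ 3)) * (2 ^ 7 / (c1 * q0)) ^ κ * al 0 ⌈R⌉ ^ 2 *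
          C * u ^ j / u ^ 2 := by gcongr
      _ = _ := by ring
  refine (Finset.sum_le_sum hterm).trans ?_
  rw [← Finset.mul_sum]
  refine (mul_le_mul_of_nonneg_left (geom_Icc u0 u1 j1 Λ) (by positivity)).trans (le_of_eq ?_)
  ring

end DynPerc
end

section
open scoped BigOperators
namespace DynPerc
open Classical

lemma al_pos (n : ℕ) : 0 < al 0 n := by
  have hD : Dep (Cross 0 n) (bigE n) := (Cross_dep 0 n).mono fun e he => ann_bdd he
  rw [al, Pr_eq hD, probOn_eq_sum]
  refine div_pos ?_ (by positivity)
  refine Finset.sum_pos' (fun F _ => by split_ifs <;> norm_num)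
    ⟨bigE n, Finset.mem_powerset_self _, ?_⟩
  have hc : ∀ i : ℕ, i ≤ n → Conn (cfg (bigE n)) ((0 : ℤ), (0 : ℤ)) ((i : ℤ), (0 : ℤ)) := by
    intro i
    induction i with
    | zero => intro _; exact Conn.refl _
    | succ i ih =>
      intro h
      refine Relation.ReflTransGen.tail (ih (by omega)) (Or.inl ⟨?_, ?_⟩)
      · rw [cfg_eq_true, mem_bigE]
        simp only
        omega
      · simp
  have h : Cross 0 n (cfg (bigE n)) := by
    refine cross_of_conn (u := (0, 0)) (v := (n, 0)) ?_ ?_ (hc n le_rfl)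
    · simp [nm]
    · simp [nm]
  rw [if_pos h]
  norm_num

lemma W_small (R : ℝ) (hR : 1 ≤ R) {J : ℕ} (hJ : 3 ≤ J) :
    Wt (edgeFinset R) (fR R) (fun S => ∀ e ∈ S, lo e < 2 ^ J) ≤
      (1 / (c1 * al 0 (2 ^ J))) ^ 2 * al 0 ⌈R⌉ ^ 2 := by
  have hn : 0 ≤ ⌈R⌉ := Int.ceil_nonneg (by linarith)
  have h2 : (0 : ℤ) ≤ 2 ^ J := by positivity
  have hW := W_proj R (p := 0) (a1 := 0) (b1 := 0) (p' := 0) (q' := 0) (a2 := 2 ^ J) (b2 := ⌈R⌉)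
    le_rfl le_rfl le_rfl le_rfl h2 h2 h2 hn hn hn le_rfl
  have hm : Wt (edgeFinset R) (fR R) (fun S => ∀ e ∈ S, lo e < 2 ^ J) ≤
      Wt (edgeFinset R) (fR R) (fun S => ∀ e ∈ S, ¬ ann 0 0 e ∧ ¬ ann (2 ^ J) ⌈R⌉ e) := by
    refine Wt_mono fun S _ h e he => ?_
    have := h e he
    unfold ann
    constructor <;> omega
  have a1 := al_nonneg 0 0
  have a2 := al_le_one 0 0
  have a3 := al_nonneg (2 ^ J) ⌈R⌉
  have hb : al 0 0 * al (2 ^ J) ⌈R⌉ ≤ al (2 ^ J) ⌈R⌉ := mul_le_of_le_one_left a3 a2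
  have hb2 : al 0 0 * al 0 0 ≤ 1 := mul_le_one₀ a2 a1 a2
  have h3 : (al 0 0 * al (2 ^ J) ⌈R⌉) ^ 2 * (al 0 0 * al 0 0) ≤ al (2 ^ J) ⌈R⌉ ^ 2 * 1 := by
    gcongr
  have hp : 0 < al 0 (2 ^ J) := by exact_mod_cast al_pos (2 ^ J)
  have hc := c1_pos
  have hq := al_qm hJ ⌈R⌉
  have hmo : al (2 ^ J) ⌈R⌉ ≤ al (2 ^ (J + 3)) ⌈R⌉ :=
    al_mono (pow_le_pow_right₀ (by norm_num) (by omega)) le_rfl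
  have h4 : al (2 ^ J) ⌈R⌉ ≤ 1 / (c1 * al 0 (2 ^ J)) * al 0 ⌈R⌉ := by
    rw [one_div_mul_eq_div, le_div_iff₀ (by positivity)]
    have : al (2 ^ J) ⌈R⌉ * (c1 * al 0 (2 ^ J)) ≤ al (2 ^ (J + 3)) ⌈R⌉ * (c1 * al 0 (2 ^ J)) := by
      gcongr
    linarith
  have h5 : al (2 ^ J) ⌈R⌉ ^ 2 ≤ (1 / (c1 * al 0 (2 ^ J)) * al 0 ⌈R⌉) ^ 2 := by gcongr
  rw [mul_pow] at h5
  linarith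

lemma spectral_eq (R : ℝ) (Q : Finset Edge → Prop) :
    spectralProb R Q = Wt (edgeFinset R) (fR R) Q / alpha1 R := by
  have hf : ∀ S, fourier R S = fc (edgeFinset R) (fR R) S := by
    intro S
    unfold fourier fc Ex fR
    congr 1
    refine Finset.sum_congr rfl fun F _ => ?_
    by_cases h : ZeroToBoundary R (cfg F) <;> simp [h]
  unfold spectralProb Wt
  congr 1
  refine Finset.sum_congr rfl fun S _ => ?_
  rw [hf]

lemma far_of_not_inBox {r : ℝ} {S : Finset Edge} (h : ¬ InBox r S) :
    ∃ e ∈ S, r ≤ (lo e : ℝ) + 1 := by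
  unfold InBox at h
  push Not at h
  obtain ⟨e, he, h⟩ := h
  refine ⟨e, he, ?_⟩
  by_contra hlt
  push Not at hlt
  have key : ∀ z : ℤ, |z| ≤ lo e → |(z : ℝ)| + 1 < r := by
    intro z hz
    have : ((|z| : ℤ) : ℝ) ≤ (lo e : ℝ) := by exact_mod_cast hz
    rw [Int.cast_abs] at this
    linarith
  have key2 : ∀ z : ℤ, (|z| ≤ lo e ∨ |z + 1| ≤ lo e) → |(z : ℝ) + 1 / 2| < r := by
    rintro z (hz | hz)
    · have h1 := key z hz
      have := abs_add_le (z : ℝ) (1 / 2)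
      rw [abs_of_pos (by norm_num : (0 : ℝ) < 1 / 2)] at this
      linarith
    · have h1 := key _ hz
      have := abs_add_le ((z + 1 : ℤ) : ℝ) (-(1 / 2))
      rw [abs_neg, abs_of_pos (by norm_num : (0 : ℝ) < 1 / 2)] at this
      have e1 : ((z + 1 : ℤ) : ℝ) + -(1 / 2) = (z : ℝ) + 1 / 2 := by push_cast; ring
      rw [e1] at this
      linarith
  obtain ⟨⟨x, y⟩, b⟩ := e
  have hlo : nm (x, y) ≤ lo ((x, y), b) ∨ nm (tl ((x, y), b)) ≤ lo ((x, y), b) := by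
    rw [← min_le_iff]; exact le_rfl
  cases b
  · rw [tl_false] at hlo
    simp only [nm, max_le_iff] at hlo
    have hx := key x (by tauto)
    have hy := key2 y (by tauto)
    have := h (by simp [midpoint]; linarith)
    simp [midpoint] at this
    norm_num at hy
    linarith
  · rw [tl_true] at hlo
    simp only [nm, max_le_iff] at hlo
    have hx := key2 x (by tauto)
    have hy := key y (by tauto)
    have := h (by simpa [midpoint] using hx)
    simp [midpoint] at this
    linarith

lemma log_small {ε D : ℝ} (hε : 0 < ε) (hD : 0 < D) : ∃ k0 : ℕ, ∀ k : ℕ, k0 ≤ k →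
    D * (1 + ((Nat.log 2 k + 1 : ℕ) : ℝ)) ≤ (k : ℝ) ^ ε := by
  have h1 := (isLittleO_log_rpow_atTop hε).def (c := 1 / (4 * D)) (by positivity)
  have h2 := (tendsto_rpow_atTop hε).eventually_ge_atTop (4 * D)
  have h3 := tendsto_natCast_atTop_atTop.eventually
    (h1.and (h2.and (Filter.eventually_ge_atTop (1 : ℝ))))
  obtain ⟨k0, hk0⟩ := Filter.eventually_atTop.1 h3
  refine ⟨k0, fun k hk => ?_⟩
  obtain ⟨a, b, c⟩ := hk0 k hk
  have hk1 : 1 ≤ k := by exact_mod_cast c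
  have hlog0 : 0 ≤ Real.log k := Real.log_nonneg c
  rw [Real.norm_of_nonneg hlog0, Real.norm_of_nonneg (by positivity)] at a
  have hp : ((2 : ℝ)) ^ (Nat.log 2 k) ≤ k := by
    exact_mod_cast Nat.pow_log_le_self 2 (x := k) (by omega)
  have hl := Real.log_le_log (by positivity) hp
  rw [Real.log_pow] at hl
  have hl2 := Real.log_two_gt_d9
  have hnn : (0 : ℝ) ≤ (Nat.log 2 k : ℝ) := by positivity
  have h5 : (Nat.log 2 k : ℝ) ≤ 2 * Real.log k := by nlinarith
  have h6 : Real.log k * (4 * D) ≤ (k : ℝ) ^ ε := by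
    rw [div_mul_eq_mul_div, one_mul, le_div_iff₀ (by positivity)] at a
    exact a
  push_cast
  have h7 : D * (Nat.log 2 k : ℝ) ≤ D * (2 * Real.log k) := by gcongr
  linarith

lemma W_large {ε C v B : ℝ} (hε : 0 < ε) (hC : 0 < C) (hv : 0 < v) (hv1 : v < 1) (hB : 0 < B)
    (H : ∀ (R : ℝ) (k κ j1 : ℕ), k ≤ 2 ^ κ →
    2 * κ + 10 ≤ j1 → Wt (edgeFinset R) (fR R) (fun S => S.card < k ∧ ∃ e ∈ S, 2 ^ j1 ≤ lo e) ≤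
      C * B ^ κ * v ^ j1 * al 0 ⌈R⌉ ^ 2) :
    ∃ k0 : ℕ, ∃ K δ : ℝ, 0 < K ∧ 0 < δ ∧ ∀ k : ℕ, k0 ≤ k → ∀ R : ℝ,
      Wt (edgeFinset R) (fR R) (fun S => S.card < k ∧ ¬ InBox (Real.exp ((k : ℝ) ^ ε)) S) ≤
        K * Real.exp (-(δ * (k : ℝ) ^ ε)) * al 0 ⌈R⌉ ^ 2 := by
  obtain ⟨θ, hθ⟩ : ∃ θ, θ = -Real.log v := ⟨_, rfl⟩
  have hθ0 : 0 < θ := by rw [hθ]; linarith [Real.log_neg hv hv1]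
  obtain ⟨k0, hk0⟩ := log_small (D := 40 + 4 * |Real.log B| / θ) hε (by positivity)
  refine ⟨k0, C * Real.exp θ, θ / 4, by positivity, by positivity, fun k hk R => ?_⟩
  have hx := hk0 k hk
  set κ := Nat.log 2 k + 1 with hκ
  set x := (k : ℝ) ^ ε with hxd
  have hκ0 : (0 : ℝ) ≤ (κ : ℝ) := by positivity
  have hD0 : 0 ≤ 4 * |Real.log B| / θ := by positivity
  have hx1 : 40 * (1 + (κ : ℝ)) ≤ x := by nlinarith
  have hx2 : (κ : ℝ) * |Real.log B| ≤ θ * x / 4 := by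
    have : 4 * |Real.log B| / θ * κ ≤ x := by nlinarith
    rw [div_mul_eq_mul_div, div_le_iff₀ hθ0] at this
    linarith
  set j := ⌊x / 2⌋₊ with hj
  have hj1 : 2 * κ + 10 ≤ j := by
    refine Nat.le_floor ?_
    push_cast
    linarith
  have hj2 : (j : ℝ) ≤ x / 2 := Nat.floor_le (by linarith)
  have hj3 : x / 2 < j + 1 := Nat.lt_floor_add_one _
  have hkk : k ≤ 2 ^ κ := (Nat.lt_pow_succ_log_self (by norm_num) k).le
  refine (Wt_mono ?_).trans ((H R k κ j hkk hj1).trans ?_)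
  · rintro S - ⟨h1, h2⟩
    obtain ⟨e, he, h3⟩ := far_of_not_inBox h2
    refine ⟨h1, e, he, ?_⟩
    have e1 : (2 : ℝ) ≤ Real.exp 1 := by linarith [Real.add_one_le_exp (1 : ℝ)]
    have e2 : (2 : ℝ) ^ (2 * j) ≤ Real.exp x := by
      calc (2 : ℝ) ^ (2 * j) ≤ Real.exp 1 ^ (2 * j) := by gcongr
        _ = Real.exp ((2 * j : ℕ) : ℝ) := by rw [← Real.exp_nat_mul, mul_one]
        _ ≤ _ := by
          refine Real.exp_le_exp.2 ?_
          push_cast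
          linarith
    have e3 : (2 : ℝ) ≤ 2 ^ j := le_self_pow₀ (by norm_num) (by omega)
    have e4 : (2 : ℝ) ^ j + 1 ≤ lo e + 1 := by
      refine le_trans ?_ (e2.trans h3)
      rw [two_mul, pow_add]
      nlinarith
    have e5 : (2 : ℝ) ^ j ≤ lo e := by linarith
    exact_mod_cast e5
  · have f1 : B ^ κ ≤ Real.exp (θ * x / 4) := by
      calc B ^ κ = Real.exp (κ * Real.log B) := by rw [Real.exp_nat_mul, Real.exp_log hB]
        _ ≤ _ := Real.exp_le_exp.2 (le_trans (by gcongr; exact le_abs_self _) hx2)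
    have f2 : v ^ j ≤ Real.exp (θ - θ * x / 2) := by
      calc v ^ j = Real.exp (j * Real.log v) := by rw [Real.exp_nat_mul, Real.exp_log hv]
        _ ≤ _ := Real.exp_le_exp.2 (by
          rw [show Real.log v = -θ by rw [hθ]; ring]
          nlinarith)
    have f3 : C * Real.exp θ * Real.exp (-(θ / 4 * x)) =
        C * Real.exp (θ * x / 4) * Real.exp (θ - θ * x / 2) := by
      rw [mul_assoc, mul_assoc, ← Real.exp_add, ← Real.exp_add]
      congr 2
      ring
    rw [f3]
    gcongr

lemma W_final {ε : ℝ} (hε : 0 < ε) : ∃ K δ : ℝ, 0 < K ∧ 0 < δ ∧ ∀ k : ℕ, ∀ R : ℝ, 1 ≤ R →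
      Wt (edgeFinset R) (fR R) (fun S => S.card < k ∧ ¬ InBox (Real.exp ((k : ℝ) ^ ε)) S) ≤
        K * Real.exp (-(δ * (k : ℝ) ^ ε)) * al 0 ⌈R⌉ ^ 2 := by
  obtain ⟨C, v, B, hC, hv, hv1, hB, H⟩ := W_main
  obtain ⟨k0, K, δ, hK, hδ, h⟩ := W_large hε hC hv hv1 hB H
  set J := 2 * k0 + 10 with hJ
  set K2 := C * B ^ k0 * v ^ J + (1 / (c1 * al 0 (2 ^ J))) ^ 2 with hK2
  have hK20 : 0 ≤ K2 := by positivity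
  refine ⟨K + K2 * Real.exp (δ * (k0 : ℝ) ^ ε), δ, by positivity, hδ, fun k R hR => ?_⟩
  by_cases hk : k0 ≤ k
  · refine (h k hk R).trans ?_
    gcongr
    have : 0 ≤ K2 * Real.exp (δ * (k0 : ℝ) ^ ε) := by positivity
    linarith
  · have h1 := Wt_or (E := edgeFinset R) (f := fR R)
      (fun S => S.card < k ∧ ¬ InBox (Real.exp ((k : ℝ) ^ ε)) S)
      (fun S => S.card < k0 ∧ ∃ e ∈ S, 2 ^ J ≤ lo e) (fun S => ∀ e ∈ S, lo e < 2 ^ J) (by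
        rintro S - ⟨h2, -⟩
        by_cases h3 : ∃ e ∈ S, 2 ^ J ≤ lo e
        · exact Or.inl ⟨by omega, h3⟩
        · push Not at h3
          exact Or.inr h3)
    have h2 := H R k0 k0 J Nat.lt_two_pow_self.le le_rfl
    have h3 := W_small R hR (J := J) (by omega)
    have h4 : (1 : ℝ) ≤ Real.exp (δ * (k0 : ℝ) ^ ε) * Real.exp (-(δ * (k : ℝ) ^ ε)) := by
      rw [← Real.exp_add, Real.one_le_exp_iff]
      have : (k : ℝ) ^ ε ≤ (k0 : ℝ) ^ ε := by
        refine Real.rpow_le_rpow (by positivity) ?_ hε.le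
        exact_mod_cast (by omega : k ≤ k0)
      nlinarith
    calc _ ≤ K2 * 1 * al 0 ⌈R⌉ ^ 2 := by rw [hK2]; linarith
      _ ≤ K2 * (Real.exp (δ * (k0 : ℝ) ^ ε) * Real.exp (-(δ * (k : ℝ) ^ ε))) * al 0 ⌈R⌉ ^ 2 := by
        gcongr
      _ = (0 + K2 * Real.exp (δ * (k0 : ℝ) ^ ε)) * Real.exp (-(δ * (k : ℝ) ^ ε)) *
          al 0 ⌈R⌉ ^ 2 := by ring
      _ ≤ _ := by gcongr

lemma clustering_aux :
    ∀ ε₀ : ℝ, 0 < ε₀ → ∃ C : ℝ, 0 < C ∧ ∀ k : ℕ, 1 ≤ k → ∀ R : ℝ, 1 ≤ R →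
      spectralProb R (fun S =>
          ((S.card : ℝ) < (k : ℝ)) ∧ ¬ InBox (Real.exp ((k : ℝ) ^ ε₀)) S)
        ≤ C * alpha1 R * Real.exp (-((k : ℝ) ^ ε₀) / C) := by
  intro ε hε
  obtain ⟨K, δ, hK, hδ, h⟩ := W_final hε
  refine ⟨max K (1 / δ), lt_max_of_lt_left hK, fun k _ R hR => ?_⟩
  rw [spectral_eq, alpha1_eq]
  have ha := al_nonneg 0 ⌈R⌉
  have hCp : 0 < max K (1 / δ) := lt_max_of_lt_left hK
  refine div_le_of_le_mul₀ ha (by positivity) ?_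
  have h1 : Wt (edgeFinset R) (fR R) (fun S =>
      ((S.card : ℝ) < (k : ℝ)) ∧ ¬ InBox (Real.exp ((k : ℝ) ^ ε)) S) ≤
      K * Real.exp (-(δ * (k : ℝ) ^ ε)) * al 0 ⌈R⌉ ^ 2 := by
    refine (Wt_mono ?_).trans (h k R hR)
    rintro S - ⟨a, b⟩
    exact ⟨by exact_mod_cast a, b⟩
  refine h1.trans ?_
  have h2 : Real.exp (-(δ * (k : ℝ) ^ ε)) ≤ Real.exp (-((k : ℝ) ^ ε) / max K (1 / δ)) := by
    rw [Real.exp_le_exp, neg_div, neg_le_neg_iff, div_le_iff₀ hCp]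
    have h3 : δ * (1 / δ) ≤ δ * max K (1 / δ) := by gcongr; exact le_max_right _ _
    rw [mul_one_div_cancel hδ.ne'] at h3
    have h4 : (0 : ℝ) ≤ (k : ℝ) ^ ε := by positivity
    nlinarith
  calc _ ≤ max K (1 / δ) * Real.exp (-((k : ℝ) ^ ε) / max K (1 / δ)) * al 0 ⌈R⌉ ^ 2 := by
        gcongr
        exact le_max_left _ _
    _ = _ := by ring

end DynPerc
end

namespace DynPerc

/-- **Proposition (clustering, long-range form).**
For every `ε₀ > 0` there is a constant `C = C(ε₀) < ∞` such that for all integers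
`k ≥ 1` and all `R ≥ 1`, the spectral sample `𝒮` of the radial indicator `f_R` of
critical bond percolation on `ℤ²` satisfies
`𝐏̂_{f_R}[ |𝒮| < k, 𝒮 ⊄ (-exp(k^{ε₀}), exp(k^{ε₀}))² ] ≤ C · α₁(R) · exp(-k^{ε₀}/C)`. -/
theorem clustering_long_range :
    ∀ ε₀ : ℝ, 0 < ε₀ → ∃ C : ℝ, 0 < C ∧ ∀ k : ℕ, 1 ≤ k → ∀ R : ℝ, 1 ≤ R →
      spectralProb R (fun S =>
          ((S.card : ℝ) < (k : ℝ)) ∧ ¬ InBox (Real.exp ((k : ℝ) ^ ε₀)) S)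
        ≤ C * alpha1 R * Real.exp (-((k : ℝ) ^ ε₀) / C) := by
  exact clustering_aux

end DynPerc
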